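/- For every positive integer n there exists a bound q_n such that for every finite field k with q elements, if q > q_n then h(GL_n(k)) is an integer. -/

import Mathlib

/-- The set of pairs (χ, d) where χ is the character of an irreducible (simple) complex
representation of `G` and `d` is its degree. Distinct irreducible characters correspond to
distinct isomorphism classes, so this set is in bijection with `Irr(G)`. -/
noncomputable def irrCharDegSet (G : Type) [Group G] : Set ((G → ℂ) × ℕ) :=
  {p | ∃ V : FDRep ℂ G, CategoryTheory.Simple V ∧ p.1 = V.character ∧ p.2 = Module.finrank ℂ V}

/-- `h(G)`: the product of the sizes of all conjugacy classes of `G` divided by the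
product of the degrees of all irreducible complex characters of `G`. -/
noncomputable def groupH (G : Type) [Group G] : ℚ :=
  (∏ᶠ c : ConjClasses G, (c.carrier.ncard : ℚ)) / (∏ᶠ p ∈ irrCharDegSet G, (p.2 : ℚ))

namespace HaradaGL

section

open CategoryTheory Module

section CharacterTheory

variable {G : Type} [Group G] [Fintype G]

/-- The normalized bilinear pairing of complex functions on a finite group. -/
noncomputable def inner (f g : G → ℂ) : ℂ := (Nat.card G : ℂ)⁻¹ * ∑ x, f x * g x⁻¹

/-- Characters of finite-dimensional complex representations. -/
def IsChar (f : G → ℂ) : Prop := ∃ V : FDRep ℂ G, f = V.character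

/-- The set of irreducible characters. -/
def irrSet (G : Type) [Group G] : Set (G → ℂ) := {χ | ∃ V : FDRep ℂ G, Simple V ∧ χ = V.character}

/-- Functions constant on conjugacy classes. -/
def IsClassFun (f : G → ℂ) : Prop := ∀ g h : G, f (h * g * h⁻¹) = f g

omit [Fintype G] in
theorem IsChar.isClassFun {f : G → ℂ} (hf : IsChar f) : IsClassFun f := by
  obtain ⟨V, rfl⟩ := hf
  exact fun g h => V.char_conj g h

omit [Fintype G] in
theorem isChar_of_mem_irrSet {f : G → ℂ} (hf : f ∈ irrSet G) : IsChar f := by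
  obtain ⟨V, -, h⟩ := hf
  exact ⟨V, h⟩

omit [Fintype G] in
theorem IsChar.of_representation {V : Type} [AddCommGroup V] [Module ℂ V] [FiniteDimensional ℂ V]
    (ρ : Representation ℂ G V) : IsChar ρ.character :=
  ⟨FDRep.of ρ, rfl⟩

omit [Fintype G] in
theorem IsChar.mul {f g : G → ℂ} (hf : IsChar f) (hg : IsChar g) : IsChar (f * g) := by
  obtain ⟨V, rfl⟩ := hf
  obtain ⟨W, rfl⟩ := hg
  exact ⟨_, (FDRep.char_tensor V W).symm⟩

omit [Fintype G] in
theorem IsChar.comp {H : Type} [Group H] (φ : H →* G) {f : G → ℂ} (hf : IsChar f) :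
    IsChar (f ∘ φ) := by
  obtain ⟨V, rfl⟩ := hf
  exact IsChar.of_representation (G := H) (MonoidHom.comp V.ρ φ)

omit [Fintype G] in
theorem IsChar.of_hom (θ : G →* ℂ) : IsChar (θ : G → ℂ) := by
  let ρ : Representation ℂ G ℂ := (algebraMap ℂ (Module.End ℂ ℂ)).toMonoidHom.comp θ
  have : (θ : G → ℂ) = ρ.character := by
    ext g
    change θ g = LinearMap.trace ℂ ℂ (algebraMap ℂ (Module.End ℂ ℂ) (θ g))
    rw [Algebra.algebraMap_eq_smul_one, map_smul, LinearMap.trace_one]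
    simp
  rw [this]
  exact IsChar.of_representation ρ

theorem IsChar.inner_nat {f g : G → ℂ} (hf : IsChar f) (hg : IsChar g) :
    ∃ m : ℕ, inner f g = m := by
  obtain ⟨V, rfl⟩ := hf
  obtain ⟨W, rfl⟩ := hg
  have : Invertible (Nat.card G : ℂ) := invertibleOfNonzero (by simp)
  exact ⟨_, FDRep.scalar_product_char_eq_finrank_equivariant W V⟩

open Classical in
theorem inner_irr {f g : G → ℂ} (hf : f ∈ irrSet G) (hg : g ∈ irrSet G) :
    inner f g = if f = g then 1 else 0 := by
  obtain ⟨V, hV, rfl⟩ := hf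
  obtain ⟨W, hW, rfl⟩ := hg
  have : Invertible (Nat.card G : ℂ) := invertibleOfNonzero (by simp)
  have h1 := FDRep.char_orthonormal V W
  have h2 := FDRep.char_orthonormal V V
  rw [if_pos ⟨Iso.refl V⟩] at h2
  by_cases h : Nonempty (V ≅ W)
  · rw [if_pos (FDRep.char_iso h.some)]
    simpa [h, inner] using h1
  · rw [if_neg]
    · simpa [h, inner] using h1
    · intro he
      rw [if_neg h, ← he, h2] at h1
      simp at h1

theorem irrSet_of_isIrreducible {V : Type} [AddCommGroup V] [Module ℂ V] [FiniteDimensional ℂ V]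
    (ρ : Representation ℂ G V) [ρ.IsIrreducible] : ρ.character ∈ irrSet G := by
  refine ⟨FDRep.of ρ, ?_, rfl⟩
  have : Invertible (Nat.card G : ℂ) := invertibleOfNonzero (by simp)
  rw [FDRep.simple_iff_char_is_norm_one]
  have h := Representation.char_orthonormal ρ ρ
  rw [if_pos ⟨Representation.Equiv.refl ρ⟩, inv_mul_eq_one₀ (by simp)] at h
  exact h.symm

open scoped MonoidAlgebra in
/-- Class functions orthogonal to all irreducible characters vanish. -/
theorem eq_zero_of_inner_irr {f : G → ℂ} (hf : IsClassFun f)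
    (h : ∀ χ ∈ irrSet G, inner f χ = 0) : f = 0 := by
  let z : MonoidAlgebra ℂ G := ∑ g, MonoidAlgebra.single g (f g⁻¹)
  have hzc : ∀ a : MonoidAlgebra ℂ G, a * z = z * a := by
    intro a
    induction a using MonoidAlgebra.induction_linear with
    | zero => simp
    | add a b ha hb => rw [add_mul, mul_add, ha, hb]
    | single g r =>
      simp only [z, Finset.mul_sum, Finset.sum_mul, MonoidAlgebra.single_mul_single]
      refine Fintype.sum_equiv ((Equiv.mulLeft g).trans (Equiv.mulRight g⁻¹)) _ _ fun x => ?_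
      have := hf x⁻¹ g
      simp [mul_assoc, ← this, mul_comm]
  have hz : z ∈ Ring.jacobson (MonoidAlgebra ℂ G) := by
    have hM : ∀ m : Submodule (MonoidAlgebra ℂ G) (MonoidAlgebra ℂ G), IsCoatom m → z ∈ m := by
      intro m hm
      let M := MonoidAlgebra ℂ G ⧸ m
      have : IsSimpleModule (MonoidAlgebra ℂ G) M := isSimpleModule_iff_isCoatom.2 hm
      have : FiniteDimensional ℂ M := inferInstance
      let ρ : Representation ℂ G M := Representation.ofModule' M
      have hρ : ∀ a : MonoidAlgebra ℂ G, ∀ v : M, ρ.asAlgebraHom a v = a • v := by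
        intro a v
        change (MonoidAlgebra.lift ℂ (M →ₗ[ℂ] M) G
          ((MonoidAlgebra.lift ℂ (M →ₗ[ℂ] M) G).symm (Algebra.lsmul ℂ ℂ M))) a v = _
        rw [Equiv.apply_symm_apply]
        rfl
      let e : ρ.asModule ≃ₗ[MonoidAlgebra ℂ G] M :=
        { ρ.asModuleEquiv with
          map_smul' := fun a v => hρ a (ρ.asModuleEquiv v) }
      have : ρ.IsIrreducible := by
        rw [Representation.irreducible_iff_isSimpleModule_asModule]
        exact IsSimpleModule.congr e
      have hχ := h _ (irrSet_of_isIrreducible ρ)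
      let Z : Module.End (MonoidAlgebra ℂ G) M :=
        { toFun := fun v => z • v
          map_add' := smul_add z
          map_smul' := fun a v => by rw [RingHom.id_apply, smul_smul, smul_smul, hzc] }
      obtain ⟨t, ht⟩ := (IsSimpleModule.algebraMap_end_bijective_of_isAlgClosed
        (A := MonoidAlgebra ℂ G) (V := M) ℂ).2 Z
      have ht' : ∀ v : M, z • v = t • v := fun v => (LinearMap.congr_fun ht v).symm
      have htr : ∑ g, f g⁻¹ * ρ.character g = t * Module.finrank ℂ M := by
        have h1 : ρ.asAlgebraHom z = t • (1 : Module.End ℂ M) := by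
          ext v
          rw [hρ, ht']
          rfl
        have h2 := congrArg (LinearMap.trace ℂ M) h1
        rw [map_smul, LinearMap.trace_one] at h2
        rw [← smul_eq_mul t, ← h2, map_sum, map_sum]
        refine Finset.sum_congr rfl fun g _ => ?_
        rw [Representation.asAlgebraHom_single, map_smul]
        rfl
      have h0 : ∑ g, f g⁻¹ * ρ.character g = 0 := by
        rw [inner, mul_eq_zero] at hχ
        have := hχ.resolve_left (by simp)
        rw [← this]
        exact Fintype.sum_equiv (Equiv.inv G) _ _ fun g => by simp
      have hM0 : (Module.finrank ℂ M : ℂ) ≠ 0 := by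
        have : Nontrivial M := IsSimpleModule.nontrivial (MonoidAlgebra ℂ G) M
        exact_mod_cast (Module.finrank_pos (R := ℂ) (M := M)).ne'
      have t0 : t = 0 := by
        rw [h0] at htr
        exact (mul_eq_zero.1 htr.symm).resolve_right hM0
      have := ht' (Submodule.Quotient.mk 1)
      rw [t0, zero_smul, ← Submodule.Quotient.mk_smul, smul_eq_mul, mul_one] at this
      exact (Submodule.Quotient.mk_eq_zero m).1 this
    exact (Submodule.mem_sInf).2 hM
  have hz0 : z = 0 := by
    have : Ring.jacobson (MonoidAlgebra ℂ G) = ⊥ := IsSemisimpleModule.jacobson_eq_bot _ _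
    rw [this] at hz
    simpa using hz
  ext g
  classical
  have := congrArg (fun a : MonoidAlgebra ℂ G => a.coeff g⁻¹) hz0
  simpa [z, Finsupp.single_apply, Finsupp.finsetSum_apply] using this

theorem inner_add_left (f₁ f₂ g : G → ℂ) : inner (f₁ + f₂) g = inner f₁ g + inner f₂ g := by
  simp [inner, add_mul, Finset.sum_add_distrib, mul_add]

theorem inner_smul_left (r : ℂ) (f g : G → ℂ) : inner (r • f) g = r * inner f g := by
  simp [inner, Finset.mul_sum]
  exact Finset.sum_congr rfl fun x _ => by ring

theorem inner_sum_left {ι : Type*} (s : Finset ι) (f : ι → G → ℂ) (g : G → ℂ) :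
    inner (∑ i ∈ s, f i) g = ∑ i ∈ s, inner (f i) g := by
  classical
  induction s using Finset.induction_on with
  | empty => simp [inner]
  | insert a s ha ih => rw [Finset.sum_insert ha, inner_add_left, ih, Finset.sum_insert ha]

variable (G) in
theorem linearIndependent_irr : LinearIndependent ℂ (fun χ : irrSet G => (χ : G → ℂ)) := by
  rw [linearIndependent_iff']
  intro s a h χ hχ
  have h1 := congrArg (fun f => inner f (χ : G → ℂ)) h
  simp only [inner_sum_left, inner_smul_left] at h1
  rw [Finset.sum_eq_single χ] at h1
  · rw [inner_irr χ.2 χ.2, if_pos rfl] at h1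
    simpa [inner] using h1
  · intro b _ hb
    rw [inner_irr b.2 χ.2, if_neg (fun h => hb (Subtype.ext h)), mul_zero]
  · exact fun h => absurd hχ h

noncomputable instance : Fintype (irrSet G) :=
  have := (linearIndependent_irr G).finite
  Fintype.ofFinite _

theorem IsClassFun.expand {f : G → ℂ} (hf : IsClassFun f) :
    f = ∑ χ : irrSet G, inner f χ • (χ : G → ℂ) := by
  rw [← sub_eq_zero]
  apply eq_zero_of_inner_irr
  · intro g h
    have : ∀ χ : irrSet G, (χ : G → ℂ) (h * g * h⁻¹) = (χ : G → ℂ) g :=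
      fun χ => (isChar_of_mem_irrSet χ.2).isClassFun g h
    simp [hf g h, this]
  · intro χ hχ
    have : f - ∑ χ : irrSet G, inner f χ • (χ : G → ℂ)
        = f + (-1 : ℂ) • ∑ χ : irrSet G, inner f χ • (χ : G → ℂ) := by simp [sub_eq_add_neg]
    rw [this, inner_add_left, inner_smul_left, inner_sum_left, Finset.sum_eq_single ⟨χ, hχ⟩]
    · rw [inner_smul_left, inner_irr hχ hχ, if_pos rfl]
      ring
    · intro b _ hb
      rw [inner_smul_left, inner_irr b.2 hχ, if_neg (fun h => hb (Subtype.ext h)), mul_zero]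
    · simp

variable (G) in
theorem card_irrSet : Nat.card (irrSet G) = Nat.card (ConjClasses G) := by
  classical
  have : Fintype (ConjClasses G) := Fintype.ofFinite _
  let Φ : (irrSet G → ℂ) →ₗ[ℂ] (ConjClasses G → ℂ) :=
    { toFun := fun a c => ∑ χ : irrSet G, a χ * (χ : G → ℂ) c.exists_rep.choose
      map_add' := fun a b => by ext c; simp [add_mul, Finset.sum_add_distrib]
      map_smul' := fun r a => by ext c; simp [Finset.mul_sum, mul_assoc] }
  have hcl : ∀ f : G → ℂ, IsClassFun f → ∀ g : G,
      f ((ConjClasses.mk g).exists_rep.choose) = f g := by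
    intro f hf g
    have h := (ConjClasses.mk g).exists_rep.choose_spec
    obtain ⟨t, ht⟩ := isConj_iff.1 (ConjClasses.mk_eq_mk_iff_isConj.1 h.symm)
    rw [← ht]
    exact hf g t
  have hinj : Function.Injective Φ := by
    rw [injective_iff_map_eq_zero]
    intro a ha
    have h2 : ∑ χ : irrSet G, a χ • (χ : G → ℂ) = 0 := by
      ext g
      have := congrFun ha (ConjClasses.mk g)
      simp only [Φ, LinearMap.coe_mk, AddHom.coe_mk, Pi.zero_apply] at this
      rw [Finset.sum_apply, Pi.zero_apply, ← this]
      refine Finset.sum_congr rfl fun χ _ => ?_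
      rw [hcl _ (isChar_of_mem_irrSet χ.2).isClassFun]
      rfl
    exact funext (Fintype.linearIndependent_iff.1 (linearIndependent_irr G) a h2)
  have hsurj : Function.Surjective Φ := by
    intro b
    have hf : IsClassFun (fun g : G => b (ConjClasses.mk g)) := by
      intro g h
      exact congrArg b (ConjClasses.mk_eq_mk_iff_isConj.2 (isConj_iff.2 ⟨h, rfl⟩)).symm
    refine ⟨fun χ => inner (fun g : G => b (ConjClasses.mk g)) χ, ?_⟩
    ext c
    have := congrFun hf.expand c.exists_rep.choose
    simp only [Φ, LinearMap.coe_mk, AddHom.coe_mk]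
    rw [Finset.sum_apply] at this
    rw [c.exists_rep.choose_spec] at this
    exact this.symm
  have h := (LinearEquiv.ofBijective Φ ⟨hinj, hsurj⟩).finrank_eq
  rw [Module.finrank_fintype_fun_eq_card, Module.finrank_fintype_fun_eq_card] at h
  rw [Nat.card_eq_fintype_card, Nat.card_eq_fintype_card, h]

/-- Column orthogonality, in weighted form. -/
theorem sum_irr_mul (g h : G) :
    ∑ χ : irrSet G, (χ : G → ℂ) g * (χ : G → ℂ) h⁻¹ = Nat.card {t : G // t * h * t⁻¹ = g} := by
  classical
  let f : G → ℂ := fun x => Nat.card {t : G // t * h * t⁻¹ = x}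
  have hf : IsClassFun f := by
    intro x s
    simp only [f]
    congr 1
    refine Nat.card_congr ((Equiv.mulLeft s⁻¹).subtypeEquiv fun t => ?_)
    simp only [Equiv.coe_mulLeft]
    constructor
    · intro ht
      calc _ = s⁻¹ * (t * h * t⁻¹) * s := by group
        _ = x := by rw [ht]; group
    · intro ht
      calc _ = s * (s⁻¹ * t * h * (s⁻¹ * t)⁻¹) * s⁻¹ := by group
        _ = _ := by rw [ht]
  have hi : ∀ χ : irrSet G, inner f χ = (χ : G → ℂ) h⁻¹ := by
    intro χ
    have h1 : ∀ x, f x = ∑ t : G, if t * h * t⁻¹ = x then (1 : ℂ) else 0 := by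
      intro x
      simp [f, Nat.card_eq_fintype_card, Fintype.card_subtype]
    have h2 : ∑ x, f x * (χ : G → ℂ) x⁻¹ = ∑ t : G, (χ : G → ℂ) h⁻¹ := by
      simp only [h1, Finset.sum_mul]
      rw [Finset.sum_comm]
      refine Finset.sum_congr rfl fun t _ => ?_
      simp only [ite_mul, one_mul, zero_mul, Finset.sum_ite_eq, Finset.mem_univ, if_true]
      rw [← (isChar_of_mem_irrSet χ.2).isClassFun h⁻¹ t]
      group
    rw [inner, h2]
    simp
  change _ = f g
  rw [hf.expand, Finset.sum_apply]
  refine Finset.sum_congr rfl fun χ _ => ?_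
  rw [hi, Pi.smul_apply, smul_eq_mul, mul_comm]

/-- The degree of a character. -/
theorem irr_one (χ : irrSet G) : ∃ d : ℕ, 0 < d ∧ (χ : G → ℂ) 1 = d := by
  obtain ⟨χ, V, hV, rfl⟩ := χ
  refine ⟨Module.finrank ℂ V, ?_, V.char_one⟩
  rw [Nat.pos_iff_ne_zero]
  intro h0
  have h1 := inner_irr (f := V.character) (g := V.character) ⟨V, hV, rfl⟩ ⟨V, hV, rfl⟩
  have : Subsingleton V := Module.finrank_zero_iff.1 h0
  have h2 : V.character = 0 := by
    ext g
    change LinearMap.trace ℂ V (V.ρ g) = 0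
    rw [Subsingleton.elim (V.ρ g) 0, map_zero]
  rw [h2] at h1
  simp [inner] at h1

/-- The degree of an irreducible character as a natural number. -/
noncomputable def degree (χ : irrSet G) : ℕ := (irr_one χ).choose

theorem degree_pos (χ : irrSet G) : 0 < degree χ := (irr_one χ).choose_spec.1

theorem irr_one_eq (χ : irrSet G) : (χ : G → ℂ) 1 = degree χ := (irr_one χ).choose_spec.2

theorem groupH_eq : groupH G = (∏ᶠ c : ConjClasses G, (c.carrier.ncard : ℚ)) /
    ∏ χ : irrSet G, (degree χ : ℚ) := by
  have hset : irrCharDegSet G = Set.range fun χ : irrSet G => ((χ : G → ℂ), degree χ) := by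
    ext ⟨f, d⟩
    constructor
    · rintro ⟨V, hV, h1, h2⟩
      simp only at h1 h2
      refine ⟨⟨f, V, hV, h1⟩, Prod.ext rfl ?_⟩
      have := irr_one_eq (⟨f, V, hV, h1⟩ : irrSet G)
      simp only [h1, FDRep.char_one] at this
      simp only [h1, h2]
      exact_mod_cast this.symm
    · rintro ⟨⟨χ, V, hV, rfl⟩, h⟩
      refine ⟨V, hV, ?_, ?_⟩
      · exact (congrArg Prod.fst h).symm
      · have h2 := irr_one_eq (⟨V.character, V, hV, rfl⟩ : irrSet G)
        simp only [FDRep.char_one] at h2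
        rw [← congrArg Prod.snd h]
        exact_mod_cast h2.symm
  rw [groupH, hset, finprod_mem_range, finprod_eq_prod_of_fintype (M := ℚ) (α := irrSet G)]
  intro a b h
  exact Subtype.ext (congrArg Prod.fst h)

end CharacterTheory

end

section

open Module

section Average

/-- The average of a complex function over a finite type. -/
noncomputable def avg {α : Type*} [Finite α] (f : α → ℂ) : ℂ :=
  letI := Fintype.ofFinite α
  (Nat.card α : ℂ)⁻¹ * ∑ a, f a

variable {α β : Type*} [Finite α] [Finite β]

theorem avg_eq {α : Type*} [Fintype α] (f : α → ℂ) : avg f = (Nat.card α : ℂ)⁻¹ * ∑ a, f a := by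
  unfold avg
  congr!

theorem avg_equiv (e : α ≃ β) (f : β → ℂ) : avg (fun a => f (e a)) = avg f := by
  cases nonempty_fintype α
  cases nonempty_fintype β
  rw [avg_eq, avg_eq, Nat.card_congr e, e.sum_comp]

theorem avg_mul_left (r : ℂ) (f : α → ℂ) : avg (fun a => r * f a) = r * avg f := by
  cases nonempty_fintype α
  simp only [avg_eq, ← Finset.mul_sum]
  ring

theorem avg_mul_right (r : ℂ) (f : α → ℂ) : avg (fun a => f a * r) = avg f * r := by
  simp only [mul_comm _ r, avg_mul_left]

theorem avg_const [Nonempty α] (r : ℂ) : avg (fun _ : α => r) = r := by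
  cases nonempty_fintype α
  simp [avg_eq]

theorem avg_sum {ι : Type*} (s : Finset ι) (f : ι → α → ℂ) :
    avg (fun a => ∑ i ∈ s, f i a) = ∑ i ∈ s, avg (f i) := by
  cases nonempty_fintype α
  simp only [avg_eq]
  rw [Finset.sum_comm, Finset.mul_sum]

theorem avg_prod (f : α × β → ℂ) : avg f = avg fun a => avg fun b => f (a, b) := by
  cases nonempty_fintype α
  cases nonempty_fintype β
  simp only [avg_eq, Fintype.sum_prod_type, Nat.card_prod, ← Finset.mul_sum]
  push_cast
  rw [mul_inv]
  ring

theorem avg_comm (f : α → β → ℂ) :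
    (avg fun a => avg fun b => f a b) = avg fun b => avg fun a => f a b := by
  have h1 := avg_prod fun p : α × β => f p.1 p.2
  have h2 := avg_prod fun p : β × α => f p.2 p.1
  rw [← h1, ← h2, ← avg_equiv (Equiv.prodComm α β)]
  rfl

theorem avg_congr {f g : α → ℂ} (h : ∀ a, f a = g a) : avg f = avg g := congrArg avg (funext h)

theorem avg_surjective {A B : Type*} [AddCommGroup A] [AddCommGroup B] [Finite A] [Finite B]
    (L : A →+ B) (hL : Function.Surjective L) (f : B → ℂ) : avg (fun a => f (L a)) = avg f := by
  classical
  cases nonempty_fintype A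
  cases nonempty_fintype B
  let e := (AddSubgroup.addGroupEquivQuotientProdAddSubgroup (s := L.ker)).trans
    ((QuotientAddGroup.quotientKerEquivOfSurjective L hL).toEquiv.prodCongr (Equiv.refl _))
  have he : ∀ a, (e a).1 = L a := by
    intro a
    change (QuotientAddGroup.quotientKerEquivOfSurjective L hL)
      (AddSubgroup.addGroupEquivQuotientProdAddSubgroup (s := L.ker) a).1 = L a
    rfl
  have h1 := avg_equiv e (fun p => f p.1)
  simp only [he] at h1
  rw [h1, avg_prod]
  exact avg_congr fun b => avg_const (α := L.ker) (f b)

end Average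

section Evaluation

variable {k : Type} [Field k]
variable {V W : Type} [AddCommGroup V] [Module k V]
  [AddCommGroup W] [Module k W]

open Classical in
/-- The value of a class function of `GL n k` at an endomorphism, extended by zero to
endomorphisms which are not invertible or act on a space of another dimension. -/
noncomputable def ev [FiniteDimensional k V] {n : ℕ} (f : GL (Fin n) k → ℂ) (T : End k V) : ℂ :=
  if h : finrank k V = n ∧ IsUnit T then
    f (Units.map (LinearMap.toMatrixAlgEquiv (finBasisOfFinrankEq k V h.1)).toMonoidHom h.2.unit)
  else 0

theorem ev_of_not_isUnit [FiniteDimensional k V] {n : ℕ} (f : GL (Fin n) k → ℂ) {T : End k V}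
    (h : ¬ IsUnit T) : ev f T = 0 := dif_neg fun h' => h h'.2

theorem ev_of_ne [FiniteDimensional k V] {n : ℕ} (f : GL (Fin n) k → ℂ) (T : End k V)
    (h : finrank k V ≠ n) : ev f T = 0 := dif_neg fun h' => h h'.1

theorem ev_basis [FiniteDimensional k V] {n : ℕ} {f : GL (Fin n) k → ℂ} (hf : IsClassFun f)
    (b : Basis (Fin n) k V) (T : (End k V)ˣ) :
    ev f (T : End k V) = f (Units.map (LinearMap.toMatrixAlgEquiv b).toMonoidHom T) := by
  have hn : finrank k V = n := by simp [finrank_eq_card_basis b]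
  rw [ev, dif_pos ⟨hn, T.isUnit⟩]
  set b' := finBasisOfFinrankEq k V hn
  have hT : (T.isUnit).unit = T := by ext; rfl
  rw [hT]
  let P : GL (Fin n) k := ⟨b.toMatrix b', b'.toMatrix b, by simp, by simp⟩
  have h := hf (Units.map (LinearMap.toMatrixAlgEquiv b').toMonoidHom T) P
  rw [← h]
  congr 1
  ext1
  have := basis_toMatrix_mul_linearMap_toMatrix_mul_basis_toMatrix b b' b b' (T : End k V)
  exact this

theorem ev_congr [FiniteDimensional k V] [FiniteDimensional k W] {n : ℕ} {f : GL (Fin n) k → ℂ}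
    (hf : IsClassFun f) (e : V ≃ₗ[k] W) {T : End k V} {S : End k W}
    (h : ∀ v, e (T v) = S (e v)) : ev f T = ev f S := by
  have hS : S = e.conj T := by
    ext w
    simp [LinearEquiv.conj_apply, h]
  have hu : IsUnit T ↔ IsUnit S := by
    rw [hS]
    exact (MulEquiv.isUnit_map (LinearEquiv.conjRingEquiv e)).symm
  by_cases hT : IsUnit T
  · by_cases hn : finrank k V = n
    · let b := finBasisOfFinrankEq k V hn
      have hT' := hu.1 hT
      have h1 := ev_basis hf b hT.unit
      have h2 := ev_basis hf (b.map e) hT'.unit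
      rw [IsUnit.unit_spec] at h1 h2
      rw [h1, h2]
      congr 1
      ext i j
      simp [LinearMap.toMatrixAlgEquiv_apply, ← h]
    · rw [ev_of_ne f T hn, ev_of_ne f S (by rwa [← e.finrank_eq])]
  · rw [ev_of_not_isUnit f hT, ev_of_not_isUnit f (by rwa [← hu])]

theorem ev_toLin' {n : ℕ} {f : GL (Fin n) k → ℂ} (hf : IsClassFun f) (g : GL (Fin n) k) :
    ev f (Matrix.toLin' (g : Matrix (Fin n) (Fin n) k)) = f g := by
  have h := ev_basis hf (Pi.basisFun k (Fin n)) (Matrix.GeneralLinearGroup.toLin g)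
  have h2 : ((Matrix.GeneralLinearGroup.toLin g : LinearMap.GeneralLinearGroup k (Fin n → k)) :
      End k (Fin n → k)) = Matrix.toLin' (g : Matrix (Fin n) (Fin n) k) := rfl
  rw [h2] at h
  rw [h]
  congr 1
  ext1
  exact LinearMap.toMatrix'_toLin' _

end Evaluation

end

section

open Module

section Triangular

variable {k : Type} [Field k]
variable {V₁ V₂ V₃ W₁ W₂ : Type} [AddCommGroup V₁] [Module k V₁] [AddCommGroup V₂] [Module k V₂]
  [AddCommGroup V₃] [Module k V₃]
  [AddCommGroup W₁] [Module k W₁] [AddCommGroup W₂] [Module k W₂]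

/-- The block upper triangular endomorphism of `V₁ × V₂`. -/
def tri (s : End k V₁) (u : V₂ →ₗ[k] V₁) (t : End k V₂) : End k (V₁ × V₂) :=
  (s.coprod u).prod (t.comp (LinearMap.snd k V₁ V₂))

@[simp] theorem tri_apply (s : End k V₁) (u : V₂ →ₗ[k] V₁) (t : End k V₂) (v : V₁ × V₂) :
    tri s u t v = (s v.1 + u v.2, t v.2) := rfl

theorem tri_mul (s s' : End k V₁) (u u' : V₂ →ₗ[k] V₁) (t t' : End k V₂) :
    tri s u t * tri s' u' t' = tri (s * s') (s ∘ₗ u' + u ∘ₗ t') (t * t') := by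
  ext v <;> simp

theorem tri_one : tri (1 : End k V₁) 0 (1 : End k V₂) = 1 := by
  ext v <;> simp

theorem isUnit_tri {s : End k V₁} {u : V₂ →ₗ[k] V₁} {t : End k V₂} (hs : IsUnit s) (ht : IsUnit t) :
    IsUnit (tri s u t) := by
  obtain ⟨s, rfl⟩ := hs
  obtain ⟨t, rfl⟩ := ht
  refine ⟨⟨tri s u t, tri (↑s⁻¹ : End k V₁) (-((↑s⁻¹ : End k V₁) ∘ₗ u ∘ₗ (↑t⁻¹ : End k V₂)))
    (↑t⁻¹ : End k V₂), ?_, ?_⟩, rfl⟩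
  · rw [tri_mul, Units.mul_inv, Units.mul_inv, ← tri_one]
    congr 1
    ext v
    have h : ∀ w, (s : End k V₁) ((↑s⁻¹ : End k V₁) w) = w := fun w => by
      rw [← Module.End.mul_apply, Units.mul_inv, Module.End.one_apply]
    simp [h]
  · rw [tri_mul, Units.inv_mul, Units.inv_mul, ← tri_one]
    congr 1
    ext v
    have h : ∀ w, (↑t⁻¹ : End k V₂) ((t : End k V₂) w) = w := fun w => by
      rw [← Module.End.mul_apply, Units.inv_mul, Module.End.one_apply]
    simp [h]

instance [Finite k] [FiniteDimensional k V₁] [FiniteDimensional k V₂] : Finite (V₁ →ₗ[k] V₂) :=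
  Module.finite_of_finite k

/-- The restriction of a class function to a maximal parabolic subgroup, averaged over the
unipotent radical. -/
noncomputable def res [Finite k] [FiniteDimensional k V₁] [FiniteDimensional k V₂] {n : ℕ}
    (f : GL (Fin n) k → ℂ) (s : End k V₁) (t : End k V₂) : ℂ :=
  avg fun u : V₂ →ₗ[k] V₁ => ev f (tri s u t)

theorem res_congr [Finite k] [FiniteDimensional k V₁] [FiniteDimensional k V₂]
    [FiniteDimensional k W₁] [FiniteDimensional k W₂] {n : ℕ}
    {f : GL (Fin n) k → ℂ} (hf : IsClassFun f) (e₁ : V₁ ≃ₗ[k] W₁) (e₂ : V₂ ≃ₗ[k] W₂)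
    {s : End k V₁} {t : End k V₂} {s' : End k W₁} {t' : End k W₂}
    (h₁ : ∀ v, e₁ (s v) = s' (e₁ v)) (h₂ : ∀ v, e₂ (t v) = t' (e₂ v)) :
    res f s t = res f s' t' := by
  unfold res
  rw [← avg_equiv (LinearEquiv.arrowCongr e₂ e₁).toEquiv]
  refine avg_congr fun u => ?_
  refine ev_congr hf (e₁.prodCongr e₂) fun v => ?_
  simp [h₁, h₂]

end Triangular

section Constants

variable {k : Type} [Field k] [Fintype k]

/-- The linear automorphism given by an invertible matrix. -/
noncomputable def glEquiv {m : ℕ} (g : GL (Fin m) k) : (Fin m → k) ≃ₗ[k] (Fin m → k) :=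
  Matrix.toLin'OfInv (M' := (g : Matrix (Fin m) (Fin m) k))
    (M := ((g⁻¹ : GL (Fin m) k) : Matrix (Fin m) (Fin m) k)) (by rw [← Units.val_mul]; simp)
      (by rw [← Units.val_mul]; simp)

/-- An invertible matrix as an endomorphism. -/
noncomputable def gl {m : ℕ} (g : GL (Fin m) k) : End k (Fin m → k) :=
  Matrix.toLin' (g : Matrix (Fin m) (Fin m) k)

theorem gl_mul {m : ℕ} (g h : GL (Fin m) k) : gl (g * h) = gl g * gl h := by
  rw [gl, Units.val_mul, Matrix.toLin'_mul]
  rfl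

theorem ev_gl {n : ℕ} {f : GL (Fin n) k → ℂ} (hf : IsClassFun f) (g : GL (Fin n) k) :
    ev f (gl g) = f g := ev_toLin' hf g

theorem glEquiv_apply {m : ℕ} (g : GL (Fin m) k) (v : Fin m → k) : glEquiv g v = gl g v := rfl

theorem glEquiv_conj {m : ℕ} (g h : GL (Fin m) k) (v : Fin m → k) :
    glEquiv h (gl g v) = gl (h * g * h⁻¹) (glEquiv h v) := by
  rw [glEquiv_apply, glEquiv_apply, ← Module.End.mul_apply, ← Module.End.mul_apply, ← gl_mul,
    ← gl_mul, inv_mul_cancel_right]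

theorem IsClassFun.res_left {n : ℕ} {f : GL (Fin n) k → ℂ} (hf : IsClassFun f)
    {V₂ : Type} [AddCommGroup V₂] [Module k V₂] [FiniteDimensional k V₂] (t : End k V₂) (m : ℕ) :
    IsClassFun fun g : GL (Fin m) k => res f (gl g) t :=
  fun g h => (res_congr hf (glEquiv h) (LinearEquiv.refl k V₂) (glEquiv_conj g h)
    (fun _ => by simp)).symm

theorem IsClassFun.res_right {n : ℕ} {f : GL (Fin n) k → ℂ} (hf : IsClassFun f)
    {V₁ : Type} [AddCommGroup V₁] [Module k V₁] [FiniteDimensional k V₁] (s : End k V₁) (m : ℕ) :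
    IsClassFun fun g : GL (Fin m) k => res f s (gl g) :=
  fun g h => (res_congr hf (LinearEquiv.refl k V₁) (glEquiv h) (fun _ => by simp)
    (glEquiv_conj g h)).symm

omit [Fintype k] in
theorem exists_gl {V : Type} [AddCommGroup V] [Module k V] [FiniteDimensional k V] {n : ℕ}
    (hn : finrank k V = n) {s : End k V} (hs : IsUnit s) :
    ∃ (e : V ≃ₗ[k] (Fin n → k)) (g : GL (Fin n) k),
      ∀ v, e (s v) = gl g (e v) := by
  let b := finBasisOfFinrankEq k V hn
  refine ⟨b.equivFun, Units.map (LinearMap.toMatrixAlgEquiv b).toMonoidHom hs.unit, fun v => ?_⟩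
  have := LinearMap.toMatrix_mulVec_repr b b s v
  rw [gl, Matrix.toLin'_apply]
  exact this.symm

noncomputable instance (n : ℕ) : Fintype (GL (Fin n) k) := Fintype.ofFinite _

variable (k) in
/-- Irreducible characters of all the groups `GL n k`. -/
def Ir : Type := Σ n, irrSet (GL (Fin n) k)

/-- The rank of the group. -/
def Ir.deg (x : Ir k) : ℕ := x.1

/-- The character as a function. -/
def Ir.fn (x : Ir k) : GL (Fin x.deg) k → ℂ := x.2.1

omit [Fintype k] in
theorem Ir.isChar (x : Ir k) : IsChar x.fn := isChar_of_mem_irrSet x.2.2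

omit [Fintype k] in
theorem Ir.isClassFun (x : Ir k) : IsClassFun x.fn := x.isChar.isClassFun

variable (k) in
/-- The irreducible characters of `GL n k`. -/
noncomputable def lev (n : ℕ) : Finset (Ir k) :=
  Finset.univ.map (⟨fun χ : irrSet (GL (Fin n) k) => (⟨n, χ⟩ : Ir k), fun _ _ h =>
      eq_of_heq (Sigma.mk.inj h).2⟩ : irrSet (GL (Fin n) k) ↪ Ir k)

@[simp] theorem mem_lev {n : ℕ} {x : Ir k} : x ∈ lev k n ↔ x.deg = n := by
  obtain ⟨m, χ⟩ := x
  constructor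
  · intro h
    obtain ⟨y, -, hy⟩ := Finset.mem_map.1 h
    exact (congrArg Ir.deg hy).symm
  · rintro rfl
    exact Finset.mem_map.2 ⟨χ, Finset.mem_univ _, rfl⟩

theorem sum_lev {n : ℕ} (F : Ir k → ℂ) :
    ∑ x ∈ lev k n, F x = ∑ χ : irrSet (GL (Fin n) k), F ⟨n, χ⟩ := by
  rw [lev, Finset.sum_map]
  rfl

open Classical in
variable (k) in
/-- Pairs of irreducible characters of given total rank. -/
noncomputable def pairs (n : ℕ) : Finset (Ir k × Ir k) :=
  (Finset.HasAntidiagonal.antidiagonal n).biUnion fun p => lev k p.1 ×ˢ lev k p.2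

@[simp] theorem mem_pairs {n : ℕ} {p : Ir k × Ir k} :
    p ∈ pairs k n ↔ p.1.deg + p.2.deg = n := by
  simp only [pairs, Finset.mem_biUnion, Finset.HasAntidiagonal.mem_antidiagonal,
      Finset.mem_product, mem_lev]
  constructor
  · rintro ⟨q, hq, h1, h2⟩
    rw [h1, h2, hq]
  · exact fun h => ⟨(p.1.deg, p.2.deg), h, rfl, rfl⟩

theorem sum_pairs_eq {M : Type*} [AddCommMonoid M] {n a b : ℕ} (hn : a + b = n)
    (F : Ir k × Ir k → M)
    (hF : ∀ p, ¬ (p.1.deg = a ∧ p.2.deg = b) → F p = 0) :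
    ∑ p ∈ pairs k n, F p = ∑ y ∈ lev k a, ∑ z ∈ lev k b, F (y, z) := by
  rw [← Finset.sum_product', eq_comm]
  refine Finset.sum_subset (fun p hp => ?_) fun p _ hp => hF p fun h => hp ?_
  · simp only [Finset.mem_product, mem_lev] at hp
    rw [mem_pairs, hp.1, hp.2, hn]
  · simpa using h

/-- The complex structure constants. -/
noncomputable def cst (a b x : Ir k) : ℂ :=
  avg fun s : GL (Fin a.deg) k => avg fun t : GL (Fin b.deg) k =>
    a.fn s⁻¹ * b.fn t⁻¹ * res x.fn (gl s) (gl t)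

theorem avg_eq_inner {G : Type} [Group G] [Fintype G] (f g : G → ℂ) :
    (avg fun s => f s⁻¹ * g s) = inner g f := by
  rw [avg_eq, inner]
  simp only [mul_comm]

theorem ev_irr_of_congr (y : Ir k) {V : Type} [AddCommGroup V] [Module k V] [FiniteDimensional k V]
    {s : End k V} (e : V ≃ₗ[k] (Fin y.deg → k)) {g : GL (Fin y.deg) k}
    (h : ∀ v, e (s v) = gl g (e v)) :
    ev y.fn s = y.fn g := by
  rw [ev_congr y.isClassFun e h, ev_gl y.isClassFun]

theorem res_matrix_eq_sum (x : Ir k) {m n : ℕ} (s : GL (Fin m) k) (t : GL (Fin n) k) :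
    res x.fn (gl s) (gl t) =
      ∑ y : irrSet (GL (Fin m) k), ∑ z : irrSet (GL (Fin n) k),
        cst ⟨m, y⟩ ⟨n, z⟩ x * (y.1 s * z.1 t) := by
  have h1 := congrFun (x.isClassFun.res_left (gl t) m).expand s
  rw [Finset.sum_apply] at h1
  rw [h1]
  refine Finset.sum_congr rfl fun y _ => ?_
  rw [← avg_eq_inner, Pi.smul_apply, smul_eq_mul]
  have h2 : ∀ s : GL (Fin m) k,
      res x.fn (gl s) (gl t) =
      ∑ z : irrSet (GL (Fin n) k), (avg fun t' : GL (Fin n) k => z.1 t'⁻¹ *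
        res x.fn (gl s) (gl t')) * z.1 t := by
    intro s
    have h1 := congrFun (x.isClassFun.res_right (gl s) n).expand t
    rw [Finset.sum_apply] at h1
    rw [h1]
    refine Finset.sum_congr rfl fun z _ => ?_
    rw [← avg_eq_inner]
    rfl
  simp only [h2, Finset.mul_sum]
  rw [avg_sum, Finset.sum_mul]
  refine Finset.sum_congr rfl fun z _ => ?_
  have h3 : cst ⟨m, y⟩ ⟨n, z⟩ x = avg fun s : GL (Fin m) k => y.1 s⁻¹ *
      avg fun t : GL (Fin n) k => z.1 t⁻¹ *
        res x.fn (gl s) (gl t) := by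
    unfold cst
    refine avg_congr fun s => ?_
    rw [← avg_mul_left]
    exact avg_congr fun t => mul_assoc _ _ _
  rw [h3]
  simp only [← mul_assoc, avg_mul_right]
  ring

variable {V₁ V₂ : Type} [AddCommGroup V₁] [Module k V₁] [FiniteDimensional k V₁]
  [AddCommGroup V₂] [Module k V₂] [FiniteDimensional k V₂]

/-- The restriction of an irreducible character to a parabolic subgroup, expanded in products
of irreducible characters. -/
theorem res_eq_sum (x : Ir k) {s : End k V₁} {t : End k V₂} (hs : IsUnit s) (ht : IsUnit t) :
    res x.fn s t = ∑ p ∈ pairs k x.deg, cst p.1 p.2 x * (ev p.1.fn s * ev p.2.fn t) := by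
  by_cases hd : finrank k V₁ + finrank k V₂ = x.deg
  · obtain ⟨e₁, g₁, h₁⟩ := exists_gl rfl hs
    obtain ⟨e₂, g₂, h₂⟩ := exists_gl rfl ht
    rw [res_congr x.isClassFun e₁ e₂ h₁ h₂, res_matrix_eq_sum, sum_pairs_eq hd, sum_lev]
    · refine Finset.sum_congr rfl fun y _ => ?_
      rw [sum_lev]
      refine Finset.sum_congr rfl fun z _ => ?_
      rw [ev_irr_of_congr ⟨_, y⟩ e₁ h₁, ev_irr_of_congr ⟨_, z⟩ e₂ h₂]
      rfl
    · intro p hp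
      by_cases h : finrank k V₁ = p.1.deg
      · rw [ev_of_ne p.2.fn t fun h' => hp ⟨h.symm, h'.symm⟩]
        simp
      · rw [ev_of_ne _ _ h]
        simp
  · rw [Finset.sum_eq_zero]
    · unfold res
      rw [← avg_const (α := V₂ →ₗ[k] V₁) 0]
      exact avg_congr fun u => ev_of_ne _ _ (by rwa [finrank_prod])
    · intro p hp
      rw [mem_pairs] at hp
      by_cases h : finrank k V₁ = p.1.deg
      · rw [ev_of_ne p.2.fn t fun h' => hd (by rw [h, h', hp])]
        simp
      · rw [ev_of_ne _ _ h]
        simp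

end Constants

end

section

open Module

variable {k : Type} [Field k] [Fintype k]

/-- The multiplicity functional of an irreducible character on functions of endomorphisms. -/
noncomputable def pr (a : Ir k) (F : End k (Fin a.deg → k) → ℂ) : ℂ :=
  avg fun s : GL (Fin a.deg) k => a.fn s⁻¹ * F (gl s)

omit [Fintype k] in
theorem isUnit_gl {n : ℕ} (g : GL (Fin n) k) : IsUnit (gl g) :=
  ⟨Matrix.GeneralLinearGroup.toLin g, rfl⟩

theorem pr_congr {a : Ir k} {F F' : End k (Fin a.deg → k) → ℂ}
    (h : ∀ s, IsUnit s → F s = F' s) : pr a F = pr a F' :=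
  avg_congr fun s => by rw [h _ (isUnit_gl s)]

theorem pr_sum {ι : Type*} (a : Ir k) (s : Finset ι) (F : ι → End k (Fin a.deg → k) → ℂ) :
    pr a (fun T => ∑ i ∈ s, F i T) = ∑ i ∈ s, pr a (F i) := by
  simp only [pr, Finset.mul_sum, avg_sum]

theorem pr_mul_left (a : Ir k) (r : ℂ) (F : End k (Fin a.deg → k) → ℂ) :
    pr a (fun T => r * F T) = r * pr a F := by
  simp only [pr, mul_left_comm _ r, avg_mul_left]

theorem pr_mul_right (a : Ir k) (r : ℂ) (F : End k (Fin a.deg → k) → ℂ) :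
    pr a (fun T => F T * r) = pr a F * r := by
  simp only [mul_comm _ r, pr_mul_left]

theorem pr_avg {α : Type*} [Finite α] (a : Ir k) (F : α → End k (Fin a.deg → k) → ℂ) :
    pr a (fun T => avg fun i => F i T) = avg fun i => pr a (F i) := by
  simp only [pr, ← avg_mul_left]
  rw [avg_comm]

theorem pr_comm (a b : Ir k) (F : End k (Fin a.deg → k) → End k (Fin b.deg → k) → ℂ) :
    pr a (fun s => pr b (F s)) = pr b fun t => pr a fun s => F s t := by
  simp only [pr, ← avg_mul_left]
  rw [avg_comm]
  simp only [mul_left_comm]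

open Classical in
theorem pr_ev (a y : Ir k) : pr a (fun s => ev y.fn s) = if y = a then 1 else 0 := by
  by_cases hd : y.deg = a.deg
  · obtain ⟨n, a⟩ := a
    obtain ⟨m, y⟩ := y
    obtain rfl : m = n := hd
    have h : ∀ s : GL (Fin m) k, ev (Ir.fn (k := k) ⟨m, y⟩) (gl s) = y.1 s :=
      ev_gl (Ir.isClassFun (k := k) ⟨m, y⟩)
    change (avg fun s : GL (Fin m) k => a.1 s⁻¹ * ev (Ir.fn (k := k) ⟨m, y⟩) (gl s)) = _
    simp only [h]
    rw [avg_eq_inner, inner_irr y.2 a.2]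
    refine if_congr ⟨fun h => ?_, fun h => ?_⟩ rfl rfl
    · rw [Subtype.ext h]
    · rw [eq_of_heq (Sigma.mk.inj h).2]
  · rw [if_neg fun h => hd (congrArg Ir.deg h)]
    unfold pr
    rw [← avg_const (α := GL (Fin a.deg) k) 0]
    refine avg_congr fun s => ?_
    change a.fn s⁻¹ * ev y.fn (gl s) = 0
    rw [ev_of_ne _ _ (by rw [finrank_fin_fun]; exact Ne.symm hd), mul_zero]

theorem cst_eq_pr (a b x : Ir k) : cst a b x = pr a fun s => pr b fun t => res x.fn s t := by
  simp only [cst, pr, ← avg_mul_left, mul_assoc]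

theorem cst_eq_zero {a b x : Ir k} (h : a.deg + b.deg ≠ x.deg) : cst a b x = 0 := by
  have h0 : ∀ s t, res (V₁ := Fin a.deg → k) (V₂ := Fin b.deg → k) x.fn s t = 0 := by
    intro s t
    unfold res
    rw [← avg_const (α := (Fin b.deg → k) →ₗ[k] (Fin a.deg → k)) 0]
    exact avg_congr fun u => ev_of_ne _ _ (by simpa using h)
  simp only [cst_eq_pr, h0]
  simp [pr, avg_eq]

theorem pr_res_right {V : Type} [AddCommGroup V] [Module k V] [FiniteDimensional k V]
    (x d : Ir k) {S : End k V} (hS : IsUnit S) :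
    pr d (fun r => res x.fn S r) =
      ∑ y ∈ lev k (finrank k V), cst y d x * ev y.fn S := by
  classical
  have h1 : pr d (fun r => res x.fn S r) =
      ∑ p ∈ pairs k x.deg, cst p.1 p.2 x * ev p.1.fn S * (if p.2 = d then 1 else 0) := by
    rw [pr_congr fun r hr => res_eq_sum x hS hr, pr_sum]
    refine Finset.sum_congr rfl fun p _ => ?_
    rw [← pr_ev, ← pr_mul_left]
    simp only [mul_assoc]
  rw [h1]
  by_cases hd : finrank k V + d.deg = x.deg
  · rw [sum_pairs_eq hd]
    · refine Finset.sum_congr rfl fun y _ => ?_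
      rw [Finset.sum_eq_single_of_mem d (by simp)]
      · simp
      · intro z _ hz
        rw [if_neg hz, mul_zero]
    · intro p hp
      by_cases h : p.2 = d
      · rw [ev_of_ne _ _ fun h' => hp ⟨h'.symm, by rw [h]⟩]
        simp
      · rw [if_neg h, mul_zero]
  · rw [Finset.sum_eq_zero, Finset.sum_eq_zero]
    · intro y hy
      rw [cst_eq_zero (by rwa [mem_lev.1 hy]), zero_mul]
    · intro p hp
      by_cases h : p.2 = d
      · subst h
        rw [mem_pairs] at hp
        rw [ev_of_ne _ _ fun h' => hd (by rw [h', hp])]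
        simp
      · rw [if_neg h, mul_zero]

theorem pr_res_left {V : Type} [AddCommGroup V] [Module k V] [FiniteDimensional k V]
    (x d : Ir k) {S : End k V} (hS : IsUnit S) :
    pr d (fun r => res x.fn r S) =
      ∑ y ∈ lev k (finrank k V), cst d y x * ev y.fn S := by
  classical
  have h1 : pr d (fun r => res x.fn r S) =
      ∑ p ∈ pairs k x.deg, cst p.1 p.2 x * ev p.2.fn S * (if p.1 = d then 1 else 0) := by
    rw [pr_congr fun r hr => res_eq_sum x hr hS, pr_sum]
    refine Finset.sum_congr rfl fun p _ => ?_
    rw [← pr_ev, ← pr_mul_left]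
    simp only [mul_assoc, mul_comm (ev p.2.fn S)]
  rw [h1]
  by_cases hd : d.deg + finrank k V = x.deg
  · rw [sum_pairs_eq hd]
    · rw [Finset.sum_eq_single_of_mem d (by simp)]
      · simp
      · intro z _ hz
        simp [if_neg hz]
    · intro p hp
      by_cases h : p.1 = d
      · rw [ev_of_ne _ _ fun h' => hp ⟨by rw [h], h'.symm⟩]
        simp
      · rw [if_neg h, mul_zero]
  · rw [Finset.sum_eq_zero, Finset.sum_eq_zero]
    · intro y hy
      rw [cst_eq_zero (by rwa [mem_lev.1 hy]), zero_mul]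
    · intro p hp
      by_cases h : p.1 = d
      · subst h
        rw [mem_pairs] at hp
        rw [ev_of_ne _ _ fun h' => hd (by rw [h', hp])]
        simp
      · rw [if_neg h, mul_zero]

theorem avg_tri_assoc {V₁ V₂ V₃ : Type} [AddCommGroup V₁] [Module k V₁] [FiniteDimensional k V₁]
    [AddCommGroup V₂] [Module k V₂] [FiniteDimensional k V₂]
    [AddCommGroup V₃] [Module k V₃] [FiniteDimensional k V₃] {n : ℕ} {f : GL (Fin n) k → ℂ}
    (hf : IsClassFun f) (s : End k V₁) (t : End k V₂) (r : End k V₃) :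
    (avg fun u : V₂ →ₗ[k] V₁ => res f (tri s u t) r) =
      avg fun u : V₃ →ₗ[k] V₂ => res f s (tri t u r) := by
  have h1 : ∀ u : V₂ →ₗ[k] V₁, res f (tri s u t) r = avg fun v : V₃ →ₗ[k] V₂ =>
      avg fun w : V₃ →ₗ[k] V₁ => ev f (tri (tri s u t) (w.prod v) r) := by
    intro u
    rw [avg_comm, ← avg_prod (fun p : (V₃ →ₗ[k] V₁) × (V₃ →ₗ[k] V₂) =>
      ev f (tri (tri s u t) (p.1.prod p.2) r)), res,
      ← avg_equiv (LinearMap.prodEquiv k (M := V₃) (M₂ := V₁) (M₃ := V₂)).toEquiv]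
    rfl
  have h2 : ∀ v : V₃ →ₗ[k] V₂, res f s (tri t v r) = avg fun u : V₂ →ₗ[k] V₁ =>
      avg fun w : V₃ →ₗ[k] V₁ => ev f (tri s (u.coprod w) (tri t v r)) := by
    intro v
    rw [← avg_prod (fun p : (V₂ →ₗ[k] V₁) × (V₃ →ₗ[k] V₁) =>
      ev f (tri s (p.1.coprod p.2) (tri t v r))), res,
      ← avg_equiv (LinearMap.coprodEquiv k (M := V₂) (M₂ := V₃) (M₃ := V₁)).toEquiv]
    rfl
  simp only [h1, h2]
  rw [avg_comm]
  refine avg_congr fun v => avg_congr fun u => avg_congr fun w => ?_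
  refine ev_congr hf (LinearEquiv.prodAssoc k V₁ V₂ V₃) fun p => ?_
  simp [add_assoc]

theorem cst_coassoc (a b d x : Ir k) :
    ∑ y ∈ lev k (a.deg + b.deg), cst a b y * cst y d x =
      ∑ z ∈ lev k (b.deg + d.deg), cst b d z * cst a z x := by
  have h1 : ∑ y ∈ lev k (a.deg + b.deg), cst a b y * cst y d x =
      pr a fun s => pr b fun t => pr d fun r =>
        avg fun u : (Fin b.deg → k) →ₗ[k] (Fin a.deg → k) => res x.fn (tri s u t) r := by
    have h : ∀ s t, IsUnit s → IsUnit t → (pr d fun r =>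
        avg fun u : (Fin b.deg → k) →ₗ[k] (Fin a.deg → k) => res x.fn (tri s u t) r) =
        ∑ y ∈ lev k (a.deg + b.deg), cst y d x * res y.fn s t := by
      intro s t hs ht
      rw [pr_avg, avg_congr fun u => pr_res_right x d (isUnit_tri hs ht), avg_sum]
      simp only [avg_mul_left, finrank_prod, finrank_fin_fun]
      rfl
    rw [pr_congr fun s hs => pr_congr fun t ht => h s t hs ht]
    simp only [pr_sum, pr_mul_left, ← cst_eq_pr, mul_comm]
  have h2 : ∑ z ∈ lev k (b.deg + d.deg), cst b d z * cst a z x =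
      pr b fun t => pr d fun r => pr a fun s =>
        avg fun u : (Fin d.deg → k) →ₗ[k] (Fin b.deg → k) => res x.fn s (tri t u r) := by
    have h : ∀ t r, IsUnit t → IsUnit r → (pr a fun s =>
        avg fun u : (Fin d.deg → k) →ₗ[k] (Fin b.deg → k) => res x.fn s (tri t u r)) =
        ∑ z ∈ lev k (b.deg + d.deg), cst a z x * res z.fn t r := by
      intro s t hs ht
      rw [pr_avg, avg_congr fun u => pr_res_left x a (isUnit_tri hs ht), avg_sum]
      simp only [avg_mul_left, finrank_prod, finrank_fin_fun]
      rfl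
    rw [pr_congr fun s hs => pr_congr fun t ht => h s t hs ht]
    simp only [pr_sum, pr_mul_left, ← cst_eq_pr, mul_comm]
  rw [h1, h2, pr_comm]
  refine pr_congr fun t _ => ?_
  rw [pr_comm]
  refine pr_congr fun r _ => pr_congr fun s _ => ?_
  exact avg_tri_assoc x.isClassFun s t r

theorem cst_nat (a b x : Ir k) : ∃ m : ℕ, cst a b x = m := by
  by_cases hd : a.deg + b.deg = x.deg
  · let V₁ := Fin a.deg → k
    let V₂ := Fin b.deg → k
    let P : Subgroup (GL (Fin a.deg) k × GL (Fin b.deg) k × (End k (V₁ × V₂))ˣ) :=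
      { carrier := {p | ∃ u : V₂ →ₗ[k] V₁, (p.2.2 : End k (V₁ × V₂)) = tri (gl p.1) u (gl p.2.1)}
        mul_mem' := by
          rintro p q ⟨u, hu⟩ ⟨v, hv⟩
          refine ⟨gl p.1 ∘ₗ v + u ∘ₗ gl q.2.1, ?_⟩
          simp only [Prod.snd_mul, Prod.fst_mul, Units.val_mul, hu, hv, gl_mul, tri_mul]
        one_mem' := ⟨0, by
          have h1 : ∀ n, gl (1 : GL (Fin n) k) = 1 := fun n => by
            rw [gl, Units.val_one, Matrix.toLin'_one]; rfl
          simp only [Prod.snd_one, Prod.fst_one, Units.val_one, h1, tri_one]⟩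
        inv_mem' := by
          rintro p ⟨u, hu⟩
          have h1 : ∀ n, gl (1 : GL (Fin n) k) = 1 := fun n => by
            rw [gl, Units.val_one, Matrix.toLin'_one]; rfl
          refine ⟨-(gl p.1⁻¹ ∘ₗ u ∘ₗ gl p.2.1⁻¹), ?_⟩
          rw [Prod.snd_inv, Prod.snd_inv]
          refine (Units.inv_eq_of_mul_eq_one_left ?_)
          rw [hu, tri_mul, Prod.fst_inv, Prod.fst_inv, ← gl_mul, ← gl_mul, inv_mul_cancel,
            inv_mul_cancel, h1, h1, ← tri_one]
          congr 1
          ext v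
          have h2 : gl p.2.1⁻¹ * gl p.2.1 = 1 := by rw [← gl_mul, inv_mul_cancel, h1]
          have h3 : ∀ w, gl p.2.1⁻¹ (gl p.2.1 w) = w := fun w => by
            rw [← Module.End.mul_apply, h2, Module.End.one_apply]
          simp [h3] }
    have : Fintype P := Fintype.ofFinite _
    let b₀ := finBasisOfFinrankEq k (V₁ × V₂) (n := x.deg) (by simpa [V₁, V₂] using hd)
    have hA : IsChar fun p : P => a.fn p.1.1 :=
      a.isChar.comp ((MonoidHom.fst _ _).comp P.subtype)
    have hB : IsChar fun p : P => b.fn p.1.2.1 :=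
      b.isChar.comp (((MonoidHom.fst _ _).comp (MonoidHom.snd _ _)).comp P.subtype)
    have hX : IsChar fun p : P => x.fn (Units.map
        (LinearMap.toMatrixAlgEquiv b₀).toMonoidHom p.1.2.2) :=
      x.isChar.comp ((Units.map (LinearMap.toMatrixAlgEquiv b₀).toMonoidHom).comp
        (((MonoidHom.snd _ _).comp (MonoidHom.snd _ _)).comp P.subtype))
    obtain ⟨m, hm⟩ := hX.inner_nat (hA.mul hB)
    refine ⟨m, ?_⟩
    rw [← hm, ← avg_eq_inner]
    let F : (GL (Fin a.deg) k × GL (Fin b.deg) k) × (V₂ →ₗ[k] V₁) → P := fun q =>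
      ⟨(q.1.1, q.1.2, (isUnit_tri (u := q.2) (isUnit_gl q.1.1) (isUnit_gl q.1.2)).unit), q.2, rfl⟩
    have hF : Function.Bijective F := by
      constructor
      · rintro ⟨⟨s, t⟩, u⟩ ⟨⟨s', t'⟩, u'⟩ h
        have h1 := congrArg Subtype.val h
        simp only [F, Prod.mk.injEq] at h1
        obtain ⟨rfl, rfl, h2⟩ := h1
        have h3 : tri (gl s) u (gl t) = tri (gl s) u' (gl t) := congrArg Units.val h2
        have : u = u' := by
          refine LinearMap.ext fun w => ?_
          have := LinearMap.congr_fun h3 (0, w)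
          simpa using congrArg Prod.fst this
        rw [this]
      · rintro ⟨⟨s, t, g⟩, u, hu⟩
        refine ⟨((s, t), u), Subtype.ext ?_⟩
        simp only [F, Prod.mk.injEq, true_and]
        ext1
        exact hu.symm
    rw [← avg_equiv (Equiv.ofBijective F hF), avg_prod, avg_prod, cst]
    refine avg_congr fun s => avg_congr fun t => ?_
    rw [res, ← avg_mul_left]
    refine avg_congr fun u => ?_
    have h := ev_basis x.isClassFun b₀
      (isUnit_tri (u := u) (isUnit_gl s) (isUnit_gl t)).unit
    rw [IsUnit.unit_spec] at h
    rw [h]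
    rfl
  · exact ⟨0, by rw [cst_eq_zero hd, Nat.cast_zero]⟩

end

section

open Module

section Ind

variable {k : Type} [Field k]
variable {V V' A B : Type} [AddCommGroup V] [Module k V] [FiniteDimensional k V]
  [AddCommGroup V'] [Module k V'] [FiniteDimensional k V']
  [AddCommGroup A] [Module k A] [FiniteDimensional k A]
  [AddCommGroup B] [Module k B] [FiniteDimensional k B]

open Classical in
/-- The product of the values of `f` on an invariant subspace and `g` on the quotient. -/
noncomputable def term {m l : ℕ} (f : GL (Fin m) k → ℂ) (g : GL (Fin l) k → ℂ) (T : End k V)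
    (W : Submodule k V) : ℂ :=
  if h : W ≤ W.comap T then ev f (T.restrict h) * ev g (W.mapQ W T h) else 0

variable {m l : ℕ} {f : GL (Fin m) k → ℂ} {g : GL (Fin l) k → ℂ}

theorem term_of_exact (hf : IsClassFun f) (hg : IsClassFun g) {T : End k V} {W : Submodule k V}
    {i : A →ₗ[k] V} {p : V →ₗ[k] B}
    (hi : Function.Injective i) (hp : Function.Surjective p) (hW : LinearMap.range i = W)
    (hex : LinearMap.ker p = W) {s : End k A} {t : End k B}
    (h1 : ∀ a, T (i a) = i (s a)) (h2 : ∀ v, p (T v) = t (p v)) :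
    term f g T W = ev f s * ev g t := by
  subst hW
  have h : LinearMap.range i ≤ (LinearMap.range i).comap T := by
    rintro _ ⟨a, rfl⟩
    exact ⟨s a, (h1 a).symm⟩
  rw [term, dif_pos h]
  congr 1
  · refine (ev_congr hf (LinearEquiv.ofInjective i hi) fun a => Subtype.ext ?_).symm
    exact (h1 a).symm
  · refine ev_congr hg ((Submodule.quotEquivOfEq _ _ hex.symm).trans
      (p.quotKerEquivOfSurjective hp)) fun v => ?_
    induction v using Submodule.Quotient.induction_on with
    | H v => exact h2 v

theorem term_map (hf : IsClassFun f) (hg : IsClassFun g) (e : V ≃ₗ[k] V') {T : End k V}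
    {S : End k V'} (he : ∀ v, e (T v) = S (e v)) (W : Submodule k V) :
    term f g S (W.map (e : V →ₗ[k] V')) = term f g T W := by
  by_cases h : W ≤ W.comap T
  · rw [term.eq_def f g T, dif_pos h]
    refine term_of_exact hf hg (i := (e : V →ₗ[k] V') ∘ₗ W.subtype)
      (p := W.mkQ ∘ₗ (e.symm : V' →ₗ[k] V)) ?_ ?_ ?_ ?_ ?_ ?_
    · exact e.injective.comp W.injective_subtype
    · exact W.mkQ_surjective.comp e.symm.surjective
    · rw [LinearMap.range_comp, Submodule.range_subtype]
    · rw [LinearMap.ker_comp, Submodule.ker_mkQ]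
      exact (Submodule.map_equiv_eq_comap_symm e W).symm
    · exact fun a => (he a).symm
    · intro v
      obtain ⟨v, rfl⟩ := e.surjective v
      simp [← he]
  · rw [term, term, dif_neg h, dif_neg]
    contrapose! h
    intro w hw
    obtain ⟨w', hw', h'⟩ := h ⟨w, hw, rfl⟩
    have : T w = w' := e.injective (by rw [he]; exact h'.symm)
    rw [Submodule.mem_comap, this]
    exact hw'

theorem term_eq_zero {T : End k V} {W : Submodule k V} (h : finrank k W ≠ m) :
    term f g T W = 0 := by
  rw [term]
  split_ifs
  · rw [ev_of_ne _ _ h, zero_mul]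
  · rfl

instance [Finite k] : Finite (Submodule k V) :=
  have : Finite V := Module.finite_of_finite k
  Finite.of_injective (fun W : Submodule k V => (W : Set V)) SetLike.coe_injective

noncomputable instance [Finite k] : Fintype (Submodule k V) :=
  Fintype.ofFinite _

/-- The parabolically induced function. -/
noncomputable def ind [Finite k] (f : GL (Fin m) k → ℂ)
    (g : GL (Fin l) k → ℂ) (T : End k V) : ℂ :=
  ∑ W : Submodule k V, term f g T W

theorem ind_congr [Finite k]
    (hf : IsClassFun f) (hg : IsClassFun g) (e : V ≃ₗ[k] V') {T : End k V}
    {S : End k V'} (he : ∀ v, e (T v) = S (e v)) : ind f g T = ind f g S := by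
  unfold ind
  exact Fintype.sum_equiv (Submodule.orderIsoMapComap e).toEquiv _ _
    fun W => (term_map hf hg e he W).symm

end Ind

section Flag

variable {k : Type} [Field k] [Fintype k]
variable {V₁ V₂ : Type} [AddCommGroup V₁] [Module k V₁] [FiniteDimensional k V₁]
  [AddCommGroup V₂] [Module k V₂] [FiniteDimensional k V₂]

variable (k V₁ V₂) in
/-- The standard subspace. -/
def std : Submodule k (V₁ × V₂) := LinearMap.range (LinearMap.inl k V₁ V₂)

omit [Fintype k] [FiniteDimensional k V₁] [FiniteDimensional k V₂] in
theorem mem_std {v : V₁ × V₂} : v ∈ std k V₁ V₂ ↔ v.2 = 0 := by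
  constructor
  · rintro ⟨w, rfl⟩
    rfl
  · intro h
    exact ⟨v.1, Prod.ext rfl h.symm⟩

omit [Fintype k] [FiniteDimensional k V₁] [FiniteDimensional k V₂] in
theorem finrank_std : finrank k (std k V₁ V₂) = finrank k V₁ :=
  LinearMap.finrank_range_of_inj LinearMap.inl_injective

instance : Finite (End k V₁)ˣ := Finite.of_injective _ Units.val_injective

noncomputable instance : Fintype (End k V₁)ˣ := Fintype.ofFinite _

/-- A block triangular automorphism. -/
noncomputable def triU (p : (End k V₁)ˣ × (End k V₂)ˣ × (V₂ →ₗ[k] V₁)) : (End k (V₁ × V₂))ˣ :=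
  (isUnit_tri (u := p.2.2) p.1.isUnit p.2.1.isUnit).unit

omit [Fintype k] [FiniteDimensional k V₁] [FiniteDimensional k V₂] in
@[simp] theorem triU_val (p : (End k V₁)ˣ × (End k V₂)ˣ × (V₂ →ₗ[k] V₁)) :
    (triU p : End k (V₁ × V₂)) = tri p.1 p.2.2 p.2.1 := rfl

omit [Fintype k] [FiniteDimensional k V₁] [FiniteDimensional k V₂] in
theorem triU_injective : Function.Injective (triU (k := k) (V₁ := V₁) (V₂ := V₂)) := by
  rintro ⟨s, t, u⟩ ⟨s', t', u'⟩ h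
  have h3 : tri (s : End k V₁) u (t : End k V₂) = tri (s' : End k V₁) u' t' := congrArg Units.val h
  have h1 : s = s' := by
    ext w
    simpa using congrArg Prod.fst (LinearMap.congr_fun h3 (w, 0))
  have h2 : t = t' := by
    ext w
    simpa using congrArg Prod.snd (LinearMap.congr_fun h3 (0, w))
  have h4 : u = u' := by
    ext w
    simpa using congrArg Prod.fst (LinearMap.congr_fun h3 (0, w))
  rw [h1, h2, h4]

omit [Fintype k] in
theorem exists_triU {g : (End k (V₁ × V₂))ˣ}
    (h : std k V₁ V₂ ≤ (std k V₁ V₂).comap (g : End k (V₁ × V₂))) : ∃ p, triU p = g := by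
  have h0 : ∀ v, ((g : End k (V₁ × V₂)) (v, 0)).2 = 0 := fun v => mem_std.1 (h (mem_std.2 rfl))
  have hker : ∀ v, (g : End k (V₁ × V₂)) v = 0 → v = 0 := by
    intro v hv
    have := congrArg (↑g⁻¹ : End k (V₁ × V₂)) hv
    rwa [← Module.End.mul_apply, Units.inv_mul, map_zero] at this
  have hsurj : ∀ w, ∃ v, (g : End k (V₁ × V₂)) v = w := by
    intro w
    refine ⟨(↑g⁻¹ : End k (V₁ × V₂)) w, ?_⟩
    rw [← Module.End.mul_apply, Units.mul_inv, Module.End.one_apply]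
  have hadd : ∀ v w, (g : End k (V₁ × V₂)) (v, w) = (g : End k (V₁ × V₂)) (v, 0) +
      (g : End k (V₁ × V₂)) (0, w) := by
    intro v w
    rw [← map_add]
    simp
  have hs : IsUnit (LinearMap.fst k V₁ V₂ ∘ₗ (g : End k (V₁ × V₂)) ∘ₗ LinearMap.inl k V₁ V₂ :
      End k V₁) := by
    rw [LinearMap.isUnit_iff_ker_eq_bot, LinearMap.ker_eq_bot']
    intro v hv
    exact congrArg Prod.fst (hker (v, 0) (Prod.ext hv (h0 v)))
  have ht : IsUnit (LinearMap.snd k V₁ V₂ ∘ₗ (g : End k (V₁ × V₂)) ∘ₗ LinearMap.inr k V₁ V₂ :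
      End k V₂) := by
    rw [LinearMap.isUnit_iff_range_eq_top, LinearMap.range_eq_top]
    intro w
    obtain ⟨⟨a, b⟩, hv⟩ := hsurj (0, w)
    refine ⟨b, ?_⟩
    have := congrArg Prod.snd ((hadd a b).symm.trans hv)
    simpa [h0] using this
  refine ⟨⟨hs.unit, ht.unit, LinearMap.fst k V₁ V₂ ∘ₗ (g : End k (V₁ × V₂)) ∘ₗ
      LinearMap.inr k V₁ V₂⟩, ?_⟩
  ext1
  refine LinearMap.ext fun v => ?_
  obtain ⟨a, b⟩ := v
  rw [hadd]
  simp [h0, Prod.ext_iff]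

omit [Fintype k] in
theorem exists_map_std {W : Submodule k (V₁ × V₂)} (hW : finrank k W = finrank k V₁) :
    ∃ g : (End k (V₁ × V₂))ˣ, (std k V₁ V₂).map (g : End k (V₁ × V₂)) = W := by
  obtain ⟨C, hC⟩ := W.exists_isCompl
  have h1 := Submodule.finrank_add_eq_of_isCompl hC
  rw [finrank_prod, hW] at h1
  let e₁ : V₁ ≃ₗ[k] W := LinearEquiv.ofFinrankEq _ _ hW.symm
  let e₂ : V₂ ≃ₗ[k] C := LinearEquiv.ofFinrankEq _ _ (by omega)
  let e := (e₁.prodCongr e₂).trans (Submodule.prodEquivOfIsCompl W C hC)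
  refine ⟨LinearMap.GeneralLinearGroup.ofLinearEquiv e, ?_⟩
  ext w
  constructor
  · rintro ⟨v, hv, rfl⟩
    have hv : v.2 = 0 := mem_std.1 hv
    change e v ∈ W
    simp [e, hv]
  · intro hw
    refine ⟨(e₁.symm ⟨w, hw⟩, 0), mem_std.2 rfl, ?_⟩
    change e _ = w
    simp [e]

omit [Fintype k] [FiniteDimensional k V₁] [FiniteDimensional k V₂] in
theorem map_std_triU (p : (End k V₁)ˣ × (End k V₂)ˣ × (V₂ →ₗ[k] V₁)) :
    (std k V₁ V₂).map (triU p : End k (V₁ × V₂)) = std k V₁ V₂ := by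
  ext w
  rw [mem_std]
  constructor
  · rintro ⟨v, hv, rfl⟩
    have hv : v.2 = 0 := mem_std.1 hv
    simp [hv]
  · intro hw
    refine ⟨((↑p.1⁻¹ : End k V₁) w.1, 0), mem_std.2 rfl, ?_⟩
    have h : (p.1 : End k V₁) ((↑p.1⁻¹ : End k V₁) w.1) = w.1 := by
      rw [← Module.End.mul_apply, Units.mul_inv, Module.End.one_apply]
    rw [triU_val, tri_apply]
    simp [h, hw, Prod.ext_iff]

omit [Fintype k] in
theorem card_fiber (g : (End k (V₁ × V₂))ˣ) :
    Nat.card {h : (End k (V₁ × V₂))ˣ // (std k V₁ V₂).map (h : End k (V₁ × V₂)) =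
      (std k V₁ V₂).map (g : End k (V₁ × V₂))} =
    Nat.card ((End k V₁)ˣ × (End k V₂)ˣ × (V₂ →ₗ[k] V₁)) := by
  symm
  have hmul : ∀ (a b : (End k (V₁ × V₂))ˣ) (W : Submodule k (V₁ × V₂)),
      W.map ((a * b : (End k (V₁ × V₂))ˣ) : End k (V₁ × V₂)) =
      (W.map (b : End k (V₁ × V₂))).map (a : End k (V₁ × V₂)) :=
    fun a b W => Submodule.map_comp _ _ _
  refine Nat.card_eq_of_bijective (fun p => ⟨g * triU p, by rw [hmul, map_std_triU]⟩) ⟨?_, ?_⟩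
  · intro p q h
    exact triU_injective (mul_left_cancel (congrArg Subtype.val h))
  · rintro ⟨h, hh⟩
    obtain ⟨p, hp⟩ := exists_triU (g := g⁻¹ * h) (by
      rw [← Submodule.map_le_iff_le_comap, hmul, hh, ← hmul, inv_mul_cancel]
      exact (Submodule.map_id _).le)
    exact ⟨p, Subtype.ext (mul_eq_of_eq_inv_mul hp)⟩

/-- Sums over subspaces as sums over the general linear group. -/
theorem sum_submodule (F : Submodule k (V₁ × V₂) → ℂ)
    (hF : ∀ W : Submodule k (V₁ × V₂), finrank k W ≠ finrank k V₁ → F W = 0) :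
    (Nat.card ((End k V₁)ˣ × (End k V₂)ˣ × (V₂ →ₗ[k] V₁)) : ℂ) *
        ∑ W : Submodule k (V₁ × V₂), F W =
      ∑ g : (End k (V₁ × V₂))ˣ, F ((std k V₁ V₂).map (g : End k (V₁ × V₂))) := by
  classical
  rw [← Finset.sum_fiberwise (s := Finset.univ)
    (g := fun g : (End k (V₁ × V₂))ˣ => (std k V₁ V₂).map (g : End k (V₁ × V₂))), Finset.mul_sum]
  refine Finset.sum_congr rfl fun W _ => ?_
  by_cases hW : finrank k W = finrank k V₁
  · rw [Finset.sum_congr rfl fun g hg => congrArg F (Finset.mem_filter.1 hg).2, Finset.sum_const,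
      nsmul_eq_mul]
    congr 2
    obtain ⟨g, rfl⟩ := exists_map_std hW
    rw [← card_fiber g, Nat.card_eq_fintype_card, Fintype.card_subtype]
  · rw [hF W hW, mul_zero, Finset.sum_eq_zero]
    intro g hg
    rw [(Finset.mem_filter.1 hg).2, hF W hW]

/-- The inverse of a block triangular automorphism. -/
noncomputable def triInv : ((End k V₁)ˣ × (End k V₂)ˣ × (V₂ →ₗ[k] V₁)) ≃
    ((End k V₁)ˣ × (End k V₂)ˣ × (V₂ →ₗ[k] V₁)) :=
  Function.Involutive.toPerm
    (fun p => (p.1⁻¹, p.2.1⁻¹, -((↑p.1⁻¹ : End k V₁) ∘ₗ p.2.2 ∘ₗ (↑p.2.1⁻¹ : End k V₂)))) (by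
      rintro ⟨s, t, u⟩
      simp only [inv_inv, Prod.mk.injEq, true_and]
      ext w
      have h1 : ∀ w, (s : End k V₁) ((↑s⁻¹ : End k V₁) w) = w := fun w => by
        rw [← Module.End.mul_apply, Units.mul_inv, Module.End.one_apply]
      have h2 : ∀ w, (↑t⁻¹ : End k V₂) ((t : End k V₂) w) = w := fun w => by
        rw [← Module.End.mul_apply, Units.inv_mul, Module.End.one_apply]
      simp [h1, h2])

omit [Fintype k] [FiniteDimensional k V₁] [FiniteDimensional k V₂] in
theorem triInv_apply (p : (End k V₁)ˣ × (End k V₂)ˣ × (V₂ →ₗ[k] V₁)) : triInv p =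
    (p.1⁻¹, p.2.1⁻¹, -((↑p.1⁻¹ : End k V₁) ∘ₗ p.2.2 ∘ₗ (↑p.2.1⁻¹ : End k V₂))) := rfl

omit [Fintype k] [FiniteDimensional k V₁] [FiniteDimensional k V₂] in
theorem triU_triInv (p : (End k V₁)ˣ × (End k V₂)ˣ × (V₂ →ₗ[k] V₁)) :
    triU (triInv p) = (triU p)⁻¹ := by
  rw [eq_inv_iff_mul_eq_one]
  ext1
  rw [Units.val_mul, triU_val, triU_val, tri_mul, Units.val_one, ← tri_one]
  obtain ⟨s, t, u⟩ := p
  congr 1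
  · exact Units.inv_mul s
  · ext w
    have h2 : ∀ w, (↑t⁻¹ : End k V₂) ((t : End k V₂) w) = w := fun w => by
      rw [← Module.End.mul_apply, Units.inv_mul, Module.End.one_apply]
    simp [triInv_apply, h2]
  · exact Units.inv_mul t

/-- A unit of the endomorphism ring as an automorphism. -/
noncomputable def unitEquiv {V : Type} [AddCommGroup V] [Module k V] (g : (End k V)ˣ) : V ≃ₗ[k] V :=
  LinearMap.GeneralLinearGroup.generalLinearEquiv k V g

omit [Fintype k] in
@[simp] theorem unitEquiv_apply {V : Type} [AddCommGroup V] [Module k V] (g : (End k V)ˣ) (v : V) :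
    unitEquiv g v = (g : End k V) v := rfl

omit [Fintype k] in
theorem unitEquiv_conj {V : Type} [AddCommGroup V] [Module k V] (g h : (End k V)ˣ) (v : V) :
    unitEquiv g ((h : End k V) v) = ((g * h * g⁻¹ : (End k V)ˣ) : End k V) (unitEquiv g v) := by
  simp only [unitEquiv_apply, ← Module.End.mul_apply, ← Units.val_mul]
  rw [inv_mul_cancel_right]

theorem sum_units_mul_ind {m l n : ℕ} {f : GL (Fin m) k → ℂ} {g : GL (Fin l) k → ℂ}
    {x : GL (Fin n) k → ℂ}
    (hf : IsClassFun f) (hg : IsClassFun g) (hx : IsClassFun x) (hm : finrank k V₁ = m) :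
    (avg fun T : (End k (V₁ × V₂))ˣ => ev x (↑T⁻¹ : End k (V₁ × V₂)) *
        ind f g (T : End k (V₁ × V₂))) =
      avg fun s : (End k V₁)ˣ => avg fun t : (End k V₂)ˣ =>
        ev f (↑s⁻¹ : End k V₁) * ev g (↑t⁻¹ : End k V₂) * res x (s : End k V₁) (t : End k V₂) := by
  classical
  have hterm : ∀ T h : (End k (V₁ × V₂))ˣ, ev x (↑(h * T * h⁻¹)⁻¹ : End k (V₁ × V₂)) *
      term f g (↑(h * T * h⁻¹) : End k (V₁ × V₂)) ((std k V₁ V₂).map (h : End k (V₁ × V₂))) =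
      ev x (↑T⁻¹ : End k (V₁ × V₂)) * term f g (T : End k (V₁ × V₂)) (std k V₁ V₂) := by
    intro T h
    have h1 : (h * T * h⁻¹)⁻¹ = h * T⁻¹ * h⁻¹ := by group
    rw [h1, ← ev_congr hx (unitEquiv h) (unitEquiv_conj h T⁻¹),
      ← term_map hf hg (unitEquiv h) (unitEquiv_conj h T)]
    rfl
  have hc : (Nat.card ((End k V₁)ˣ × (End k V₂)ˣ × (V₂ →ₗ[k] V₁)) : ℂ) ≠ 0 :=
    Nat.cast_ne_zero.2 Nat.card_pos.ne'
  have hG : (Nat.card (End k (V₁ × V₂))ˣ : ℂ) ≠ 0 :=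
    Nat.cast_ne_zero.2 Nat.card_pos.ne'
  have : Fintype ((End k V₁)ˣ × (End k V₂)ˣ × (V₂ →ₗ[k] V₁)) := Fintype.ofFinite _
  refine mul_left_cancel₀ hc ?_
  have h1 : (Nat.card ((End k V₁)ˣ × (End k V₂)ˣ × (V₂ →ₗ[k] V₁)) : ℂ) *
      (avg fun T : (End k (V₁ × V₂))ˣ => ev x (↑T⁻¹ : End k (V₁ × V₂)) *
        ind f g (T : End k (V₁ × V₂))) =
      ∑ T : (End k (V₁ × V₂))ˣ, ev x (↑T⁻¹ : End k (V₁ × V₂)) *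
        term f g (T : End k (V₁ × V₂)) (std k V₁ V₂) := by
    rw [← avg_mul_left]
    have h2 : ∀ T : (End k (V₁ × V₂))ˣ,
        (Nat.card ((End k V₁)ˣ × (End k V₂)ˣ × (V₂ →ₗ[k] V₁)) : ℂ) *
          (ev x (↑T⁻¹ : End k (V₁ × V₂)) * ind f g (T : End k (V₁ × V₂))) =
        ∑ h : (End k (V₁ × V₂))ˣ, ev x (↑T⁻¹ : End k (V₁ × V₂)) *
          term f g (T : End k (V₁ × V₂)) ((std k V₁ V₂).map (h : End k (V₁ × V₂))) := by
      intro T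
      rw [ind, mul_left_comm, sum_submodule _ fun W hW => term_eq_zero (hm ▸ hW), Finset.mul_sum]
    simp only [h2, avg_sum]
    rw [Finset.sum_congr rfl fun h _ => ((avg_equiv (MulAut.conj h).toEquiv _).symm.trans
      (avg_congr fun T => hterm T h))]
    rw [Finset.sum_const, nsmul_eq_mul, avg_eq, ← mul_assoc, Finset.card_univ,
      ← Nat.card_eq_fintype_card, mul_inv_cancel₀ hG, one_mul]
  rw [h1]
  have h2 : ∑ T : (End k (V₁ × V₂))ˣ, ev x (↑T⁻¹ : End k (V₁ × V₂)) *
        term f g (T : End k (V₁ × V₂)) (std k V₁ V₂) =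
      ∑ p : (End k V₁)ˣ × (End k V₂)ˣ × (V₂ →ₗ[k] V₁), ev x (↑(triU p)⁻¹ : End k (V₁ × V₂)) *
        (ev f (p.1 : End k V₁) * ev g (p.2.1 : End k V₂)) := by
    have h3 : ∀ p : (End k V₁)ˣ × (End k V₂)ˣ × (V₂ →ₗ[k] V₁),
        ev f (p.1 : End k V₁) * ev g (p.2.1 : End k V₂) =
          term f g (triU p : End k (V₁ × V₂)) (std k V₁ V₂) := by
      intro p
      refine (term_of_exact hf hg (i := LinearMap.inl k V₁ V₂) (p := LinearMap.snd k V₁ V₂)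
        LinearMap.inl_injective LinearMap.snd_surjective rfl ?_ ?_ ?_).symm
      · rw [LinearMap.ker_snd]
        try rfl
      · intro a; simp
      · intro v; simp
    simp only [h3]
    symm
    refine Finset.sum_of_injOn triU triU_injective.injOn (by simp) ?_ (fun _ _ => rfl)
    intro T _ hT
    rw [term, dif_neg, mul_zero]
    intro h
    obtain ⟨p, hp⟩ := exists_triU h
    exact hT ⟨p, by simp, hp⟩
  have h3 : ∀ F : (End k V₁)ˣ × (End k V₂)ˣ × (V₂ →ₗ[k] V₁) → ℂ, ∑ p, F p =
      (Nat.card ((End k V₁)ˣ × (End k V₂)ˣ × (V₂ →ₗ[k] V₁)) : ℂ) * avg F := by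
    intro F
    rw [avg_eq, ← mul_assoc, mul_inv_cancel₀ hc, one_mul]
  rw [h2, ← Equiv.sum_comp triInv, h3]
  congr 1
  rw [avg_prod]
  refine avg_congr fun s => ?_
  rw [avg_prod]
  refine avg_congr fun t => ?_
  rw [res, ← avg_mul_left]
  refine avg_congr fun u => ?_
  rw [triU_triInv, inv_inv]
  exact mul_comm _ _

theorem ind_eq_zero {V : Type} [AddCommGroup V] [Module k V] [FiniteDimensional k V] {m l : ℕ}
    (f : GL (Fin m) k → ℂ) (g : GL (Fin l) k → ℂ) (T : End k V) (h : m + l ≠ finrank k V) :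
    ind f g T = 0 := by
  refine Finset.sum_eq_zero fun W _ => ?_
  by_cases hW : finrank k W = m
  · rw [term]
    split_ifs
    · rw [ev_of_ne g _ fun h' => h ?_, mul_zero]
      rw [← hW, ← h', add_comm, Submodule.finrank_quotient_add_finrank]
    · rfl
  · exact term_eq_zero hW

theorem pr_ind (a b x : Ir k) : pr x (fun T => ind a.fn b.fn T) = cst a b x := by
  by_cases h : a.deg + b.deg = x.deg
  swap
  · rw [cst_eq_zero h, pr, ← avg_const (α := GL (Fin x.deg) k) 0]
    refine avg_congr fun s => ?_
    rw [ind_eq_zero _ _ _ (by simpa using h), mul_zero]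
  let V₁ := Fin a.deg → k
  let V₂ := Fin b.deg → k
  let b₀ := finBasisOfFinrankEq k (V₁ × V₂) (n := x.deg) (by simpa [V₁, V₂] using h)
  have key := sum_units_mul_ind (V₁ := V₁) (V₂ := V₂) a.isClassFun b.isClassFun x.isClassFun
    (finrank_fin_fun k)
  have h1 : cst a b x = avg fun s : (End k V₁)ˣ => avg fun t : (End k V₂)ˣ =>
      ev a.fn (↑s⁻¹ : End k V₁) * ev b.fn (↑t⁻¹ : End k V₂) *
        res x.fn (s : End k V₁) (t : End k V₂) := by
    rw [cst, ← avg_equiv (Matrix.GeneralLinearGroup.toLin (n := Fin a.deg) (R := k)).toEquiv]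
    refine avg_congr fun s => ?_
    rw [← avg_equiv (Matrix.GeneralLinearGroup.toLin (n := Fin b.deg) (R := k)).toEquiv]
    refine avg_congr fun t => ?_
    congr 2
    · rw [← ev_gl a.isClassFun, MulEquiv.toEquiv_eq_coe, MulEquiv.coe_toEquiv, ← map_inv]
      rfl
    · rw [← ev_gl b.isClassFun, MulEquiv.toEquiv_eq_coe, MulEquiv.coe_toEquiv, ← map_inv]
      rfl
  rw [h1, ← key, pr, ← avg_equiv (Units.mapEquiv
    (LinearMap.toMatrixAlgEquiv b₀).toMulEquiv).toEquiv]
  refine avg_congr fun T => ?_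
  congr 1
  · rw [ev_basis x.isClassFun b₀ T⁻¹, map_inv]
    rfl
  · refine (ind_congr a.isClassFun b.isClassFun b₀.equivFun fun v => ?_).symm
    rw [gl, Matrix.toLin'_apply]
    exact (LinearMap.toMatrix_mulVec_repr b₀ b₀ (T : End k (V₁ × V₂)) v).symm

/-- The parabolically induced character as a sum of irreducible characters. -/
theorem ind_eq_sum (a b : Ir k) {V : Type} [AddCommGroup V] [Module k V] [FiniteDimensional k V]
    {T : End k V} (hT : IsUnit T) :
    ind a.fn b.fn T = ∑ x ∈ lev k (finrank k V), cst a b x * ev x.fn T := by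
  obtain ⟨e, g, he⟩ := exists_gl rfl hT
  have hcl : IsClassFun fun g : GL (Fin (finrank k V)) k => ind a.fn b.fn (gl g) :=
    fun g h => (ind_congr a.isClassFun b.isClassFun (glEquiv h) (glEquiv_conj g h)).symm
  rw [ind_congr a.isClassFun b.isClassFun e he, sum_lev]
  have := congrFun hcl.expand g
  rw [Finset.sum_apply] at this
  rw [this]
  refine Finset.sum_congr rfl fun χ _ => ?_
  rw [Pi.smul_apply, smul_eq_mul, ← avg_eq_inner, ev_irr_of_congr ⟨_, χ⟩ e he]
  exact congrArg (· * _) (pr_ind a b ⟨_, χ⟩)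

/-- The number of flags. -/
theorem card_mul_card_submodule :
    (Nat.card ((End k V₁)ˣ × (End k V₂)ˣ × (V₂ →ₗ[k] V₁)) : ℂ) *
      Nat.card {W : Submodule k (V₁ × V₂) // finrank k W = finrank k V₁} =
      Nat.card (End k (V₁ × V₂))ˣ := by
  classical
  have := sum_submodule (k := k) (V₁ := V₁) (V₂ := V₂)
    (fun W => if finrank k W = finrank k V₁ then 1 else 0) (fun W hW => if_neg hW)
  rw [Finset.sum_boole, ← Fintype.card_subtype, ← Nat.card_eq_fintype_card] at this
  rw [this, Finset.sum_congr rfl fun g _ => if_pos ?_]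
  · simp [Nat.card_eq_fintype_card]
  · rw [← finrank_std (k := k) (V₁ := V₁) (V₂ := V₂)]
    exact LinearEquiv.finrank_map_eq (unitEquiv g) _

end Flag

end

section

open Module

section Hopf

variable {k : Type} [Field k]
variable {V₁ V₂ : Type} [AddCommGroup V₁] [Module k V₁] [FiniteDimensional k V₁]
  [AddCommGroup V₂] [Module k V₂] [FiniteDimensional k V₂]

/-- The shear of a product of subspaces. -/
def shear (W₁ : Submodule k V₁) (W₂ : Submodule k V₂) (Φ : V₂ →ₗ[k] V₁) : Submodule k (V₁ × V₂) :=
  (W₁.prod W₂).comap (tri 1 (-Φ) 1)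

omit [FiniteDimensional k V₁] [FiniteDimensional k V₂] in
theorem mem_shear {W₁ : Submodule k V₁} {W₂ : Submodule k V₂} {Φ : V₂ →ₗ[k] V₁} {v : V₁ × V₂} :
    v ∈ shear W₁ W₂ Φ ↔ v.1 - Φ v.2 ∈ W₁ ∧ v.2 ∈ W₂ := by
  simp [shear, Submodule.mem_prod, sub_eq_add_neg]

omit [FiniteDimensional k V₁] [FiniteDimensional k V₂] in
theorem comap_shear (W₁ : Submodule k V₁) (W₂ : Submodule k V₂) (Φ : V₂ →ₗ[k] V₁) :
    (shear W₁ W₂ Φ).comap (LinearMap.inl k V₁ V₂) = W₁ := by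
  ext v
  simp [mem_shear]

omit [FiniteDimensional k V₁] [FiniteDimensional k V₂] in
theorem map_shear (W₁ : Submodule k V₁) (W₂ : Submodule k V₂) (Φ : V₂ →ₗ[k] V₁) :
    (shear W₁ W₂ Φ).map (LinearMap.snd k V₁ V₂) = W₂ := by
  ext v
  constructor
  · rintro ⟨w, hw, rfl⟩
    exact (mem_shear.1 hw).2
  · intro hv
    exact ⟨(Φ v, v), mem_shear.2 ⟨by simp, hv⟩, rfl⟩

omit [FiniteDimensional k V₁] [FiniteDimensional k V₂] in
theorem exists_shear (W : Submodule k (V₁ × V₂)) :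
    ∃ Φ, shear (W.comap (LinearMap.inl k V₁ V₂)) (W.map (LinearMap.snd k V₁ V₂)) Φ = W := by
  set W₂ := W.map (LinearMap.snd k V₁ V₂) with hW₂
  let p : W →ₗ[k] W₂ := (LinearMap.snd k V₁ V₂).restrict fun w hw => ⟨w, hw, rfl⟩
  have hp : LinearMap.range p = ⊤ := by
    rw [LinearMap.range_eq_top]
    rintro ⟨_, w, hw, rfl⟩
    exact ⟨⟨w, hw⟩, rfl⟩
  obtain ⟨σ, hσ⟩ := p.exists_rightInverse_of_surjective hp
  obtain ⟨Φ, hΦ⟩ := LinearMap.exists_extend (LinearMap.fst k V₁ V₂ ∘ₗ W.subtype ∘ₗ σ)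
  refine ⟨Φ, ?_⟩
  have h1 : ∀ w, w ∈ W₂ → (Φ w, w) ∈ W := by
    intro w hw
    have h2 : Φ w = (σ ⟨w, hw⟩ : V₁ × V₂).1 := LinearMap.congr_fun hΦ ⟨w, hw⟩
    have h3 : (σ ⟨w, hw⟩ : V₁ × V₂).2 = w := congrArg Subtype.val (LinearMap.congr_fun hσ ⟨w, hw⟩)
    have h4 : (Φ w, w) = (σ ⟨w, hw⟩ : V₁ × V₂) := Prod.ext h2 h3.symm
    rw [h4]
    exact (σ ⟨w, hw⟩).2
  ext v
  rw [mem_shear]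
  have h5 : ∀ w, v = (Φ w, w) + (v.1 - Φ w, v.2 - w) := fun w => by
    ext <;> simp
  constructor
  · rintro ⟨h2, h3⟩
    rw [h5 v.2, sub_self]
    exact W.add_mem (h1 _ h3) h2
  · intro hv
    have h3 : v.2 ∈ W₂ := ⟨v, hv, rfl⟩
    refine ⟨?_, h3⟩
    have h2 := W.sub_mem hv (h1 _ h3)
    rw [Submodule.mem_comap]
    convert h2 using 1
    ext <;> simp

omit [FiniteDimensional k V₁] [FiniteDimensional k V₂] in
theorem shear_eq_shear {W₁ : Submodule k V₁} {W₂ : Submodule k V₂} {Φ Ψ : V₂ →ₗ[k] V₁} :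
    shear W₁ W₂ Ψ = shear W₁ W₂ Φ ↔ Ψ - Φ ∈ Submodule.compatibleMaps W₂ W₁ := by
  constructor
  · intro h w hw
    have h1 : (Ψ w, w) ∈ shear W₁ W₂ Φ := by
      rw [← h, mem_shear]
      exact ⟨by simp, hw⟩
    exact (mem_shear.1 h1).1
  · intro h
    ext v
    rw [mem_shear, mem_shear, and_congr_left]
    intro hv
    have h1 : Ψ v.2 - Φ v.2 ∈ W₁ := h hv
    rw [show v.1 - Φ v.2 = (v.1 - Ψ v.2) + (Ψ v.2 - Φ v.2) by abel, W₁.add_mem_iff_left h1]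

instance [Finite k] {A B : Type} [AddCommGroup A] [Module k A] [FiniteDimensional k A]
    [AddCommGroup B] [Module k B] [FiniteDimensional k B] (H : Submodule k (A →ₗ[k] B)) :
        Finite H :=
  Finite.of_injective _ Subtype.val_injective

theorem sum_submodule_prod [Finite k] (F : Submodule k (V₁ × V₂) → ℂ) :
    ∑ W : Submodule k (V₁ × V₂), F W = ∑ W₁ : Submodule k V₁, ∑ W₂ : Submodule k V₂,
      (Nat.card (V₂ →ₗ[k] V₁) : ℂ) / Nat.card (Submodule.compatibleMaps W₂ W₁) *
        avg fun Φ : V₂ →ₗ[k] V₁ => F (shear W₁ W₂ Φ) := by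
  classical
  have : Fintype (V₂ →ₗ[k] V₁) := Fintype.ofFinite _
  rw [← Finset.sum_fiberwise (s := Finset.univ)
    (g := fun W : Submodule k (V₁ × V₂) => W.comap (LinearMap.inl k V₁ V₂))]
  refine Finset.sum_congr rfl fun W₁ _ => ?_
  rw [← Finset.sum_fiberwise
    (g := fun W : Submodule k (V₁ × V₂) => W.map (LinearMap.snd k V₁ V₂))]
  refine Finset.sum_congr rfl fun W₂ _ => ?_
  have hH : (Nat.card (Submodule.compatibleMaps W₂ W₁) : ℂ) ≠ 0 :=
    Nat.cast_ne_zero.2 Nat.card_pos.ne'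
  have hA : (Nat.card (V₂ →ₗ[k] V₁) : ℂ) ≠ 0 := Nat.cast_ne_zero.2 Nat.card_pos.ne'
  rw [avg_eq, ← mul_assoc, div_mul_eq_mul_div, mul_inv_cancel₀ hA, eq_comm, div_mul_eq_mul_div,
      one_mul,
    div_eq_iff hH, Finset.sum_mul]
  rw [← Finset.sum_fiberwise_of_maps_to (s := Finset.univ)
    (t := (Finset.univ.filter fun W : Submodule k (V₁ × V₂) =>
      W.comap (LinearMap.inl k V₁ V₂) = W₁).filter fun W => W.map (LinearMap.snd k V₁ V₂) = W₂)
    (g := fun Φ => shear W₁ W₂ Φ)]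
  · refine Finset.sum_congr rfl fun W hW => ?_
    simp only [Finset.mem_filter, Finset.mem_univ, true_and] at hW
    obtain ⟨h1, h2⟩ := hW
    obtain ⟨Φ, hΦ⟩ := exists_shear W
    rw [h1, h2] at hΦ
    rw [Finset.sum_congr rfl fun Ψ hΨ => congrArg F (Finset.mem_filter.1 hΨ).2, Finset.sum_const,
      nsmul_eq_mul, mul_comm]
    congr 2
    rw [← Fintype.card_subtype, ← Nat.card_eq_fintype_card]
    refine Nat.card_congr ((Equiv.subRight Φ).subtypeEquiv fun Ψ => ?_)
    rw [← hΦ, shear_eq_shear]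
    rfl
  · intro Φ _
    simp [comap_shear, map_shear]

omit [FiniteDimensional k V₁] [FiniteDimensional k V₂] in
/-- Compatible maps restrict to arbitrary pairs of maps. -/
theorem exists_compatible {W₁ : Submodule k V₁} {W₂ : Submodule k V₂} (α : W₂ →ₗ[k] W₁)
    (β : (V₂ ⧸ W₂) →ₗ[k] (V₁ ⧸ W₁)) : ∃ (u : V₂ →ₗ[k] V₁) (h : W₂ ≤ W₁.comap u),
      u.restrict h = α ∧ W₂.mapQ W₁ u h = β := by
  obtain ⟨π, hπ⟩ := W₂.subtype.exists_leftInverse_of_injective W₂.ker_subtype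
  obtain ⟨τ, hτ⟩ := W₁.mkQ.exists_rightInverse_of_surjective W₁.range_mkQ
  have h1 : ∀ w : W₂, π w = w := fun w => LinearMap.congr_fun hπ w
  have h2 : ∀ v : V₁ ⧸ W₁, W₁.mkQ (τ v) = v := fun v => LinearMap.congr_fun hτ v
  let u : V₂ →ₗ[k] V₁ := W₁.subtype ∘ₗ α ∘ₗ π + τ ∘ₗ β ∘ₗ W₂.mkQ
  have h3 : ∀ w : W₂, u w = α w := by
    intro w
    have : W₂.mkQ w = 0 := (Submodule.Quotient.mk_eq_zero _).2 w.2
    simp only [u, LinearMap.add_apply, LinearMap.comp_apply, h1, this, map_zero, add_zero]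
    rfl
  have h : W₂ ≤ W₁.comap u := fun w hw => by
    rw [Submodule.mem_comap, h3 ⟨w, hw⟩]
    exact (α _).2
  refine ⟨u, h, LinearMap.ext fun w => Subtype.ext (h3 w), ?_⟩
  refine Submodule.linearMap_qext _ (LinearMap.ext fun v => ?_)
  change W₁.mkQ (u v) = β (W₂.mkQ v)
  have : W₁.mkQ (α (π v) : V₁) = 0 := (Submodule.Quotient.mk_eq_zero _).2 (α (π v)).2
  simp only [u, LinearMap.add_apply, LinearMap.comp_apply, map_add, h2]
  rw [Submodule.subtype_apply, this, zero_add]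

theorem avg_eq_avg_of_support {A : Type} [AddCommGroup A] [Module k A] [Finite A]
    (H : Submodule k A) (F : A → ℂ) (hF : ∀ a, a ∉ H → F a = 0) :
    (Nat.card A : ℂ) / Nat.card H * avg F = avg fun a : H => F a := by
  classical
  have : Fintype A := Fintype.ofFinite _
  have hA : (Nat.card A : ℂ) ≠ 0 := Nat.cast_ne_zero.2 Nat.card_pos.ne'
  rw [avg_eq, avg_eq, div_mul_eq_mul_div, ← mul_assoc, mul_inv_cancel₀ hA, one_mul, div_eq_inv_mul]
  congr 1
  symm
  refine Finset.sum_of_injOn Subtype.val Subtype.val_injective.injOn (by simp) ?_ (fun _ _ => rfl)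
  intro a _ ha
  exact hF a fun h => ha ⟨⟨a, h⟩, by simp, rfl⟩

variable {m l : ℕ} {f : GL (Fin m) k → ℂ} {g : GL (Fin l) k → ℂ}

theorem term_shear (hf : IsClassFun f) (hg : IsClassFun g) (s : End k V₁) (t : End k V₂)
    (u Φ : V₂ →ₗ[k] V₁) (W₁ : Submodule k V₁) (W₂ : Submodule k V₂) :
    term f g (tri s u t) (shear W₁ W₂ Φ) =
      term f g (tri s (u + (s ∘ₗ Φ - Φ ∘ₗ t)) t) (W₁.prod W₂) := by
  let e := unitEquiv (triU (1, 1, -Φ) : (End k (V₁ × V₂))ˣ)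
  have he : ∀ v, e (tri s u t v) = tri s (u + (s ∘ₗ Φ - Φ ∘ₗ t)) t (e v) := by
    intro v
    simp only [e, unitEquiv_apply, triU_val, tri_apply, Units.val_one, Module.End.one_apply]
    ext
    · simp
      abel
    · simp
  rw [← term_map hf hg e he]
  congr 1
  ext v
  constructor
  · rintro ⟨w, hw, rfl⟩
    exact hw
  · intro hv
    obtain ⟨w, rfl⟩ := e.surjective v
    exact ⟨w, hv, rfl⟩

open Classical in
/-- The restriction of an induced function. -/
theorem avg_ind [Finite k] (hf : IsClassFun f) (hg : IsClassFun g) (s : End k V₁) (t : End k V₂) :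
    (avg fun u : V₂ →ₗ[k] V₁ => ind f g (tri s u t)) =
      ∑ W₁ : Submodule k V₁, ∑ W₂ : Submodule k V₂,
        if h : W₁ ≤ W₁.comap s ∧ W₂ ≤ W₂.comap t then
          res f (s.restrict h.1) (t.restrict h.2) *
            res g (W₁.mapQ W₁ s h.1) (W₂.mapQ W₂ t h.2) else 0 := by
  simp only [ind, sum_submodule_prod]
  rw [avg_sum]
  refine Finset.sum_congr rfl fun W₁ _ => ?_
  rw [avg_sum]
  refine Finset.sum_congr rfl fun W₂ _ => ?_
  rw [avg_mul_left, avg_comm]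
  simp only [term_shear hf hg]
  have hs : ∀ Φ : V₂ →ₗ[k] V₁,
      (avg fun u => term f g (tri s (u + (s ∘ₗ Φ - Φ ∘ₗ t)) t) (W₁.prod W₂)) =
        avg fun u => term f g (tri s u t) (W₁.prod W₂) := fun Φ =>
    avg_equiv (Equiv.addRight _) fun u => term f g (tri s u t) (W₁.prod W₂)
  simp only [hs]
  rw [avg_const]
  split_ifs with h
  · rw [avg_eq_avg_of_support]
    · have h1 : ∀ u : Submodule.compatibleMaps W₂ W₁, term f g (tri s u t) (W₁.prod W₂) =
          ev f (tri (s.restrict h.1) ((u : V₂ →ₗ[k] V₁).restrict u.2) (t.restrict h.2)) *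
          ev g (tri (W₁.mapQ W₁ s h.1) (W₂.mapQ W₁ u u.2) (W₂.mapQ W₂ t h.2)) := by
        intro u
        refine term_of_exact hf hg (i := W₁.subtype.prodMap W₂.subtype)
          (p := W₁.mkQ.prodMap W₂.mkQ) ?_ ?_ ?_ ?_ ?_ ?_
        · exact Function.Injective.prodMap W₁.injective_subtype W₂.injective_subtype
        · exact Function.Surjective.prodMap W₁.mkQ_surjective W₂.mkQ_surjective
        · rw [LinearMap.range_prodMap, W₁.range_subtype, W₂.range_subtype]
        · rw [LinearMap.ker_prodMap, W₁.ker_mkQ, W₂.ker_mkQ]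
        · intro a
          rfl
        · intro v
          rfl
      simp only [h1]
      let L : Submodule.compatibleMaps W₂ W₁ →+
          ((W₂ →ₗ[k] W₁) × ((V₂ ⧸ W₂) →ₗ[k] (V₁ ⧸ W₁))) :=
        { toFun := fun u => ((u : V₂ →ₗ[k] V₁).restrict u.2, W₂.mapQ W₁ u u.2)
          map_zero' := by
            refine Prod.ext (by ext; rfl) (by ext; rfl)
          map_add' := fun u v => by
            refine Prod.ext (by ext; rfl) (by ext; rfl) }
      have hL : Function.Surjective L := by
        rintro ⟨α, β⟩
        obtain ⟨u, h, h1, h2⟩ := exists_compatible α β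
        exact ⟨⟨u, h⟩, Prod.ext h1 h2⟩
      have h2 := avg_surjective L hL fun p => ev f (tri (s.restrict h.1) p.1 (t.restrict h.2)) *
          ev g (tri (W₁.mapQ W₁ s h.1) p.2 (W₂.mapQ W₂ t h.2))
      rw [avg_prod] at h2
      refine h2.trans ?_
      simp only [avg_mul_left, avg_mul_right]
      rfl
    · intro u hu
      rw [term, dif_neg]
      intro h'
      refine hu fun w hw => ?_
      have : ((0 : V₁), w) ∈ W₁.prod W₂ := ⟨W₁.zero_mem, hw⟩
      simpa using (h' this).1
  · rw [avg_congr (g := fun _ => 0), avg_const, mul_zero]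
    intro u
    rw [term, dif_neg]
    intro h'
    refine h ⟨fun w hw => ?_, fun w hw => ?_⟩
    · have : (w, (0 : V₂)) ∈ W₁.prod W₂ := ⟨hw, W₂.zero_mem⟩
      simpa using (h' this).1
    · have : ((0 : V₁), w) ∈ W₁.prod W₂ := ⟨W₁.zero_mem, hw⟩
      simpa using (h' this).2

end Hopf

section

variable {k : Type} [Field k]

theorem isUnit_restrict {V : Type} [AddCommGroup V] [Module k V] [FiniteDimensional k V]
    {s : End k V} (hs : IsUnit s) {W : Submodule k V} (h : W ≤ W.comap s) :
    IsUnit (s.restrict h : End k W) := by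
  rw [LinearMap.isUnit_iff_ker_eq_bot, LinearMap.ker_eq_bot] at hs ⊢
  exact fun v w hvw => Subtype.ext (hs (congrArg Subtype.val hvw))

theorem isUnit_mapQ {V : Type} [AddCommGroup V] [Module k V] [FiniteDimensional k V]
    {s : End k V} (hs : IsUnit s) {W : Submodule k V} (h : W ≤ W.comap s) :
    IsUnit (W.mapQ W s h : End k (V ⧸ W)) := by
  rw [LinearMap.isUnit_iff_range_eq_top, LinearMap.range_eq_top] at hs ⊢
  intro v
  obtain ⟨v, rfl⟩ := W.mkQ_surjective v
  obtain ⟨w, rfl⟩ := hs v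
  exact ⟨W.mkQ w, rfl⟩

variable [Fintype k]

theorem avg_ind_eq_sum (a b : Ir k) {V₁ V₂ : Type} [AddCommGroup V₁] [Module k V₁]
    [FiniteDimensional k V₁] [AddCommGroup V₂] [Module k V₂] [FiniteDimensional k V₂]
    {s : End k V₁} {t : End k V₂} (hs : IsUnit s) (ht : IsUnit t) :
    (avg fun u : V₂ →ₗ[k] V₁ => ind a.fn b.fn (tri s u t)) =
      ∑ p ∈ pairs k a.deg, ∑ r ∈ pairs k b.deg, cst p.1 p.2 a * cst r.1 r.2 b *
        (ind p.1.fn r.1.fn s * ind p.2.fn r.2.fn t) := by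
  classical
  rw [avg_ind a.isClassFun b.isClassFun]
  simp only [ind, Finset.sum_mul_sum]
  simp only [Finset.mul_sum]
  refine Eq.trans ?_ ((Finset.sum_congr rfl fun p _ => Finset.sum_comm).trans
    Finset.sum_comm).symm
  refine Finset.sum_congr rfl fun W₁ _ => ?_
  refine Eq.trans ?_ ((Finset.sum_congr rfl fun p _ => Finset.sum_comm).trans
    Finset.sum_comm).symm
  refine Finset.sum_congr rfl fun W₂ _ => ?_
  split_ifs with h
  · rw [res_eq_sum a (isUnit_restrict hs h.1) (isUnit_restrict ht h.2),
      res_eq_sum b (isUnit_mapQ hs h.1) (isUnit_mapQ ht h.2), Finset.sum_mul_sum]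
    refine Finset.sum_congr rfl fun p _ => Finset.sum_congr rfl fun r _ => ?_
    rw [term, dif_pos h.1, term, dif_pos h.2]
    ring
  · symm
    refine Finset.sum_eq_zero fun p _ => Finset.sum_eq_zero fun r _ => ?_
    rw [not_and_or] at h
    obtain h | h := h
    · rw [term, dif_neg h]
      ring
    · rw [term.eq_def p.2.fn, dif_neg h]
      ring

/-- Compatibility of restriction with induction. -/
theorem cst_hopf (a b y z : Ir k) :
    ∑ x ∈ lev k (y.deg + z.deg), cst a b x * cst y z x =
      ∑ p ∈ pairs k a.deg, ∑ r ∈ pairs k b.deg, cst p.1 p.2 a * cst r.1 r.2 b *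
        (cst p.1 r.1 y * cst p.2 r.2 z) := by
  have h1 : (pr y fun s => pr z fun t => avg fun u : (Fin z.deg → k) →ₗ[k] (Fin y.deg → k) =>
      ind a.fn b.fn (tri s u t)) = ∑ x ∈ lev k (y.deg + z.deg), cst a b x * cst y z x := by
    have h2 : ∀ s : End k (Fin y.deg → k), IsUnit s → ∀ t : End k (Fin z.deg → k), IsUnit t →
        (avg fun u : (Fin z.deg → k) →ₗ[k] (Fin y.deg → k) => ind a.fn b.fn (tri s u t)) =
        ∑ x ∈ lev k (y.deg + z.deg), cst a b x * res x.fn s t := by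
      intro s hs t ht
      rw [avg_congr fun u => ind_eq_sum a b (isUnit_tri hs ht), avg_sum]
      simp only [avg_mul_left, finrank_prod, finrank_fin_fun]
      rfl
    rw [pr_congr fun s hs => pr_congr fun t ht => h2 s hs t ht]
    simp only [pr_sum, pr_mul_left, ← cst_eq_pr]
  rw [← h1, pr_congr fun s hs => pr_congr fun t ht => avg_ind_eq_sum a b hs ht]
  simp only [pr_sum, pr_mul_left, pr_mul_right, pr_ind]

end

end

section

open Module

section Unit

variable {k : Type} [Field k] [Fintype k]
variable {V₁ V₂ : Type} [AddCommGroup V₁] [Module k V₁] [FiniteDimensional k V₁]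
  [AddCommGroup V₂] [Module k V₂] [FiniteDimensional k V₂]

theorem card_irrSet_zero : Nat.card (irrSet (GL (Fin 0) k)) = 1 := by
  rw [card_irrSet, Nat.card_eq_one_iff_unique]
  refine ⟨⟨fun a b => ?_⟩, ⟨1⟩⟩
  obtain ⟨a, rfl⟩ := ConjClasses.exists_rep a
  obtain ⟨b, rfl⟩ := ConjClasses.exists_rep b
  rw [Subsingleton.elim a b]

theorem exists_irr_zero : ∃ x : Ir k, x.deg = 0 := by
  have : Nonempty (irrSet (GL (Fin 0) k)) := (Nat.card_eq_one_iff_unique.1 card_irrSet_zero).2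
  exact ⟨⟨0, this.some⟩, rfl⟩

variable (k) in
/-- The character of the trivial group `GL 0 k`. -/
noncomputable def one : Ir k := exists_irr_zero.choose

@[simp] theorem deg_one : (one k).deg = 0 := exists_irr_zero.choose_spec

theorem eq_one_of_deg {x : Ir k} (h : x.deg = 0) : x = one k := by
  have h1 : (one k).deg = 0 := deg_one
  obtain ⟨n, x⟩ := x
  generalize one k = y at h1
  obtain ⟨m, y⟩ := y
  obtain rfl : n = 0 := h
  obtain rfl : m = 0 := h1
  have : Subsingleton (irrSet (GL (Fin 0) k)) := (Nat.card_eq_one_iff_unique.1 card_irrSet_zero).1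
  rw [Subsingleton.elim x y]

theorem lev_zero : lev k 0 = {one k} := by
  ext x
  rw [mem_lev, Finset.mem_singleton]
  exact ⟨eq_one_of_deg, fun h => h ▸ deg_one⟩

theorem one_fn (g : GL (Fin (one k).deg) k) : (one k).fn g = 1 := by
  have h1 := inner_irr (one k).2.2 (one k).2.2
  have h2 : ∀ n, n = 0 → Subsingleton (GL (Fin n) k) := by
    rintro n rfl
    infer_instance
  have h3 : Subsingleton (GL (Fin (one k).deg) k) := h2 _ deg_one
  rw [Subsingleton.elim g 1]
  change inner (one k).fn (one k).fn = _ at h1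
  rw [inner, Nat.card_unique, if_pos rfl, Fintype.sum_eq_single 1 fun x hx =>
    absurd (Subsingleton.elim x 1) hx, inv_one] at h1
  obtain ⟨d, hd, h⟩ := irr_one (one k).2
  have h' : (one k).fn 1 = d := h
  rw [h'] at h1 ⊢
  rw [Nat.cast_one, inv_one, one_mul] at h1
  norm_cast at h1 ⊢
  exact Nat.eq_one_of_mul_eq_one_left h1

theorem res_trivial_right [Subsingleton V₂] {n : ℕ} {f : GL (Fin n) k → ℂ} (hf : IsClassFun f)
    (s : End k V₁) (t : End k V₂) : res f s t = ev f s := by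
  unfold res
  rw [← avg_const (α := V₂ →ₗ[k] V₁) (ev f s)]
  refine avg_congr fun u => ?_
  let e : (V₁ × V₂) ≃ₗ[k] V₁ := LinearEquiv.ofBijective (LinearMap.fst k V₁ V₂)
    ⟨fun a b h => Prod.ext h (Subsingleton.elim _ _), fun a => ⟨(a, 0), rfl⟩⟩
  refine ev_congr hf e fun v => ?_
  change s v.1 + u v.2 = s v.1
  rw [Subsingleton.elim v.2 0, map_zero, add_zero]

theorem res_trivial_left [Subsingleton V₁] {n : ℕ} {f : GL (Fin n) k → ℂ} (hf : IsClassFun f)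
    (s : End k V₁) (t : End k V₂) : res f s t = ev f t := by
  unfold res
  rw [← avg_const (α := V₂ →ₗ[k] V₁) (ev f t)]
  refine avg_congr fun u => ?_
  let e : (V₁ × V₂) ≃ₗ[k] V₂ := LinearEquiv.ofBijective (LinearMap.snd k V₁ V₂)
    ⟨fun a b h => Prod.ext (Subsingleton.elim _ _) h, fun a => ⟨(0, a), rfl⟩⟩
  refine ev_congr hf e fun v => rfl

theorem pr_one_const (r : ℂ) : pr (one k) (fun _ => r) = r := by
  refine Eq.trans ?_ (avg_const (α := GL (Fin (one k).deg) k) r)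
  exact avg_congr fun s => by rw [one_fn, one_mul]

instance : Subsingleton (Fin (one k).deg → k) := by
  rw [deg_one]
  infer_instance

open Classical in
theorem cst_one_right (a x : Ir k) : cst a (one k) x = if x = a then 1 else 0 := by
  simp only [cst_eq_pr, res_trivial_right x.isClassFun, pr_one_const, pr_ev]

open Classical in
theorem cst_one_left (a x : Ir k) : cst (one k) a x = if x = a then 1 else 0 := by
  simp only [cst_eq_pr, res_trivial_left x.isClassFun, pr_one_const, pr_ev]

end Unit

section Dimension

/-- The part of the order of `GL n` prime to the characteristic. -/
def cop (q n : ℕ) : ℕ := ∏ i ∈ Finset.range n, (q ^ (i + 1) - 1)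

theorem cop_pos {q : ℕ} (hq : 1 < q) (n : ℕ) : 0 < cop q n :=
  Finset.prod_pos fun i _ => Nat.sub_pos_of_lt (Nat.one_lt_pow (Nat.succ_ne_zero i) hq)

theorem cop_succ (q n : ℕ) : cop q (n + 1) = cop q n * (q ^ (n + 1) - 1) :=
  Finset.prod_range_succ _ _

variable {k : Type} [Field k] [Fintype k]

theorem card_GL_eq (n : ℕ) : Nat.card (GL (Fin n) k) =
    Fintype.card k ^ (n.choose 2) * cop (Fintype.card k) n := by
  rw [Matrix.card_GL_field]
  induction n with
  | zero => simp [cop]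
  | succ n ih =>
    rw [Fin.prod_univ_succ, cop_succ]
    have : ∀ i : Fin n, Fintype.card k ^ (n + 1) - Fintype.card k ^ (i.succ : ℕ) =
        Fintype.card k * (Fintype.card k ^ n - Fintype.card k ^ (i : ℕ)) := by
      intro i
      rw [Nat.mul_sub, Fin.val_succ, pow_succ', pow_succ']
    simp only [this]
    rw [Finset.prod_mul_distrib, ih, Finset.prod_const, Finset.card_univ, Fintype.card_fin,
      Nat.choose_succ_succ' n 1, Nat.choose_one_right, pow_add]
    simp
    ring

theorem card_units_End {V : Type} [AddCommGroup V] [Module k V] [FiniteDimensional k V] :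
    Nat.card (End k V)ˣ =
      Fintype.card k ^ ((finrank k V).choose 2) * cop (Fintype.card k) (finrank k V) := by
  rw [← card_GL_eq]
  exact Nat.card_congr (Units.mapEquiv
    (LinearMap.toMatrixAlgEquiv (finBasis k V)).toMulEquiv).toEquiv

theorem choose_two_add (a b : ℕ) : (a + b).choose 2 = a.choose 2 + b.choose 2 + a * b := by
  induction b with
  | zero => simp
  | succ b ih =>
    rw [← add_assoc, Nat.choose_succ_succ' (a + b) 1, Nat.choose_succ_succ' b 1, ih,
      Nat.choose_one_right, Nat.choose_one_right]
    ring

/-- The number of subspaces. -/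
theorem card_submodule (V₁ V₂ : Type) [AddCommGroup V₁] [Module k V₁] [FiniteDimensional k V₁]
    [AddCommGroup V₂] [Module k V₂] [FiniteDimensional k V₂] :
    ((cop (Fintype.card k) (finrank k V₁) : ℂ) * cop (Fintype.card k) (finrank k V₂)) *
      Nat.card {W : Submodule k (V₁ × V₂) // finrank k W = finrank k V₁} =
    cop (Fintype.card k) (finrank k V₁ + finrank k V₂) := by
  have h := card_mul_card_submodule (k := k) (V₁ := V₁) (V₂ := V₂)
  have hq : (Fintype.card k : ℂ) ≠ 0 := Nat.cast_ne_zero.2 Fintype.card_ne_zero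
  rw [Nat.card_prod, Nat.card_prod, card_units_End, card_units_End, card_units_End,
    finrank_prod, Module.natCard_eq_pow_finrank (K := k), finrank_linearMap,
    Nat.card_eq_fintype_card (α := k), choose_two_add] at h
  push_cast at h
  have hne : (Fintype.card k : ℂ) ^ ((finrank k V₁).choose 2) *
      (Fintype.card k : ℂ) ^ ((finrank k V₂).choose 2) *
      (Fintype.card k : ℂ) ^ (finrank k V₁ * finrank k V₂) ≠ 0 := by positivity
  refine mul_left_cancel₀ hne ?_
  rw [pow_add, pow_add] at h
  rw [mul_comm (finrank k V₂)] at h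
  linear_combination h

/-- The degree of an irreducible character, normalized to be multiplicative. -/
noncomputable def phi (x : Ir k) : ℂ := x.fn 1 / cop (Fintype.card k) x.deg

theorem ev_one (x : Ir k) {V : Type} [AddCommGroup V] [Module k V] [FiniteDimensional k V]
    (h : finrank k V = x.deg) : ev x.fn (1 : End k V) = x.fn 1 := by
  rw [ev_irr_of_congr x (g := 1) (finBasisOfFinrankEq k V h).equivFun]
  intro v
  simp [gl]

theorem cop_ne_zero (n : ℕ) : (cop (Fintype.card k) n : ℂ) ≠ 0 :=
  Nat.cast_ne_zero.2 (cop_pos Fintype.one_lt_card n).ne'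

theorem phi_mul (a b : Ir k) : ∑ x ∈ lev k (a.deg + b.deg), cst a b x * phi x = phi a * phi b := by
  let V₁ := Fin a.deg → k
  let V₂ := Fin b.deg → k
  have hV₁ : finrank k V₁ = a.deg := finrank_fin_fun k
  have hV₂ : finrank k V₂ = b.deg := finrank_fin_fun k
  have h1 := ind_eq_sum a b (V := V₁ × V₂) isUnit_one
  have h2 : ind a.fn b.fn (1 : End k (V₁ × V₂)) = a.fn 1 * b.fn 1 *
      Nat.card {W : Submodule k (V₁ × V₂) // finrank k W = finrank k V₁} := by
    classical
    rw [ind, Nat.card_eq_fintype_card, Fintype.card_subtype, ← Finset.sum_boole, Finset.mul_sum]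
    refine Finset.sum_congr rfl fun W _ => ?_
    split_ifs with h
    · have hW : W ≤ W.comap (1 : End k (V₁ × V₂)) := fun w hw => hw
      rw [term, dif_pos hW, mul_one]
      have e1 : LinearMap.restrict (1 : End k (V₁ × V₂)) hW = (1 : End k W) :=
        LinearMap.ext fun v => rfl
      have e2 : W.mapQ W (1 : End k (V₁ × V₂)) hW = (1 : End k (_ ⧸ W)) := W.mapQ_id
      rw [e1, e2, ev_one a (h.trans hV₁), ev_one b]
      have := W.finrank_quotient_add_finrank
      rw [finrank_prod, h] at this
      omega
    · rw [term_eq_zero (by rwa [hV₁] at h), mul_zero]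
  have h3 := card_submodule (k := k) V₁ V₂
  rw [h2, finrank_prod, hV₁, hV₂] at h1
  rw [hV₁, hV₂] at h3
  have h4 : ∑ x ∈ lev k (a.deg + b.deg), cst a b x * phi x =
      (∑ x ∈ lev k (a.deg + b.deg), cst a b x * ev x.fn (1 : End k (V₁ × V₂))) /
        cop (Fintype.card k) (a.deg + b.deg) := by
    rw [Finset.sum_div]
    refine Finset.sum_congr rfl fun x hx => ?_
    rw [mem_lev] at hx
    rw [ev_one x (by rw [finrank_prod, hV₁, hV₂, hx]), phi, ← hx, mul_div_assoc]
  rw [h4, ← h1, phi, phi, div_mul_div_comm, div_eq_div_iff (cop_ne_zero _)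
    (mul_ne_zero (cop_ne_zero _) (cop_ne_zero _))]
  linear_combination (a.fn 1 * b.fn 1) * h3

@[simp] theorem phi_one : phi (one k) = 1 := by
  rw [phi, one_fn, deg_one]
  simp [cop]

end Dimension

end

section

open Module

section Whittaker

variable {k : Type} [Field k] [Fintype k] (ψ : AddChar k ℂ)

/-- Iterated average of a class function against a nondegenerate character of a maximal unipotent
subgroup, starting from the linear form `lam`. -/
noncomputable def whit {n : ℕ} (f : GL (Fin n) k → ℂ) : ℕ →
    ∀ (V : Type) [AddCommGroup V] [Module k V] [FiniteDimensional k V], Dual k V → End k V → ℂ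
  | 0, _, _, _, _, _, T => ev f T
  | l + 1, V, _, _, _, lam, T => avg fun u : k →ₗ[k] V =>
      ψ (-lam (u 1)) * whit f l (V × k) (LinearMap.snd k V k) (tri T u 1)

variable {V W : Type} [AddCommGroup V] [Module k V] [FiniteDimensional k V]
  [AddCommGroup W] [Module k W] [FiniteDimensional k W]

theorem whit_congr {n : ℕ} {f : GL (Fin n) k → ℂ} (hf : IsClassFun f) (l : ℕ) :
    ∀ {V W : Type} [AddCommGroup V] [Module k V] [FiniteDimensional k V]
      [AddCommGroup W] [Module k W] [FiniteDimensional k W] (e : V ≃ₗ[k] W) {lam : Dual k V}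
      {mu : Dual k W} {T : End k V} {S : End k W}, (∀ v, mu (e v) = lam v) →
      (∀ v, e (T v) = S (e v)) → whit ψ f l V lam T = whit ψ f l W mu S := by
  induction l with
  | zero =>
    intro V W _ _ _ _ _ _ e lam mu T S h1 h2
    exact ev_congr hf e h2
  | succ l ih =>
    intro V W _ _ _ _ _ _ e lam mu T S h1 h2
    rw [whit, whit, ← avg_equiv (LinearEquiv.arrowCongr (LinearEquiv.refl k k) e).toEquiv]
    refine avg_congr fun u => ?_
    congr 1
    · simp [h1]
    · refine ih (e.prodCongr (LinearEquiv.refl k k)) (fun v => rfl) fun v => ?_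
      simp [h2]

theorem whit_eq_zero {n : ℕ} {f : GL (Fin n) k → ℂ} (l : ℕ) :
    ∀ {V : Type} [AddCommGroup V] [Module k V] [FiniteDimensional k V] {lam : Dual k V}
      {T : End k V}, finrank k V + l ≠ n → whit ψ f l V lam T = 0 := by
  induction l with
  | zero => exact fun h => ev_of_ne _ _ h
  | succ l ih =>
    intro V _ _ _ lam T h
    rw [whit, ← avg_const (α := k →ₗ[k] V) 0]
    refine avg_congr fun u => ?_
    rw [ih, mul_zero]
    rw [finrank_prod, finrank_self]
    omega

theorem avg_whit_tri (x : Ir k) {s : End k V} (hs : IsUnit s) (l : ℕ) :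
    ∀ {W : Type} [AddCommGroup W] [Module k W] [FiniteDimensional k W] {lam : Dual k W}
      {T : End k W}, IsUnit T →
      (avg fun B : W →ₗ[k] V =>
        whit ψ x.fn l (V × W) (lam ∘ₗ LinearMap.snd k V W) (tri s B T)) =
      ∑ p ∈ pairs k x.deg, cst p.1 p.2 x * (ev p.1.fn s * whit ψ p.2.fn l W lam T) := by
  induction l with
  | zero => exact fun hT => res_eq_sum x hs hT
  | succ l ih =>
    intro W _ _ _ lam T hT
    have h1 : ∀ B : W →ₗ[k] V,
        whit ψ x.fn (l + 1) (V × W) (lam ∘ₗ LinearMap.snd k V W) (tri s B T) =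
        avg fun u₂ : k →ₗ[k] W => avg fun u₁ : k →ₗ[k] V => ψ (-lam (u₂ 1)) *
          whit ψ x.fn l (V × (W × k)) (LinearMap.snd k W k ∘ₗ LinearMap.snd k V (W × k))
            (tri s (B.coprod u₁) (tri T u₂ 1)) := by
      intro B
      rw [whit, ← avg_equiv (LinearMap.prodEquiv k).toEquiv, avg_prod, avg_comm]
      refine avg_congr fun u₂ => avg_congr fun u₁ => ?_
      congr 1
      refine whit_congr ψ x.isClassFun l (LinearEquiv.prodAssoc k V W k) (fun v => rfl)
        fun v => ?_
      ext
      · simp [add_assoc]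
      · simp
      · simp
    simp only [h1]
    rw [avg_comm]
    have h2 : ∀ u₂ : k →ₗ[k] W,
        (avg fun B : W →ₗ[k] V => avg fun u₁ : k →ₗ[k] V => ψ (-lam (u₂ 1)) *
          whit ψ x.fn l (V × (W × k)) (LinearMap.snd k W k ∘ₗ LinearMap.snd k V (W × k))
            (tri s (B.coprod u₁) (tri T u₂ 1))) =
        ψ (-lam (u₂ 1)) * ∑ p ∈ pairs k x.deg, cst p.1 p.2 x * (ev p.1.fn s *
          whit ψ p.2.fn l (W × k) (LinearMap.snd k W k) (tri T u₂ 1)) := by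
      intro u₂
      rw [← ih (isUnit_tri hT isUnit_one), ← avg_mul_left,
        ← avg_equiv (LinearMap.coprodEquiv k).toEquiv, avg_prod]
      rfl
    simp only [h2, Finset.mul_sum]
    rw [avg_sum]
    refine Finset.sum_congr rfl fun p _ => ?_
    rw [whit, ← avg_mul_left, ← avg_mul_left]
    exact avg_congr fun u => by ring

/-- The multiplicity of a nondegenerate character of the unipotent group. -/
noncomputable def whd (b : Ir k) : ℂ := whit ψ b.fn b.deg PUnit 0 1

theorem whit_PUnit (b : Ir k) (l : ℕ) {T : End k PUnit} (lam : Dual k PUnit) :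
    whit ψ b.fn l PUnit lam T = if b.deg = l then whd ψ b else 0 := by
  split_ifs with h
  · rw [whd, ← h, Subsingleton.elim T 1, Subsingleton.elim lam 0]
  · refine whit_eq_zero ψ l ?_
    rw [finrank_zero_of_subsingleton, zero_add]
    exact Ne.symm h

theorem whit_zero (x : Ir k) {s : End k V} (hs : IsUnit s) (l : ℕ) :
    whit ψ x.fn l V 0 s =
      ∑ p ∈ pairs k x.deg, cst p.1 p.2 x *
        (ev p.1.fn s * if p.2.deg = l then whd ψ p.2 else 0) := by
  have h := avg_whit_tri ψ x hs l (W := PUnit) (lam := 0) (T := 1) isUnit_one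
  simp only [whit_PUnit] at h
  rw [← h, ← avg_const (α := PUnit →ₗ[k] V) (whit ψ x.fn l V 0 s)]
  refine avg_congr fun B => ?_
  let e : (V × PUnit) ≃ₗ[k] V := (LinearEquiv.ofBijective (LinearMap.fst k V PUnit)
    ⟨fun a b h => Prod.ext h (Subsingleton.elim _ _), fun a => ⟨(a, 0), rfl⟩⟩)
  refine (whit_congr ψ x.isClassFun l e (fun _ => rfl) fun v => ?_).symm
  change s v.1 + B v.2 = s v.1
  rw [Subsingleton.elim v.2 0, map_zero, add_zero]

noncomputable instance : Fintype (Dual k V) := Fintype.ofFinite _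

theorem sum_dual_apply (hψ : ψ ≠ 1) {w : V} (hw : w ≠ 0) : ∑ lam : Dual k V, ψ (-lam w) = 0 := by
  let L : Dual k V →+ k :=
    { toFun := fun lam => -lam w
      map_zero' := by simp
      map_add' := fun a b => by simp [add_comm] }
  refine AddChar.sum_eq_zero_of_ne_one (ψ := ψ.compAddMonoidHom L) fun h => ?_
  obtain ⟨c, hc⟩ := AddChar.ne_one_iff.1 hψ
  obtain ⟨lam, hl⟩ : ∃ lam : Dual k V, lam w ≠ 0 := by
    by_contra! h'
    exact hw ((Module.forall_dual_apply_eq_zero_iff k w).1 h')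
  refine hc ?_
  have := DFunLike.congr_fun h ((-c / lam w) • lam)
  rw [AddChar.compAddMonoidHom_apply] at this
  simpa [L, hl] using this

theorem sum_dual (hψ : ψ ≠ 1) (F : (k →ₗ[k] V) → ℂ) :
    ∑ lam : Dual k V, (avg fun u : k →ₗ[k] V => ψ (-lam (u 1)) * F u) = F 0 := by
  classical
  have : Fintype (k →ₗ[k] V) := Fintype.ofFinite _
  simp only [avg_eq]
  rw [← Finset.mul_sum, Finset.sum_comm, Fintype.sum_eq_single 0]
  · have hc : Nat.card (k →ₗ[k] V) = Fintype.card (Dual k V) := by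
      rw [← Nat.card_eq_fintype_card, Module.natCard_eq_pow_finrank (K := k),
        Module.natCard_eq_pow_finrank (K := k) (V := Dual k V), finrank_linearMap,
        Subspace.dual_finrank_eq]
      simp
    have h0 : (Fintype.card (Dual k V) : ℂ) ≠ 0 := Nat.cast_ne_zero.2 Fintype.card_ne_zero
    rw [hc]
    simp [h0]
  · intro u hu
    rw [← Finset.sum_mul, sum_dual_apply ψ hψ, zero_mul]
    contrapose! hu
    ext
    simpa using hu

omit [Fintype k] [FiniteDimensional k V] in
theorem exists_equiv_ker {lam : Dual k V} (h : lam ≠ 0) :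
    ∃ e : V ≃ₗ[k] (LinearMap.ker lam × k), ∀ v, (e v).2 = lam v := by
  obtain ⟨v₀, hv₀⟩ : ∃ v₀, lam v₀ = 1 := by
    obtain ⟨v, hv⟩ : ∃ v, lam v ≠ 0 := by
      by_contra! h'
      exact h (LinearMap.ext h')
    exact ⟨(lam v)⁻¹ • v, by simp [hv]⟩
  let g : V →ₗ[k] LinearMap.ker lam :=
    (LinearMap.id - lam.smulRight v₀).codRestrict _ fun v => by simp [hv₀]
  refine ⟨LinearEquiv.ofBijective (g.prod lam) ⟨?_, ?_⟩, fun v => rfl⟩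
  · rw [injective_iff_map_eq_zero]
    intro v hv
    have h1 : lam v = 0 := congrArg Prod.snd hv
    have h2 : v - lam v • v₀ = 0 := congrArg (fun p => (p.1 : V)) hv
    simpa [h1] using h2
  · rintro ⟨⟨w, hw⟩, c⟩
    rw [LinearMap.mem_ker] at hw
    refine ⟨w + c • v₀, Prod.ext (Subtype.ext ?_) ?_⟩
    · change w + c • v₀ - lam (w + c • v₀) • v₀ = w
      simp [hw, hv₀]
    · simp [hw, hv₀]

theorem whit_snd (hψ : ψ ≠ 1) (x : Ir k) (m : ℕ) : ∀ (l : ℕ) (V : Type) [AddCommGroup V]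
    [Module k V] [FiniteDimensional k V], finrank k V = m → x.deg = m + 1 + l →
      whit ψ x.fn l (V × k) (LinearMap.snd k V k) 1 = cop (Fintype.card k) m *
        ∑ p ∈ pairs k x.deg with p.1.deg ≤ m, cst p.1 p.2 x * (phi p.1 * whd ψ p.2) := by
  classical
  have key : ∀ (l : ℕ) (V : Type) [AddCommGroup V] [Module k V] [FiniteDimensional k V],
      x.deg = finrank k V + 1 + l → whit ψ x.fn l (V × k) (LinearMap.snd k V k) 1 =
        cop (Fintype.card k) (finrank k V) *
          ∑ p ∈ pairs k x.deg with p.1.deg = finrank k V, cst p.1 p.2 x * (phi p.1 * whd ψ p.2) +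
        ∑ lam ∈ (Finset.univ : Finset (Dual k V)).erase 0, whit ψ x.fn (l + 1) V lam 1 := by
    intro l V _ _ _ hx
    have h := sum_dual ψ (V := V) hψ fun u =>
        whit ψ x.fn l (V × k) (LinearMap.snd k V k) (tri 1 u 1)
    rw [tri_one] at h
    rw [← h, ← Finset.add_sum_erase _ _ (Finset.mem_univ 0)]
    congr 1
    change whit ψ x.fn (l + 1) V 0 1 = _
    rw [whit_zero ψ x isUnit_one, Finset.mul_sum, Finset.sum_filter]
    refine Finset.sum_congr rfl fun p hp => ?_
    rw [mem_pairs] at hp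
    by_cases hd : p.1.deg = finrank k V
    · rw [if_pos hd, if_pos (by omega), ev_one _ hd.symm, phi, ← hd]
      have := cop_ne_zero (k := k) p.1.deg
      field_simp
    · rw [if_neg hd, if_neg (by omega)]
      simp
  induction m with
  | zero =>
    intro l V _ _ _ hV hx
    rw [key l V (by rw [hV, hx]), hV, Finset.sum_eq_zero (s := Finset.erase _ _)]
    · simp
    · intro lam hlam
      have h0 : lam ≠ 0 := Finset.ne_of_mem_erase hlam
      have : Subsingleton V := finrank_zero_iff.1 hV
      exact absurd (LinearMap.ext fun v => by rw [Subsingleton.elim v 0]; simp) h0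
  | succ m ih =>
    intro l V _ _ _ hV hx
    rw [key l V (by rw [hV, hx]), hV]
    have h1 : ∀ lam ∈ (Finset.univ : Finset (Dual k V)).erase 0, whit ψ x.fn (l + 1) V lam 1 =
        cop (Fintype.card k) m *
        ∑ p ∈ pairs k x.deg with p.1.deg ≤ m, cst p.1 p.2 x * (phi p.1 * whd ψ p.2) := by
      intro lam hlam
      obtain ⟨e, he⟩ := exists_equiv_ker (Finset.ne_of_mem_erase hlam)
      have hm := e.finrank_eq
      rw [finrank_prod, finrank_self, hV] at hm
      rw [← ih (l + 1) (LinearMap.ker lam) (by omega) (by omega)]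
      exact whit_congr ψ x.isClassFun _ e he fun v => rfl
    have hD : Fintype.card (Dual k V) = Fintype.card k ^ (m + 1) := by
      rw [← Nat.card_eq_fintype_card, Module.natCard_eq_pow_finrank (K := k),
        Subspace.dual_finrank_eq, hV, Nat.card_eq_fintype_card]
    rw [Finset.sum_congr rfl h1, Finset.sum_const, Finset.card_erase_of_mem (Finset.mem_univ _),
      Finset.card_univ, hD, nsmul_eq_mul, ← mul_assoc,
      ← Nat.cast_mul, mul_comm (_ - 1), ← cop_succ, ← mul_add]
    congr 1
    rw [Finset.sum_filter, Finset.sum_filter, Finset.sum_filter, ← Finset.sum_add_distrib]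
    refine Finset.sum_congr rfl fun p _ => ?_
    by_cases h2 : p.1.deg = m + 1
    · simp [h2]
    · by_cases h3 : p.1.deg ≤ m
      · rw [if_neg h2, if_pos h3, if_pos (by omega), zero_add]
      · rw [if_neg h2, if_neg h3, if_neg (by omega), zero_add]

@[simp] theorem whd_one : whd ψ (one k) = 1 := by
  have : ∀ l, l = 0 → whit ψ (one k).fn l PUnit 0 1 = 1 := by
    rintro l rfl
    rw [whit, ev_one _ (by rw [deg_one, finrank_zero_of_subsingleton]), one_fn]
  exact this _ deg_one

theorem sum_phi_mul_whd (hψ : ψ ≠ 1) (x : Ir k) :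
    ∑ p ∈ pairs k x.deg, cst p.1 p.2 x * (phi p.1 * whd ψ p.2) =
      (Fintype.card k : ℂ) ^ x.deg * phi x := by
  classical
  have htop : ∑ p ∈ pairs k x.deg with p.1.deg = x.deg, cst p.1 p.2 x * (phi p.1 * whd ψ p.2) =
      phi x := by
    rw [Finset.sum_eq_single (x, one k)]
    · simp [cst_one_right]
    · intro p hp hne
      rw [Finset.mem_filter, mem_pairs] at hp
      have h2 : p.2 = one k := eq_one_of_deg (by omega)
      rw [h2, cst_one_right, if_neg, zero_mul]
      rintro rfl
      exact hne (Prod.ext rfl h2)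
    · simp
  rcases hN : x.deg with _ | N
  · rw [← htop, hN, pow_zero, one_mul, Finset.sum_filter]
    refine Finset.sum_congr rfl fun p hp => ?_
    rw [mem_pairs] at hp
    rw [if_pos (by omega)]
  · have h1 := whit_snd ψ hψ x N 0 (Fin N → k) (finrank_fin_fun k) (by rw [hN])
    rw [whit, ev_one x (by rw [finrank_prod, finrank_fin_fun, finrank_self, hN])] at h1
    have h2 : x.fn 1 = cop (Fintype.card k) (N + 1) * phi x := by
      have := cop_ne_zero (k := k) x.deg
      rw [phi, ← hN]
      field_simp
    have hq : 1 ≤ Fintype.card k ^ (N + 1) := Nat.one_le_pow _ _ Fintype.card_pos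
    rw [h2, cop_succ, Nat.cast_mul, mul_assoc] at h1
    have h3 := mul_left_cancel₀ (cop_ne_zero (k := k) N) h1
    rw [Nat.cast_sub hq, Nat.cast_one, sub_mul, one_mul, sub_eq_iff_eq_add, Nat.cast_pow] at h3
    rw [h3, ← hN, ← htop, hN, Finset.sum_filter, Finset.sum_filter, ← Finset.sum_add_distrib]
    refine Finset.sum_congr rfl fun p hp => ?_
    rw [mem_pairs] at hp
    by_cases h : p.1.deg = N + 1
    · simp [h]
    · rw [if_neg h, if_pos (by omega), add_zero]

section Integrality

/-- The semidirect product of a group acting linearly on a space by the linear maps from the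
ground field. -/
structure Ext {H : Type} [Group H] (ρ : H →* End k V) where
  /-- The group component. -/
  fst : H
  /-- The linear component. -/
  snd : k →ₗ[k] V

variable {H : Type} [Group H] (ρ : H →* End k V)

instance : Mul (Ext ρ) := ⟨fun a b => ⟨a.fst * b.fst, a.snd + ρ a.fst ∘ₗ b.snd⟩⟩
instance : One (Ext ρ) := ⟨⟨1, 0⟩⟩
instance : Inv (Ext ρ) := ⟨fun a => ⟨a.fst⁻¹, -(ρ a.fst⁻¹ ∘ₗ a.snd)⟩⟩

instance : Group (Ext ρ) := Group.ofLeftAxioms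
  (fun a b c => by
    change Ext.mk _ _ = Ext.mk _ _
    congr 1
    · exact mul_assoc _ _ _
    · ext
      change a.snd 1 + ρ a.fst (b.snd 1) + ρ (a.fst * b.fst) (c.snd 1) =
        a.snd 1 + ρ a.fst (b.snd 1 + ρ b.fst (c.snd 1))
      rw [map_mul, map_add, Module.End.mul_apply, add_assoc])
  (fun a => by
    change Ext.mk _ _ = a
    obtain ⟨g, u⟩ := a
    congr 1
    · exact one_mul _
    · ext
      change (0 : V) + ρ 1 (u 1) = u 1
      simp)
  (fun a => by
    change Ext.mk _ _ = Ext.mk _ _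
    congr 1
    · exact inv_mul_cancel _
    · ext
      change -(ρ a.fst⁻¹ (a.snd 1)) + ρ a.fst⁻¹ (a.snd 1) = 0
      simp)

/-- The underlying set of the semidirect product. -/
def Ext.equiv : Ext ρ ≃ H × (k →ₗ[k] V) :=
  ⟨fun a => (a.fst, a.snd), fun a => ⟨a.1, a.2⟩, fun _ => rfl, fun _ => rfl⟩

instance [Finite H] : Finite (Ext ρ) := Finite.of_equiv _ (Ext.equiv ρ).symm

/-- The action of the semidirect product. -/
def Ext.hom : Ext ρ →* End k (V × k) where
  toFun a := tri (ρ a.fst) a.snd 1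
  map_one' := by
    change tri (ρ 1) 0 1 = 1
    rw [map_one, tri_one]
  map_mul' a b := by
    rw [tri_mul]
    change tri (ρ (a.fst * b.fst)) (a.snd + ρ a.fst ∘ₗ b.snd) 1 = _
    rw [map_mul, add_comm]
    rfl

/-- An extension of a one-dimensional character. -/
def Ext.char (θ : H →* ℂ) {lam : Dual k V} (hl : ∀ h v, lam (ρ h v) = lam v) : Ext ρ →* ℂ where
  toFun a := θ a.fst * ψ (lam (a.snd 1))
  map_one' := by
    change θ 1 * ψ (lam 0) = 1
    simp
  map_mul' a b := by
    change θ (a.fst * b.fst) * ψ (lam (a.snd 1 + ρ a.fst (b.snd 1))) = _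
    rw [map_mul, map_add, hl, AddChar.map_add_eq_mul]
    ring

theorem whit_nat (x : Ir k) (l : ℕ) : ∀ {V : Type} [AddCommGroup V] [Module k V]
    [FiniteDimensional k V] {H : Type} [Group H] [Finite H] (ρ : H →* End k V) (θ : H →* ℂ)
    (lam : Dual k V), (∀ h v, lam (ρ h v) = lam v) →
      ∃ m : ℕ, (avg fun h : H => θ h⁻¹ * whit ψ x.fn l V lam (ρ h)) = m := by
  induction l with
  | zero =>
    intro V _ _ _ H _ _ ρ θ lam hl
    cases nonempty_fintype H
    by_cases hd : finrank k V = x.deg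
    · let b := finBasisOfFinrankEq k V hd
      obtain ⟨m, hm⟩ := IsChar.inner_nat (x.isChar.comp ((Units.map
        (LinearMap.toMatrixAlgEquiv b).toMonoidHom).comp ρ.toHomUnits)) (IsChar.of_hom θ)
      refine ⟨m, ?_⟩
      rw [← hm, ← avg_eq_inner]
      refine avg_congr fun h => ?_
      congr 1
      exact ev_basis x.isClassFun b (ρ.toHomUnits h)
    · refine ⟨0, ?_⟩
      rw [Nat.cast_zero, ← avg_const (α := H) 0]
      exact avg_congr fun h => by rw [whit, ev_of_ne _ _ hd, mul_zero]
  | succ l ih =>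
    intro V _ _ _ H _ _ ρ θ lam hl
    obtain ⟨m, hm⟩ := ih (Ext.hom ρ) (Ext.char ψ ρ θ hl) (LinearMap.snd k V k) fun h v => rfl
    refine ⟨m, ?_⟩
    rw [← hm, ← avg_equiv (Ext.equiv ρ).symm, avg_prod]
    refine avg_congr fun h => ?_
    rw [whit, ← avg_mul_left]
    refine avg_congr fun u => ?_
    rw [← mul_assoc]
    congr 1
    change _ = θ h⁻¹ * ψ (lam (-(ρ h⁻¹ (u 1))))
    rw [lam.map_neg, hl]

theorem whd_nat (b : Ir k) : ∃ m : ℕ, whd ψ b = m := by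
  obtain ⟨m, hm⟩ := whit_nat ψ b b.deg (V := PUnit) (H := Unit) 1 1 0 fun _ _ => rfl
  refine ⟨m, ?_⟩
  rw [← hm, whd, ← avg_const (α := Unit) (whit ψ b.fn b.deg PUnit 0 1)]
  refine avg_congr fun _ => ?_
  rw [MonoidHom.one_apply, one_mul]
  rfl

end Integrality

end Whittaker

end

section

open Module

section StructureConstants

variable {k : Type} [Field k] [Fintype k]

/-- The structure constants as natural numbers. -/
noncomputable def cn (a b x : Ir k) : ℕ := (cst_nat a b x).choose

theorem cn_cast (a b x : Ir k) : (cn a b x : ℂ) = cst a b x := (cst_nat a b x).choose_spec.symm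

theorem cn_eq_zero {a b x : Ir k} (h : a.deg + b.deg ≠ x.deg) : cn a b x = 0 := by
  have := cst_eq_zero h
  rw [← cn_cast] at this
  exact_mod_cast this

theorem deg_of_cn_ne_zero {a b x : Ir k} (h : cn a b x ≠ 0) : a.deg + b.deg = x.deg := by
  contrapose! h
  exact cn_eq_zero h

open Classical in
theorem cn_one_left (a x : Ir k) : cn (one k) a x = if x = a then 1 else 0 := by
  have := cst_one_left a x
  rw [← cn_cast] at this
  split_ifs with h
  · rw [if_pos h] at this
    exact_mod_cast this
  · rw [if_neg h] at this
    exact_mod_cast this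

open Classical in
theorem cn_one_right (a x : Ir k) : cn a (one k) x = if x = a then 1 else 0 := by
  have := cst_one_right a x
  rw [← cn_cast] at this
  split_ifs with h
  · rw [if_pos h] at this
    exact_mod_cast this
  · rw [if_neg h] at this
    exact_mod_cast this

theorem cn_coassoc (a b d x : Ir k) :
    ∑ y ∈ lev k (a.deg + b.deg), cn a b y * cn y d x =
      ∑ z ∈ lev k (b.deg + d.deg), cn b d z * cn a z x := by
  have := cst_coassoc a b d x
  simp only [← cn_cast] at this
  exact_mod_cast this

theorem cn_hopf (a b y z : Ir k) :
    ∑ x ∈ lev k (y.deg + z.deg), cn a b x * cn y z x =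
      ∑ p ∈ pairs k a.deg, ∑ r ∈ pairs k b.deg, cn p.1 p.2 a * cn r.1 r.2 b *
        (cn p.1 r.1 y * cn p.2 r.2 z) := by
  have := cst_hopf a b y z
  simp only [← cn_cast] at this
  exact_mod_cast this

theorem sum_pairs_swap {M : Type*} [AddCommMonoid M] (n : ℕ) (F : Ir k × Ir k → M) :
    ∑ p ∈ pairs k n, F p = ∑ p ∈ pairs k n, F p.swap := by
  refine Finset.sum_nbij' Prod.swap Prod.swap ?_ ?_ ?_ ?_ ?_
  · intro p hp
    rw [mem_pairs] at hp ⊢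
    rw [← hp, add_comm]
    rfl
  · intro p hp
    rw [mem_pairs] at hp ⊢
    rw [← hp, add_comm]
    rfl
  · exact fun p _ => rfl
  · exact fun p _ => rfl
  · exact fun p _ => rfl

/-- Parabolic induction is commutative. -/
theorem cn_comm (a b x : Ir k) : cn a b x = cn b a x := by
  induction hn : x.deg using Nat.strong_induction_on generalizing a b x with
  | _ n ih =>
  by_cases ha : a.deg = 0
  · rw [eq_one_of_deg ha, cn_one_left, cn_one_right]
  by_cases hb : b.deg = 0
  · rw [eq_one_of_deg hb, cn_one_left, cn_one_right]
  by_cases hd : a.deg + b.deg = n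
  swap
  · rw [cn_eq_zero (by rwa [hn]), cn_eq_zero (by rwa [hn, add_comm])]
  have key : ∀ y z : Ir k, y.deg < n → z.deg < n → y.deg + z.deg = n →
      ∑ x ∈ lev k n, cn a b x * cn y z x = ∑ x ∈ lev k n, cn b a x * cn y z x := by
    intro y z hy hz hyz
    rw [← hyz, cn_hopf, cn_hopf, Finset.sum_comm]
    refine Finset.sum_congr rfl fun r _ => Finset.sum_congr rfl fun p _ => ?_
    rw [ih _ hy p.1 r.1 y rfl, ih _ hz p.2 r.2 z rfl, mul_comm (cn p.1 p.2 a)]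
  have h1 := key a b (by omega) (by omega) hd
  have h2 := key b a (by omega) (by omega) (by omega)
  have h3 : ∑ x ∈ lev k n, ((cn a b x : ℤ) - cn b a x) ^ 2 = 0 := by
    zify at h1 h2
    have : ∀ x : Ir k, ((cn a b x : ℤ) - cn b a x) ^ 2 =
        (cn a b x * cn a b x - cn b a x * cn a b x) - (cn a b x * cn b a x - cn b a x * cn b a x) :=
      fun x => by ring
    simp only [this, Finset.sum_sub_distrib]
    rw [h1, h2]
    ring
  rw [Finset.sum_eq_zero_iff_of_nonneg fun _ _ => sq_nonneg _] at h3
  have := h3 x (mem_lev.2 hn)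
  rw [sq_eq_zero_iff, sub_eq_zero] at this
  exact_mod_cast this

open Classical in
variable (k) in
/-- The irreducible characters of degree at most `n`. -/
noncomputable def upto (n : ℕ) : Finset (Ir k) := (Finset.range (n + 1)).biUnion (lev k)

@[simp] theorem mem_upto {n : ℕ} {x : Ir k} : x ∈ upto k n ↔ x.deg ≤ n := by
  simp [upto]

theorem sum_upto_cn_left {M : Type*} [NonAssocSemiring M] {n : ℕ} (a b : Ir k) (F : Ir k → M)
    (hF : ∀ y, n < y.deg → F y = 0) :
    ∑ y ∈ upto k n, (cn a b y : M) * F y = ∑ y ∈ lev k (a.deg + b.deg), (cn a b y : M) * F y := by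
  classical
  by_cases h : a.deg + b.deg ≤ n
  · refine (Finset.sum_subset (fun y hy => ?_) fun y _ hy => ?_).symm
    · rw [mem_lev] at hy
      rw [mem_upto, hy]
      exact h
    · rw [mem_lev] at hy
      rw [cn_eq_zero (Ne.symm hy), Nat.cast_zero, zero_mul]
  · rw [Finset.sum_eq_zero, Finset.sum_eq_zero]
    · intro y hy
      rw [mem_lev] at hy
      rw [hF y (by omega), mul_zero]
    · intro y hy
      rw [mem_upto] at hy
      rw [cn_eq_zero (by omega), Nat.cast_zero, zero_mul]

theorem cn_coassoc_upto (n : ℕ) (a b d x : Ir k) (hx : x.deg ≤ n) :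
    ∑ y ∈ upto k n, cn a b y * cn y d x = ∑ z ∈ upto k n, cn b d z * cn a z x := by
  have h1 := sum_upto_cn_left (n := n) a b (fun y => cn y d x) fun y hy => cn_eq_zero (by omega)
  have h2 := sum_upto_cn_left (n := n) b d (fun y => cn a y x) fun y hy => cn_eq_zero (by omega)
  simp only [Nat.cast_id] at h1 h2
  rw [h1, h2, cn_coassoc]

end StructureConstants

section Convolution

variable {k : Type} [Field k] [Fintype k] {R : Type*} [CommRing R]

variable (k R) in
/-- Functions on irreducible characters, with the convolution product. -/
def Conv : Type _ := Ir k → R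

instance : AddCommGroup (Conv k R) := inferInstanceAs (AddCommGroup (Ir k → R))

open Classical in
/-- The unit of the convolution product. -/
noncomputable instance : One (Conv k R) := ⟨fun x => if x = one k then 1 else 0⟩

/-- The convolution product. -/
noncomputable instance : Mul (Conv k R) :=
  ⟨fun f g x => ∑ p ∈ pairs k x.deg, (cn p.1 p.2 x : R) * (f p.1 * g p.2)⟩

namespace Conv

open Classical in
theorem one_apply (x : Ir k) : (1 : Conv k R) x = if x = one k then 1 else 0 := rfl

theorem mul_apply (f g : Conv k R) (x : Ir k) :
    (f * g) x = ∑ p ∈ pairs k x.deg, (cn p.1 p.2 x : R) * (f p.1 * g p.2) := rfl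

@[simp] theorem add_apply (f g : Conv k R) (x : Ir k) : (f + g) x = f x + g x := rfl

@[simp] theorem zero_apply (x : Ir k) : (0 : Conv k R) x = 0 := rfl

@[ext] theorem ext {f g : Conv k R} (h : ∀ x, f x = g x) : f = g := funext h

theorem mul_apply_upto {n : ℕ} (f g : Conv k R) {x : Ir k} (hx : x.deg ≤ n) :
    (f * g) x = ∑ a ∈ upto k n, ∑ b ∈ upto k n, (cn a b x : R) * (f a * g b) := by
  rw [mul_apply, ← Finset.sum_product']
  refine Finset.sum_subset (fun p hp => ?_) fun p _ hp => ?_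
  · rw [mem_pairs] at hp
    rw [Finset.mem_product, mem_upto, mem_upto]
    omega
  · rw [mem_pairs] at hp
    rw [cn_eq_zero hp, Nat.cast_zero, zero_mul]

protected theorem mul_comm' (f g : Conv k R) : f * g = g * f := by
  ext x
  rw [mul_apply, mul_apply, sum_pairs_swap]
  refine Finset.sum_congr rfl fun p _ => ?_
  rw [cn_comm, Prod.fst_swap, Prod.snd_swap, mul_comm (f _)]

protected theorem one_mul' (f : Conv k R) : 1 * f = f := by
  classical
  ext x
  rw [mul_apply, Finset.sum_eq_single (one k, x)]
  · simp [cn_one_left, one_apply]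
  · intro p hp hne
    rw [one_apply]
    split_ifs with h
    · rw [h, cn_one_left, if_neg, Nat.cast_zero, zero_mul]
      rintro rfl
      exact hne (Prod.ext h rfl)
    · simp
  · intro h
    simp at h

protected theorem mul_assoc' (f g h : Conv k R) : f * g * h = f * (g * h) := by
  ext x
  have hle : ∀ y ∈ upto k x.deg, y.deg ≤ x.deg := fun y => mem_upto.1
  have h1 : (f * g * h) x = ∑ a ∈ upto k x.deg, ∑ b ∈ upto k x.deg, ∑ d ∈ upto k x.deg,
      ((∑ y ∈ upto k x.deg, cn a b y * cn y d x : ℕ) : R) * (f a * g b * h d) := by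
    rw [mul_apply_upto _ _ le_rfl]
    calc _ = ∑ y ∈ upto k x.deg, ∑ d ∈ upto k x.deg, ∑ a ∈ upto k x.deg, ∑ b ∈ upto k x.deg,
          ((cn a b y * cn y d x : ℕ) : R) * (f a * g b * h d) := by
          refine Finset.sum_congr rfl fun y hy => Finset.sum_congr rfl fun d _ => ?_
          rw [mul_apply_upto _ _ (hle y hy), Finset.sum_mul, Finset.mul_sum]
          refine Finset.sum_congr rfl fun a _ => ?_
          rw [Finset.sum_mul, Finset.mul_sum]
          refine Finset.sum_congr rfl fun b _ => ?_
          push_cast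
          ring
      _ = _ := by
          refine (Finset.sum_congr rfl fun y _ => Finset.sum_comm).trans ?_
          rw [Finset.sum_comm]
          refine Finset.sum_congr rfl fun a _ => ?_
          refine (Finset.sum_congr rfl fun y _ => Finset.sum_comm).trans ?_
          rw [Finset.sum_comm]
          refine Finset.sum_congr rfl fun b _ => ?_
          rw [Finset.sum_comm]
          refine Finset.sum_congr rfl fun d _ => ?_
          rw [Nat.cast_sum, Finset.sum_mul]
  have h2 : (f * (g * h)) x = ∑ a ∈ upto k x.deg, ∑ b ∈ upto k x.deg, ∑ d ∈ upto k x.deg,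
      ((∑ z ∈ upto k x.deg, cn b d z * cn a z x : ℕ) : R) * (f a * g b * h d) := by
    rw [mul_apply_upto _ _ le_rfl]
    refine Finset.sum_congr rfl fun a _ => ?_
    calc _ = ∑ z ∈ upto k x.deg, ∑ b ∈ upto k x.deg, ∑ d ∈ upto k x.deg,
          ((cn b d z * cn a z x : ℕ) : R) * (f a * g b * h d) := by
          refine Finset.sum_congr rfl fun z hz => ?_
          rw [mul_apply_upto _ _ (hle z hz), Finset.mul_sum, Finset.mul_sum]
          refine Finset.sum_congr rfl fun b _ => ?_
          rw [Finset.mul_sum, Finset.mul_sum]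
          refine Finset.sum_congr rfl fun d _ => ?_
          push_cast
          ring
      _ = _ := by
          rw [Finset.sum_comm]
          refine Finset.sum_congr rfl fun b _ => ?_
          rw [Finset.sum_comm]
          refine Finset.sum_congr rfl fun d _ => ?_
          rw [Nat.cast_sum, Finset.sum_mul]
  rw [h1, h2]
  simp only [cn_coassoc_upto _ _ _ _ x le_rfl]

noncomputable instance : CommRing (Conv k R) where
  __ := (inferInstance : AddCommGroup (Conv k R))
  mul_comm := Conv.mul_comm'
  mul_assoc := Conv.mul_assoc'
  one_mul := Conv.one_mul'
  mul_one f := by rw [Conv.mul_comm', Conv.one_mul']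
  left_distrib f g h := by
    ext x
    simp only [mul_apply, add_apply, mul_add, Finset.sum_add_distrib]
  right_distrib f g h := by
    ext x
    simp only [mul_apply, add_apply, mul_add, add_mul, Finset.sum_add_distrib]
  zero_mul f := by
    ext x
    simp [mul_apply]
  mul_zero f := by
    ext x
    simp [mul_apply]

end Conv

end Convolution

end

section

open Module

section Multiplicative

variable {k : Type} [Field k] [Fintype k] {R : Type*} [CommRing R]

/-- Functions that are multiplicative for the product of class functions dual to convolution. -/
structure IsMult (f : Conv k R) : Prop where
  one : f (one k) = 1
  mul : ∀ a b, ∑ x ∈ lev k (a.deg + b.deg), (cn a b x : R) * f x = f a * f b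

theorem IsMult.sum_mul {f : Conv k R} (hf : IsMult f) (g : Conv k R) (a b : Ir k) :
    ∑ x ∈ lev k (a.deg + b.deg), (cn a b x : R) * (f * g) x =
      ∑ p ∈ pairs k a.deg, ∑ r ∈ pairs k b.deg, (cn p.1 p.2 a : R) * (cn r.1 r.2 b : R) *
        (f p.1 * f r.1 * ∑ z ∈ lev k (p.2.deg + r.2.deg), (cn p.2 r.2 z : R) * g z) := by
  calc _ = ∑ u ∈ pairs k (a.deg + b.deg), ((∑ x ∈ lev k (u.1.deg + u.2.deg),
        cn a b x * cn u.1 u.2 x : ℕ) : R) * (f u.1 * g u.2) := by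
        have : ∀ x ∈ lev k (a.deg + b.deg), (cn a b x : R) * (f * g) x =
            ∑ u ∈ pairs k (a.deg + b.deg), (cn a b x : R) *
                ((cn u.1 u.2 x : R) * (f u.1 * g u.2)) := by
          intro x hx
          rw [mem_lev] at hx
          rw [Conv.mul_apply, hx, Finset.mul_sum]
        rw [Finset.sum_congr rfl this, Finset.sum_comm]
        refine Finset.sum_congr rfl fun u hu => ?_
        rw [mem_pairs] at hu
        rw [hu, Nat.cast_sum, Finset.sum_mul]
        refine Finset.sum_congr rfl fun x _ => ?_
        push_cast
        ring
    _ = ∑ u ∈ pairs k (a.deg + b.deg), ∑ p ∈ pairs k a.deg, ∑ r ∈ pairs k b.deg,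
        (cn p.1 p.2 a : R) * (cn r.1 r.2 b : R) *
          (((cn p.1 r.1 u.1 : R) * f u.1) * ((cn p.2 r.2 u.2 : R) * g u.2)) := by
        refine Finset.sum_congr rfl fun u _ => ?_
        rw [cn_hopf, Nat.cast_sum, Finset.sum_mul]
        refine Finset.sum_congr rfl fun p _ => ?_
        rw [Nat.cast_sum, Finset.sum_mul]
        refine Finset.sum_congr rfl fun r _ => ?_
        push_cast
        ring
    _ = _ := by
        rw [Finset.sum_comm]
        refine Finset.sum_congr rfl fun p hp => ?_
        rw [Finset.sum_comm]
        refine Finset.sum_congr rfl fun r hr => ?_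
        rw [mem_pairs] at hp hr
        rw [← Finset.mul_sum, sum_pairs_eq (a := p.1.deg + r.1.deg) (b := p.2.deg + r.2.deg)
          (by omega), ← hf.mul, Finset.sum_mul_sum]
        intro u hu
        by_contra h
        apply hu
        have h1 : cn p.1 r.1 u.1 ≠ 0 := fun h0 => h (by simp [h0])
        have h2 : cn p.2 r.2 u.2 ≠ 0 := fun h0 => h (by simp [h0])
        exact ⟨(deg_of_cn_ne_zero h1).symm, (deg_of_cn_ne_zero h2).symm⟩

theorem Conv.apply_one_mul (f g : Conv k R) :
    (f * g) (HaradaGL.one k) = f (HaradaGL.one k) * g (HaradaGL.one k) := by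
  rw [mul_apply, Finset.sum_eq_single (HaradaGL.one k, HaradaGL.one k)]
  · simp [cn_one_left]
  · intro p hp hne
    rw [mem_pairs, deg_one, add_eq_zero] at hp
    exact (hne (Prod.ext (eq_one_of_deg hp.1) (eq_one_of_deg hp.2))).elim
  · intro h
    simp at h

theorem Conv.sum_cn_mul_sum_cn (f g : Conv k R) (a b : Ir k) :
    ∑ p ∈ pairs k a.deg, ∑ r ∈ pairs k b.deg, (cn p.1 p.2 a : R) * (cn r.1 r.2 b : R) *
        (f p.1 * f r.1 * (g p.2 * g r.2)) = (f * g) a * (f * g) b := by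
  rw [mul_apply, mul_apply, Finset.sum_mul_sum]
  refine Finset.sum_congr rfl fun p _ => Finset.sum_congr rfl fun r _ => ?_
  ring

theorem IsMult.mul' {f g : Conv k R} (hf : IsMult f) (hg : IsMult g) : IsMult (f * g) where
  one := by rw [Conv.apply_one_mul, hf.one, hg.one, mul_one]
  mul a b := by
    rw [hf.sum_mul, ← Conv.sum_cn_mul_sum_cn]
    simp only [hg.mul]

theorem IsMult.one' : IsMult (1 : Conv k R) where
  one := by simp [Conv.one_apply]
  mul a b := by
    classical
    simp only [Conv.one_apply]
    by_cases h : a = HaradaGL.one k ∧ b = HaradaGL.one k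
    · obtain ⟨rfl, rfl⟩ := h
      simp [lev_zero, cn_one_left]
    · rw [Finset.sum_eq_zero]
      · rw [not_and_or] at h
        rcases h with h | h <;> simp [h]
      · intro x hx
        rw [if_neg, mul_zero]
        rintro rfl
        rw [mem_lev, deg_one] at hx
        exact h ⟨eq_one_of_deg (by omega), eq_one_of_deg (by omega)⟩

theorem IsMult.prod {ι : Type*} {f : ι → Conv k R} (s : Finset ι) (hf : ∀ i ∈ s, IsMult (f i)) :
    IsMult (∏ i ∈ s, f i) :=
  Finset.prod_induction _ _ (fun _ _ => IsMult.mul') IsMult.one' hf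

theorem IsMult.of_mul {f g : Conv k R} (hf : IsMult f) (hfg : IsMult (f * g)) : IsMult g where
  one := by
    have := hfg.one
    rwa [Conv.apply_one_mul, hf.one, one_mul] at this
  mul a b := by
    induction hn : a.deg + b.deg using Nat.strong_induction_on generalizing a b with
    | _ n ih =>
      subst hn
      have h1 := hfg.mul a b
      rw [hf.sum_mul, ← Conv.sum_cn_mul_sum_cn, ← sub_eq_zero, ← Finset.sum_sub_distrib] at h1
      simp only [← Finset.sum_sub_distrib, ← mul_sub] at h1
      rw [Finset.sum_eq_single (HaradaGL.one k, a), Finset.sum_eq_single (HaradaGL.one k, b)] at h1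
      · simpa [cn_one_left, hf.one, sub_eq_zero] using h1
      · intro r hr hne
        rw [mem_pairs] at hr
        by_cases h : r.1.deg = 0
        · have h0 : cn r.1 r.2 b = 0 := by
            rw [eq_one_of_deg h, cn_one_left, if_neg]
            rintro rfl
            exact hne (Prod.ext (eq_one_of_deg h) rfl)
          rw [h0, Nat.cast_zero, mul_zero, zero_mul]
        · rw [ih _ (by simp only; omega) _ _ rfl, sub_self, mul_zero, mul_zero]
      · intro h
        simp at h
      · intro p hp hne
        rw [mem_pairs] at hp
        refine Finset.sum_eq_zero fun r hr => ?_
        rw [mem_pairs] at hr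
        by_cases h : p.1.deg = 0
        · have h0 : cn p.1 p.2 a = 0 := by
            rw [eq_one_of_deg h, cn_one_left, if_neg]
            rintro rfl
            exact hne (Prod.ext (eq_one_of_deg h) rfl)
          rw [h0, Nat.cast_zero, zero_mul, zero_mul]
        · rw [ih _ (by omega) _ _ rfl, sub_self, mul_zero, mul_zero]
      · intro h
        simp at h

/-- Scaling by a power of the degree. -/
def Conv.scale (c : R) (f : Conv k R) : Conv k R := fun x => c ^ x.deg * f x

theorem Conv.scale_apply (c : R) (f : Conv k R) (x : Ir k) : scale c f x = c ^ x.deg * f x := rfl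

theorem IsMult.scale {f : Conv k R} (hf : IsMult f) (c : R) : IsMult (Conv.scale c f) where
  one := by simp [Conv.scale_apply, hf.one]
  mul a b := by
    simp only [Conv.scale_apply]
    have : ∀ x ∈ lev k (a.deg + b.deg), (cn a b x : R) * (c ^ x.deg * f x) =
        c ^ (a.deg + b.deg) * ((cn a b x : R) * f x) := by
      intro x hx
      rw [mem_lev] at hx
      rw [hx]
      ring
    rw [Finset.sum_congr rfl this, ← Finset.mul_sum, hf.mul, pow_add]
    ring

/-- The generating series of pairings. -/
noncomputable def pser (f g : Conv k R) : PowerSeries R :=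
  PowerSeries.mk fun n => ∑ x ∈ lev k n, f x * g x

theorem coeff_pser (f g : Conv k R) (n : ℕ) :
    PowerSeries.coeff n (pser f g) = ∑ x ∈ lev k n, f x * g x := PowerSeries.coeff_mk _ _

theorem sum_pairs {M : Type*} [AddCommMonoid M] (n : ℕ) (F : Ir k × Ir k → M) :
    ∑ p ∈ pairs k n, F p = ∑ m ∈ Finset.HasAntidiagonal.antidiagonal n, ∑ y ∈ lev k m.1,
        ∑ z ∈ lev k m.2, F (y, z) := by
  classical
  rw [pairs, Finset.sum_biUnion]
  · exact Finset.sum_congr rfl fun m _ => Finset.sum_product _ _ _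
  · intro m _ m' _ hne
    rw [Function.onFun, Finset.disjoint_left]
    intro p hp hp'
    rw [Finset.mem_product, mem_lev, mem_lev] at hp hp'
    exact hne (Prod.ext (hp.1.symm.trans hp'.1) (hp.2.symm.trans hp'.2))

theorem IsMult.pser_mul {f : Conv k R} (hf : IsMult f) (g h : Conv k R) :
    pser f (g * h) = pser f g * pser f h := by
  ext n
  rw [PowerSeries.coeff_mul]
  simp only [coeff_pser]
  have : ∀ x ∈ lev k n, f x * (g * h) x =
      ∑ p ∈ pairs k n, ((cn p.1 p.2 x : R) * f x) * (g p.1 * h p.2) := by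
    intro x hx
    rw [mem_lev] at hx
    rw [Conv.mul_apply, hx, Finset.mul_sum]
    exact Finset.sum_congr rfl fun p _ => by ring
  rw [Finset.sum_congr rfl this, Finset.sum_comm]
  calc _ = ∑ p ∈ pairs k n, (f p.1 * g p.1) * (f p.2 * h p.2) := by
        refine Finset.sum_congr rfl fun p hp => ?_
        rw [mem_pairs] at hp
        rw [← Finset.sum_mul, ← hp, hf.mul]
        ring
    _ = _ := by
        rw [sum_pairs]
        refine Finset.sum_congr rfl fun m _ => ?_
        rw [Finset.sum_mul_sum]

theorem IsMult.pser_one {f : Conv k R} (hf : IsMult f) : pser f 1 = 1 := by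
  ext n
  rw [coeff_pser, PowerSeries.coeff_one]
  split_ifs with h
  · subst h
    simp [lev_zero, hf.one, Conv.one_apply]
  · refine Finset.sum_eq_zero fun x hx => ?_
    rw [Conv.one_apply, if_neg, mul_zero]
    rintro rfl
    rw [mem_lev, deg_one] at hx
    exact h hx.symm

theorem pser_add (f g h : Conv k R) : pser f (g + h) = pser f g + pser f h := by
  ext n
  simp only [coeff_pser, Conv.add_apply, mul_add, Finset.sum_add_distrib, map_add]

/-- Pairing with a multiplicative function, as a ring homomorphism. -/
noncomputable def IsMult.pairing {f : Conv k R} (hf : IsMult f) : Conv k R →+* PowerSeries R where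
  toFun := pser f
  map_one' := hf.pser_one
  map_mul' := hf.pser_mul
  map_zero' := by
    ext n
    simp [coeff_pser]
  map_add' := pser_add f

variable (k) in
/-- `phi` as an element of the convolution ring. -/
noncomputable def phiC : Conv k ℂ := phi

/-- `whd` as an element of the convolution ring. -/
noncomputable def whC (ψ : AddChar k ℂ) : Conv k ℂ := whd ψ

theorem phiC_apply (x : Ir k) : phiC k x = phi x := rfl

theorem whC_apply (ψ : AddChar k ℂ) (x : Ir k) : whC ψ x = whd ψ x := rfl

theorem isMult_phi : IsMult (phiC k) where
  one := phi_one
  mul a b := by simpa only [cn_cast, phiC_apply] using phi_mul a b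

variable {ψ : AddChar k ℂ}

theorem phi_mul_whd (hψ : ψ ≠ 1) :
    phiC k * whC ψ = Conv.scale (Fintype.card k : ℂ) (phiC k) := by
  ext x
  rw [Conv.mul_apply, Conv.scale_apply, phiC_apply, ← sum_phi_mul_whd ψ hψ]
  simp only [cn_cast, phiC_apply, whC_apply]

theorem isMult_whd (hψ : ψ ≠ 1) : IsMult (whC ψ) :=
  isMult_phi.of_mul (by rw [phi_mul_whd hψ]; exact isMult_phi.scale _)

end Multiplicative

end

section

open Module

section Norms

variable {k : Type} [Field k] [Fintype k]

theorem phi_mul_cop (x : Ir k) : phi x * cop (Fintype.card k) x.deg = x.fn 1 :=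
  div_mul_cancel₀ _ (cop_ne_zero _)

theorem sum_phi_sq (n : ℕ) : ∑ x ∈ lev k n, phi x * phi x =
    (Fintype.card k : ℂ) ^ n.choose 2 / cop (Fintype.card k) n := by
  have h1 := sum_irr_mul (1 : GL (Fin n) k) 1
  have h2 : Nat.card {t : GL (Fin n) k // t * 1 * t⁻¹ = 1} = Nat.card (GL (Fin n) k) := by
    refine Nat.card_congr (Equiv.subtypeUnivEquiv fun t => ?_)
    simp
  rw [h2, card_GL_eq, inv_one] at h1
  have h3 : ∑ x ∈ lev k n, phi x * phi x * (cop (Fintype.card k) n * cop (Fintype.card k) n) =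
      ∑ χ : irrSet (GL (Fin n) k), χ.1 1 * χ.1 1 := by
    rw [sum_lev (n := n)
      fun x => phi x * phi x * (cop (Fintype.card k) n * cop (Fintype.card k) n)]
    refine Finset.sum_congr rfl fun χ _ => ?_
    have := phi_mul_cop (⟨n, χ⟩ : Ir k)
    change phi (⟨n, χ⟩ : Ir k) * cop (Fintype.card k) n = χ.1 1 at this
    rw [← this]
    ring
  rw [h1, ← Finset.sum_mul] at h3
  have h0 : (cop (Fintype.card k) n : ℂ) ≠ 0 := cop_ne_zero n
  push_cast at h3
  rw [eq_div_iff h0]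
  refine mul_right_cancel₀ h0 ?_
  rw [mul_assoc]
  exact h3

theorem one_lt_card : 1 < Fintype.card k := Fintype.one_lt_card

theorem pow_card_sub_one_ne_zero {n : ℕ} (hn : n ≠ 0) : (Fintype.card k : ℂ) ^ n - 1 ≠ 0 := by
  rw [sub_ne_zero]
  exact_mod_cast (Nat.one_lt_pow hn one_lt_card).ne'

theorem sum_range_cop {q : ℕ} (hq : 1 < q) (n : ℕ) :
    ∑ i ∈ Finset.range (n + 1), (q : ℂ) ^ i.choose 2 / cop q i =
      (q : ℂ) ^ n * ((q : ℂ) ^ n.choose 2 / cop q n) := by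
  induction n with
  | zero => simp [cop]
  | succ n ih =>
    rw [Finset.sum_range_succ, ih, cop_succ]
    have h0 : (cop q n : ℂ) ≠ 0 := by exact_mod_cast (cop_pos hq n).ne'
    have h1 : (q : ℂ) ^ (n + 1) - 1 ≠ 0 := by
      rw [sub_ne_zero]
      exact_mod_cast (Nat.one_lt_pow (Nat.succ_ne_zero n) hq).ne'
    have h2 : 1 ≤ q ^ (n + 1) := Nat.one_le_pow _ _ (by omega)
    rw [Nat.choose_succ_succ' n 1, Nat.choose_one_right]
    push_cast [Nat.cast_sub h2]
    field_simp
    ring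

variable {ψ : AddChar k ℂ}

theorem pser_scale {f g : Conv k ℂ} (n : ℕ) (c : ℂ) :
    PowerSeries.coeff n (pser f (Conv.scale c g)) = c ^ n * PowerSeries.coeff n (pser f g) := by
  rw [coeff_pser, coeff_pser, Finset.mul_sum]
  refine Finset.sum_congr rfl fun x hx => ?_
  rw [mem_lev] at hx
  rw [Conv.scale_apply, hx]
  ring

theorem sum_phi_whd (hψ : ψ ≠ 1) (n : ℕ) : ∑ x ∈ lev k n, phi x * whd ψ x = 1 := by
  induction n using Nat.strong_induction_on with
  | _ n ih =>
    have h := congr_arg (PowerSeries.coeff n) (isMult_phi.pser_mul (phiC k) (whC ψ))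
    rw [phi_mul_whd hψ, pser_scale, PowerSeries.coeff_mul] at h
    simp only [coeff_pser, phiC_apply, whC_apply] at h
    rw [sum_phi_sq, ← sum_range_cop one_lt_card, Finset.Nat.sum_antidiagonal_eq_sum_range_succ_mk,
      Finset.sum_range_succ', Finset.sum_range_succ'] at h
    simp only [sum_phi_sq, Nat.sub_zero] at h
    have h1 : ∑ i ∈ Finset.range n, (Fintype.card k : ℂ) ^ (i + 1).choose 2 /
        cop (Fintype.card k) (i + 1) * ∑ x ∈ lev k (n - (i + 1)), phi x * whd ψ x =
        ∑ i ∈ Finset.range n, (Fintype.card k : ℂ) ^ (i + 1).choose 2 /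
        cop (Fintype.card k) (i + 1) := by
      refine Finset.sum_congr rfl fun i hi => ?_
      rw [Finset.mem_range] at hi
      rw [ih _ (by omega), mul_one]
    rw [h1, add_right_inj] at h
    simpa [cop] using h.symm

theorem sum_whd_sq (hψ : ψ ≠ 1) (n : ℕ) :
    ∑ j ∈ Finset.range (n + 1), ∑ x ∈ lev k j, whd ψ x * whd ψ x = (Fintype.card k : ℂ) ^ n := by
  have h := congr_arg (PowerSeries.coeff n) ((isMult_whd hψ).pser_mul (whC ψ) (phiC k))
  rw [mul_comm, phi_mul_whd hψ, pser_scale, PowerSeries.coeff_mul] at h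
  simp only [coeff_pser, phiC_apply, whC_apply] at h
  simp only [mul_comm (whd ψ _) (phi _), sum_phi_whd hψ, mul_one] at h
  rw [h, Finset.Nat.sum_antidiagonal_eq_sum_range_succ_mk]

/-- The Whittaker multiplicity as a natural number. -/
noncomputable def wh (ψ : AddChar k ℂ) (x : Ir k) : ℕ := (whd_nat ψ x).choose

theorem wh_cast (ψ : AddChar k ℂ) (x : Ir k) : (wh ψ x : ℂ) = whd ψ x :=
  (whd_nat ψ x).choose_spec.symm

theorem sum_wh_sq_le (hψ : ψ ≠ 1) (n : ℕ) :
    ∑ j ∈ Finset.range (n + 1), ∑ x ∈ lev k j, wh ψ x ^ 2 = Fintype.card k ^ n := by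
  have := sum_whd_sq hψ n
  simp only [← wh_cast, ← sq] at this
  exact_mod_cast this

theorem sum_wh_sq (hψ : ψ ≠ 1) (n : ℕ) :
    ∑ x ∈ lev k (n + 1), wh ψ x ^ 2 + Fintype.card k ^ n = Fintype.card k ^ (n + 1) := by
  rw [← sum_wh_sq_le hψ (n + 1), Finset.sum_range_succ, sum_wh_sq_le hψ n, add_comm]

/-- The integral Whittaker functional. -/
noncomputable def whZ (ψ : AddChar k ℂ) : Conv k ℤ := fun x => wh ψ x

theorem whZ_apply (x : Ir k) : whZ ψ x = wh ψ x := rfl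

theorem sum_cn_mul_wh (hψ : ψ ≠ 1) (a b : Ir k) :
    ∑ x ∈ lev k (a.deg + b.deg), cn a b x * wh ψ x = wh ψ a * wh ψ b := by
  have := (isMult_whd hψ).mul a b
  simp only [whC_apply, ← wh_cast] at this
  exact_mod_cast this

@[simp] theorem wh_one : wh ψ (one k) = 1 := by
  have := wh_cast ψ (one k)
  rw [whd_one] at this
  exact_mod_cast this

theorem isMult_whZ (hψ : ψ ≠ 1) : IsMult (whZ ψ) where
  one := by simp [whZ_apply]
  mul a b := by
    simp only [whZ_apply]
    exact_mod_cast sum_cn_mul_wh hψ a b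

/-- Cuspidal characters. -/
structure IsCusp (ρ : Ir k) : Prop where
  pos : 0 < ρ.deg
  eq_one_or : ∀ a b, cn a b ρ ≠ 0 → a = one k ∨ b = one k

theorem IsCusp.ne_one {ρ : Ir k} (hρ : IsCusp ρ) : ρ ≠ one k := by
  rintro rfl
  simpa using hρ.pos

theorem exists_of_not_isCusp {x : Ir k} (hx : ¬ IsCusp x) (h0 : x ≠ one k) :
    ∃ a b, cn a b x ≠ 0 ∧ a ≠ one k ∧ b ≠ one k := by
  contrapose! hx
  refine ⟨?_, fun a b h => ?_⟩
  · by_contra! h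
    exact h0 (eq_one_of_deg (by omega))
  · by_contra! h'
    exact h'.2 (hx a b h h'.1)

theorem IsCusp.cases {ρ a b : Ir k} (hρ : IsCusp ρ) (h : cn a b ρ ≠ 0) :
    (a = one k ∧ b = ρ) ∨ (a = ρ ∧ b = one k) := by
  rcases hρ.eq_one_or a b h with rfl | rfl
  · rw [cn_one_left] at h
    by_cases h' : ρ = b
    · exact Or.inl ⟨rfl, h'.symm⟩
    · simp [h'] at h
  · rw [cn_one_right] at h
    by_cases h' : ρ = a
    · exact Or.inr ⟨h'.symm, rfl⟩
    · simp [h'] at h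

theorem fn_one_ne_zero (x : Ir k) : x.fn 1 ≠ 0 := by
  rw [show x.fn 1 = x.2.1 1 from rfl, irr_one_eq]
  exact_mod_cast (degree_pos _).ne'

theorem phi_ne_zero (x : Ir k) : phi x ≠ 0 := div_ne_zero (fn_one_ne_zero x) (cop_ne_zero _)

theorem IsCusp.whd_eq {ρ : Ir k} (hρ : IsCusp ρ) (hψ : ψ ≠ 1) :
    whd ψ ρ = ((Fintype.card k : ℂ) ^ ρ.deg - 1) * phi ρ := by
  classical
  have h := sum_phi_mul_whd ψ hψ ρ
  rw [Finset.sum_eq_add (one k, ρ) (ρ, one k)] at h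
  · simp only [cst_one_left, cst_one_right, if_true, phi_one, whd_one, one_mul, mul_one] at h
    linear_combination h
  · intro h'
    exact hρ.ne_one (congr_arg Prod.snd h')
  · intro p _ hne
    by_contra h0
    have h1 : cst p.1 p.2 ρ ≠ 0 := left_ne_zero_of_mul h0
    rw [← cn_cast, Nat.cast_ne_zero] at h1
    rcases hρ.cases h1 with h2 | h2
    · exact hne.1 (Prod.ext h2.1 h2.2)
    · exact hne.2 (Prod.ext h2.1 h2.2)
  · intro h'
    simp at h'
  · intro h'
    simp at h'

theorem IsCusp.wh_pos {ρ : Ir k} (hρ : IsCusp ρ) (hψ : ψ ≠ 1) : 0 < wh ψ ρ := by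
  rw [Nat.pos_iff_ne_zero, ← Nat.cast_ne_zero (R := ℂ), wh_cast, hρ.whd_eq hψ]
  exact mul_ne_zero (pow_card_sub_one_ne_zero hρ.pos.ne') (phi_ne_zero ρ)

end Norms

end

section

open Module

section DivSeq

variable {k : Type} [Field k] [Fintype k] {R : Type*} [CommRing R]

open Classical in
variable (R) in
/-- The indicator function of an irreducible character. -/
noncomputable def ind1 (x : Ir k) : Conv k R := fun y => if y = x then 1 else 0

open Classical in
theorem ind1_apply (x y : Ir k) : ind1 R x y = if y = x then 1 else 0 := rfl

theorem Conv.mul_nonneg {f g : Conv k ℤ} (hf : ∀ x, 0 ≤ f x) (hg : ∀ x, 0 ≤ g x) (x : Ir k) :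
    0 ≤ (f * g) x := by
  rw [mul_apply]
  exact Finset.sum_nonneg fun p _ =>
      _root_.mul_nonneg (Nat.cast_nonneg _) (_root_.mul_nonneg (hf _) (hg _))

theorem Conv.mul_pos_of {f g : Conv k ℤ} (hf : ∀ x, 0 ≤ f x) (hg : ∀ x, 0 ≤ g x) {a b x : Ir k}
    (ha : 0 < f a) (hb : 0 < g b) (hx : cn a b x ≠ 0) : 0 < (f * g) x := by
  rw [mul_apply]
  refine Finset.sum_pos' (fun p _ =>
      _root_.mul_nonneg (Nat.cast_nonneg _) (_root_.mul_nonneg (hf _) (hg _)))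
    ⟨(a, b), mem_pairs.2 (deg_of_cn_ne_zero hx), ?_⟩
  have : (0 : ℤ) < cn a b x := by exact_mod_cast Nat.pos_of_ne_zero hx
  exact mul_pos this (mul_pos ha hb)

theorem Conv.exists_of_mul_ne_zero {f g : Conv k R} {x : Ir k} (h : (f * g) x ≠ 0) :
    ∃ a b, cn a b x ≠ 0 ∧ f a ≠ 0 ∧ g b ≠ 0 := by
  rw [mul_apply] at h
  obtain ⟨p, _, hp⟩ := Finset.exists_ne_zero_of_sum_ne_zero h
  refine ⟨p.1, p.2, ?_, ?_, ?_⟩ <;> intro h0 <;> simp [h0] at hp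

theorem ind1_pow_nonneg (ρ : Ir k) (m : ℕ) : ∀ x, 0 ≤ (ind1 ℤ ρ ^ m) x := by
  classical
  induction m with
  | zero =>
    intro x
    rw [pow_zero, Conv.one_apply]
    split_ifs <;> simp
  | succ m ih =>
    rw [pow_succ]
    refine Conv.mul_nonneg ih fun x => ?_
    rw [ind1_apply]
    split_ifs <;> simp

theorem hopf_pos {a b y z x : Ir k} (h1 : cn a b x ≠ 0) (h2 : cn y z x ≠ 0) :
    ∃ p₁ p₂ r₁ r₂, cn p₁ p₂ a ≠ 0 ∧ cn r₁ r₂ b ≠ 0 ∧ cn p₁ r₁ y ≠ 0 ∧ cn p₂ r₂ z ≠ 0 := by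
  have h := cn_hopf a b y z
  have h0 : ∑ x ∈ lev k (y.deg + z.deg), cn a b x * cn y z x ≠ 0 := by
    refine (Finset.sum_pos' (fun _ _ => Nat.zero_le _) ⟨x, ?_, ?_⟩).ne'
    · rw [mem_lev, deg_of_cn_ne_zero h2]
    · exact Nat.pos_of_ne_zero (mul_ne_zero h1 h2)
  rw [h] at h0
  obtain ⟨p, _, hp⟩ := Finset.exists_ne_zero_of_sum_ne_zero h0
  obtain ⟨r, _, hr⟩ := Finset.exists_ne_zero_of_sum_ne_zero hp
  exact ⟨p.1, p.2, r.1, r.2, left_ne_zero_of_mul (left_ne_zero_of_mul hr),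
    right_ne_zero_of_mul (left_ne_zero_of_mul hr), left_ne_zero_of_mul (right_ne_zero_of_mul hr),
    right_ne_zero_of_mul (right_ne_zero_of_mul hr)⟩

theorem IsCusp.split {ρ : Ir k} (hρ : IsCusp ρ) (m : ℕ) {a b x : Ir k} (hx : (ind1 ℤ ρ ^ m) x ≠ 0)
    (h : cn a b x ≠ 0) :
    ∃ i j, i + j = m ∧ (ind1 ℤ ρ ^ i) a ≠ 0 ∧ (ind1 ℤ ρ ^ j) b ≠ 0 := by
  classical
  induction m generalizing a b x with
  | zero =>
    rw [pow_zero, Conv.one_apply] at hx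
    have hx1 : x = one k := by
      by_contra h'
      simp [h'] at hx
    subst hx1
    have := deg_of_cn_ne_zero h
    rw [deg_one, add_eq_zero] at this
    rw [eq_one_of_deg this.1, eq_one_of_deg this.2]
    exact ⟨0, 0, rfl, by simp [Conv.one_apply], by simp [Conv.one_apply]⟩
  | succ m ih =>
    rw [pow_succ] at hx
    obtain ⟨y, z, hyz, hy, hz⟩ := Conv.exists_of_mul_ne_zero hx
    have hzρ : z = ρ := by
      by_contra h'
      simp [ind1_apply, h'] at hz
    subst hzρ
    have key : ∀ i {u v w : Ir k}, (ind1 ℤ z ^ i) u ≠ 0 → v = z → cn u v w ≠ 0 →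
        (ind1 ℤ z ^ (i + 1)) w ≠ 0 := by
      intro i u v w hu hv hw
      rw [pow_succ]
      refine (Conv.mul_pos_of (ind1_pow_nonneg z i) (by simpa using ind1_pow_nonneg z 1)
        (a := u) (b := v) ?_ ?_ hw).ne'
      · exact lt_of_le_of_ne (ind1_pow_nonneg z i u) hu.symm
      · simp [ind1_apply, hv]
    obtain ⟨p₁, p₂, r₁, r₂, h1, h2, h3, h4⟩ := hopf_pos h hyz
    obtain ⟨i, j, hij, hi, hj⟩ := ih hy h3
    rcases hρ.cases h4 with ⟨hp, hr⟩ | ⟨hp, hr⟩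
    · rw [hp, cn_one_right] at h1
      have : a = p₁ := by
        by_contra h'
        simp [h'] at h1
      exact ⟨i, j + 1, by omega, this ▸ hi, key j hj hr h2⟩
    · rw [hr, cn_one_right] at h2
      have : b = r₁ := by
        by_contra h'
        simp [h'] at h2
      exact ⟨i + 1, j, by omega, key i hi hp h1, this ▸ hj⟩

theorem ind1_pow_deg {ρ x : Ir k} (m : ℕ) (h : (ind1 R ρ ^ m) x ≠ 0) : x.deg = m * ρ.deg := by
  classical
  induction m generalizing x with
  | zero =>
    rw [pow_zero, Conv.one_apply] at h
    have hx1 : x = one k := by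
      by_contra h'
      simp [h'] at h
    simp [hx1]
  | succ m ih =>
    rw [pow_succ] at h
    obtain ⟨y, z, hyz, hy, hz⟩ := Conv.exists_of_mul_ne_zero h
    have hzρ : z = ρ := by
      by_contra h'
      simp [ind1_apply, h'] at hz
    rw [← deg_of_cn_ne_zero hyz, ih hy, hzρ]
    ring

variable {ψ : AddChar k ℂ}

theorem pser_ind1 (f : Conv k R) (ρ : Ir k) :
    pser f (ind1 R ρ) = PowerSeries.monomial ρ.deg (f ρ) := by
  classical
  ext n
  rw [coeff_pser, PowerSeries.coeff_monomial]
  simp only [ind1_apply, mul_ite, mul_one, mul_zero]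
  rw [Finset.sum_ite_eq' _ _ fun x => f x]
  simp only [mem_lev, eq_comm]

theorem pser_pow {f : Conv k R} (hf : IsMult f) (g : Conv k R) (m : ℕ) :
    pser f (g ^ m) = pser f g ^ m := map_pow hf.pairing g m

theorem sum_wh_mul_ind1_pow (hψ : ψ ≠ 1) {ρ : Ir k} (h1 : wh ψ ρ = 1) (m : ℕ) :
    ∑ x ∈ lev k (m * ρ.deg), (wh ψ x : ℤ) * (ind1 ℤ ρ ^ m) x = 1 := by
  have h := congr_arg (PowerSeries.coeff (m * ρ.deg)) (pser_pow (isMult_whZ hψ) (ind1 ℤ ρ) m)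
  rw [coeff_pser, pser_ind1, whZ_apply, h1, PowerSeries.monomial_pow, PowerSeries.coeff_monomial,
    if_pos rfl] at h
  simpa [whZ_apply] using h

/-- A divided power sequence attached to a cuspidal character. -/
structure DivSeq (ψ : AddChar k ℂ) (ρ : Ir k) (e : ℕ → Ir k) : Prop where
  pos : 0 < ρ.deg
  one : e 1 = ρ
  deg : ∀ m, (e m).deg = m * ρ.deg
  wh : ∀ m, wh ψ (e m) = 1
  cn_add : ∀ i j, cn (e i) (e j) (e (i + j)) = 1
  cn_ne : ∀ {a b m}, cn a b (e m) ≠ 0 → ∃ i j, i + j = m ∧ a = e i ∧ b = e j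

theorem exists_unique_of_sum_eq_one {ι : Type*} {s : Finset ι} {f : ι → ℤ} (h : ∀ i ∈ s, 0 ≤ f i)
    (h1 : ∑ i ∈ s, f i = 1) : ∃ i ∈ s, f i = 1 ∧ ∀ j ∈ s, f j ≠ 0 → j = i := by
  classical
  obtain ⟨i, hi, hne⟩ := Finset.exists_ne_zero_of_sum_ne_zero (by rw [h1]; exact one_ne_zero)
  have hpos : 1 ≤ f i := by have := h i hi; omega
  rw [← Finset.add_sum_erase _ _ hi] at h1
  have h2 : 0 ≤ ∑ j ∈ s.erase i, f j :=
    Finset.sum_nonneg fun j hj => h j (Finset.mem_of_mem_erase hj)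
  have h3 : ∑ j ∈ s.erase i, f j = 0 := by omega
  refine ⟨i, hi, by omega, fun j hj hj0 => ?_⟩
  by_contra hji
  exact hj0 ((Finset.sum_eq_zero_iff_of_nonneg fun j hj => h j (Finset.mem_of_mem_erase hj)).1 h3 j
    (Finset.mem_erase.2 ⟨hji, hj⟩))

theorem IsCusp.exists_divSeq {ρ : Ir k} (hρ : IsCusp ρ) (hψ : ψ ≠ 1) (h1 : wh ψ ρ = 1) :
    ∃ e, DivSeq ψ ρ e := by
  classical
  have hex : ∀ m, ∃ x ∈ lev k (m * ρ.deg), (wh ψ x : ℤ) * (ind1 ℤ ρ ^ m) x = 1 ∧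
      ∀ y ∈ lev k (m * ρ.deg), (wh ψ y : ℤ) * (ind1 ℤ ρ ^ m) y ≠ 0 → y = x := fun m =>
    exists_unique_of_sum_eq_one
      (fun x _ => mul_nonneg (Nat.cast_nonneg _) (ind1_pow_nonneg ρ m x))
          (sum_wh_mul_ind1_pow hψ h1 m)
  choose e he h2 h3 using hex
  have hp : ∀ m, 0 < (ind1 ℤ ρ ^ m) (e m) := fun m => by
    refine lt_of_le_of_ne (ind1_pow_nonneg ρ m _) fun h => ?_
    have := h2 m
    simp [← h] at this
  have hw : ∀ m, wh ψ (e m) = 1 := fun m => by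
    have := Int.eq_one_or_neg_one_of_mul_eq_one (h2 m)
    omega
  have huniq : ∀ m x, (ind1 ℤ ρ ^ m) x ≠ 0 → wh ψ x ≠ 0 → x = e m := fun m x hx hx' =>
    h3 m x (mem_lev.2 (ind1_pow_deg m hx)) (mul_ne_zero (Nat.cast_ne_zero.2 hx') hx)
  refine ⟨e, hρ.pos, ?_, fun m => mem_lev.1 (he m), hw, fun i j => ?_, fun {a b m} h => ?_⟩
  · refine (huniq 1 ρ ?_ ?_).symm
    · simp [ind1_apply]
    · rw [h1]
      exact one_ne_zero
  · have h4 := sum_cn_mul_wh hψ (e i) (e j)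
    rw [hw, hw, Finset.sum_eq_single (e (i + j)), hw] at h4
    · simpa using h4
    · intro x _ hne
      by_contra h0
      refine hne (huniq _ x ?_ (right_ne_zero_of_mul h0))
      rw [pow_add]
      exact (Conv.mul_pos_of (ind1_pow_nonneg ρ i) (ind1_pow_nonneg ρ j) (hp i) (hp j)
        (left_ne_zero_of_mul h0)).ne'
    · intro h
      rw [mem_lev] at h
      rw [cn_eq_zero (Ne.symm h), zero_mul]
  · obtain ⟨i, j, hij, hi, hj⟩ := hρ.split m (hp m).ne' h
    have h4 := sum_cn_mul_wh hψ a b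
    have h5 : wh ψ a * wh ψ b ≠ 0 := by
      rw [← h4]
      refine (Finset.sum_pos' (fun _ _ => Nat.zero_le _) ⟨e m, ?_, ?_⟩).ne'
      · rw [mem_lev, deg_of_cn_ne_zero h]
      · rw [hw, mul_one]
        exact Nat.pos_of_ne_zero h
    exact ⟨i, j, hij, huniq i a hi (left_ne_zero_of_mul h5), huniq j b hj (right_ne_zero_of_mul h5)⟩

end DivSeq

end

section

open Module

section DivSeq

variable {k : Type} [Field k] [Fintype k] {R : Type*} [CommRing R]
variable {ψ : AddChar k ℂ} {ρ : Ir k} {e : ℕ → Ir k}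

namespace DivSeq

theorem injective (h : DivSeq ψ ρ e) : Function.Injective e := fun i j hij => by
  have := congr_arg Ir.deg hij
  rw [h.deg, h.deg] at this
  exact Nat.eq_of_mul_eq_mul_right h.pos this

theorem zero (h : DivSeq ψ ρ e) : e 0 = HaradaGL.one k := eq_one_of_deg (by rw [h.deg, zero_mul])

theorem mul_apply (h : DivSeq ψ ρ e) (f g : Conv k R) (m : ℕ) :
    (f * g) (e m) = ∑ p ∈ Finset.HasAntidiagonal.antidiagonal m, f (e p.1) * g (e p.2) := by
  classical
  rw [Conv.mul_apply]
  symm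
  refine Finset.sum_of_injOn (fun p => (e p.1, e p.2)) ?_ ?_ ?_ ?_
  · intro p _ r _ hpr
    simp only [Prod.mk.injEq] at hpr
    exact Prod.ext (h.injective hpr.1) (h.injective hpr.2)
  · intro p hp
    rw [Finset.mem_coe, Finset.HasAntidiagonal.mem_antidiagonal] at hp
    rw [Finset.mem_coe, mem_pairs, h.deg, h.deg, h.deg, ← hp, add_mul]
  · intro p _ hne
    by_contra h0
    have : cn p.1 p.2 (e m) ≠ 0 := fun h1 => h0 (by rw [h1, Nat.cast_zero, zero_mul])
    obtain ⟨i, j, hij, h1, h2⟩ := h.cn_ne this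
    exact hne ⟨(i, j), by simpa using hij, Prod.ext h1.symm h2.symm⟩
  · intro p hp
    rw [Finset.HasAntidiagonal.mem_antidiagonal] at hp
    rw [← hp, h.cn_add, Nat.cast_one, one_mul]

/-- The values on a divided power sequence, as a ring homomorphism. -/
noncomputable def ser (h : DivSeq ψ ρ e) : Conv k R →+* PowerSeries R where
  toFun f := PowerSeries.mk fun m => f (e m)
  map_one' := by
    ext m
    rw [PowerSeries.coeff_mk, PowerSeries.coeff_one, Conv.one_apply]
    simp only [← h.zero, h.injective.eq_iff]
  map_mul' f g := by
    ext m
    simp only [PowerSeries.coeff_mk, PowerSeries.coeff_mul, h.mul_apply]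
  map_zero' := by
    ext m
    simp
  map_add' f g := by
    ext m
    simp

theorem coeff_ser (h : DivSeq ψ ρ e) (f : Conv k R) (m : ℕ) :
    PowerSeries.coeff m (h.ser f) = f (e m) := PowerSeries.coeff_mk m fun m => f (e m)

theorem phi_eq (h : DivSeq ψ ρ e) (hψ : ψ ≠ 1) (m : ℕ) :
    phi (e m) = ((Fintype.card k ^ ρ.deg : ℕ) : ℂ) ^ m.choose 2 /
      cop (Fintype.card k ^ ρ.deg) m := by
  have hQ : 1 < Fintype.card k ^ ρ.deg := Nat.one_lt_pow h.pos.ne' one_lt_card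
  set Q := Fintype.card k ^ ρ.deg with hQd
  have hsum : ∀ m, ∑ i ∈ Finset.range (m + 1), phi (e i) = (Q : ℂ) ^ m * phi (e m) := by
    intro m
    have h1 := h.mul_apply (phiC k) (whC ψ) m
    simp only [phi_mul_whd hψ, Conv.scale_apply, phiC_apply, whC_apply, ← wh_cast, h.wh, h.deg,
      Nat.cast_one, mul_one] at h1
    rw [Finset.Nat.sum_antidiagonal_eq_sum_range_succ_mk] at h1
    rw [← h1, hQd, mul_comm m, pow_mul, Nat.cast_pow]
  induction m using Nat.strong_induction_on with
  | _ m ih =>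
    rcases Nat.eq_zero_or_pos m with rfl | hm
    · rw [h.zero, phi_one]
      simp [cop]
    have h1 := hsum m
    have h2 := sum_range_cop hQ m
    rw [Finset.sum_range_succ] at h1 h2
    rw [Finset.sum_congr rfl fun i hi => ih i (Finset.mem_range.1 hi)] at h1
    have h3 : (Q : ℂ) ^ m - 1 ≠ 0 := by
      rw [sub_ne_zero]
      exact_mod_cast (Nat.one_lt_pow hm.ne' hQ).ne'
    refine mul_left_cancel₀ h3 ?_
    linear_combination h2 - h1

theorem eq_one_of_isCusp (h : DivSeq ψ ρ e) {x : Ir k} (hx : IsCusp x) {m : ℕ} (hm : x = e m) :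
    x = ρ := by
  rcases m with _ | m
  · rw [h.zero] at hm
    exact absurd hm hx.ne_one
  · have h1 := h.cn_add 1 m
    rw [add_comm, ← hm] at h1
    rcases hx.cases (by rw [h1]; exact one_ne_zero) with h2 | h2
    · rw [← h.zero] at h2
      exact absurd (h.injective h2.1) one_ne_zero
    · rw [← h2.1, h.one]

theorem isCusp (h : DivSeq ψ ρ e) : IsCusp ρ where
  pos := h.pos
  eq_one_or a b hab := by
    rw [← h.one] at hab
    obtain ⟨i, j, hij, h1, h2⟩ := h.cn_ne hab
    rw [← h.zero, h1, h2]
    rcases i with _ | i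
    · exact Or.inl rfl
    · right
      congr
      omega

theorem eq_zero_of_ne {ρ' : Ir k} {e' : ℕ → Ir k} (h : DivSeq ψ ρ e) (h' : DivSeq ψ ρ' e')
    (hne : ρ ≠ ρ') {m m' : ℕ} (hm : e m = e' m') : m = 0 := by
  rcases m with _ | m
  · rfl
  · have h1 := h.cn_add 1 m
    rw [add_comm, hm] at h1
    obtain ⟨i, j, _, h2, _⟩ := h'.cn_ne (by rw [h1]; exact one_ne_zero)
    rw [h.one] at h2
    exact absurd (h'.eq_one_of_isCusp h.isCusp h2) hne

end DivSeq

open Classical in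
/-- The multiplicative function attached to a divided power sequence. -/
noncomputable def dE (e : ℕ → Ir k) (t : R) : Conv k R :=
  fun x => if h : ∃ m, x = e m then t ^ h.choose else 0

theorem dE_eq_zero {t : R} {x : Ir k} (h : ∀ m, x ≠ e m) : dE e t x = 0 := by
  rw [dE, dif_neg]
  simpa using h

namespace DivSeq

theorem dE_apply (h : DivSeq ψ ρ e) (t : R) (m : ℕ) : dE e t (e m) = t ^ m := by
  have hex : ∃ m', e m = e m' := ⟨m, rfl⟩
  rw [dE, dif_pos hex, ← h.injective hex.choose_spec]

theorem isMult_dE (h : DivSeq ψ ρ e) (t : R) : IsMult (dE e t) where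
  one := by rw [← h.zero, h.dE_apply, pow_zero]
  mul a b := by
    by_cases hab : ∃ i j, a = e i ∧ b = e j
    · obtain ⟨i, j, rfl, rfl⟩ := hab
      rw [Finset.sum_eq_single (e (i + j)), h.cn_add, h.dE_apply, h.dE_apply, h.dE_apply]
      · rw [Nat.cast_one, one_mul, pow_add]
      · intro x hx hne
        rw [dE_eq_zero, mul_zero]
        rintro m rfl
        rw [mem_lev, h.deg, h.deg, h.deg, ← add_mul] at hx
        exact hne (by rw [Nat.eq_of_mul_eq_mul_right h.pos hx])
      · intro hx
        rw [mem_lev, h.deg, h.deg, h.deg, add_mul] at hx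
        exact absurd rfl hx
    · rw [Finset.sum_eq_zero]
      · by_cases ha : ∃ i, a = e i
        · rw [dE_eq_zero (x := b), mul_zero]
          intro j hj
          exact hab ⟨ha.choose, j, ha.choose_spec, hj⟩
        · rw [dE_eq_zero (x := a), zero_mul]
          simpa using ha
      · intro x _
        by_contra h0
        have hx : ∃ m, x = e m := by
          by_contra hx
          rw [dE_eq_zero (by simpa using hx), mul_zero] at h0
          exact h0 rfl
        obtain ⟨m, rfl⟩ := hx
        obtain ⟨i, j, _, h1, h2⟩ := h.cn_ne (a := a) (b := b) (m := m)
          fun h1 => h0 (by rw [h1, Nat.cast_zero, zero_mul])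
        exact hab ⟨i, j, h1, h2⟩

theorem ser_dE (h : DivSeq ψ ρ e) (t : R) : h.ser (dE e t) = PowerSeries.mk fun m => t ^ m := by
  ext m
  rw [h.coeff_ser, h.dE_apply, PowerSeries.coeff_mk]

theorem ser_dE_of_ne {ρ' : Ir k} {e' : ℕ → Ir k} (h : DivSeq ψ ρ e) (h' : DivSeq ψ ρ' e')
    (hne : ρ ≠ ρ') (t : R) : h.ser (dE e' t) = 1 := by
  ext m
  rw [h.coeff_ser, PowerSeries.coeff_one]
  split_ifs with hm
  · rw [hm, h.zero, ← h'.zero, h'.dE_apply, pow_zero]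
  · exact dE_eq_zero fun m' hm' => hm (h.eq_zero_of_ne h' hne hm')

theorem coeff_pser_dE (h : DivSeq ψ ρ e) (f : Conv k R) (t : R) (n : ℕ) :
    PowerSeries.coeff n (pser f (dE e t)) =
      if ρ.deg ∣ n then f (e (n / ρ.deg)) * t ^ (n / ρ.deg) else 0 := by
  rw [coeff_pser]
  split_ifs with hd
  · obtain ⟨m, rfl⟩ := hd
    rw [Nat.mul_div_cancel_left _ h.pos, Finset.sum_eq_single (e m), h.dE_apply]
    · intro x hx hne
      rw [dE_eq_zero, mul_zero]
      rintro i rfl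
      rw [mem_lev, h.deg, mul_comm] at hx
      exact hne (by rw [Nat.eq_of_mul_eq_mul_left h.pos hx])
    · intro hx
      rw [mem_lev, h.deg, mul_comm] at hx
      exact absurd rfl hx
  · refine Finset.sum_eq_zero fun x hx => ?_
    rw [dE_eq_zero, mul_zero]
    rintro i rfl
    rw [mem_lev, h.deg] at hx
    exact hd ⟨i, by rw [← hx, mul_comm]⟩

end DivSeq

end DivSeq

end

section

section Alternants

open PowerSeries in
theorem coeff_prod_one_sub {A ι : Type*} [CommRing A] (u : ι → A) (s : Finset ι) {j : ℕ}
    (hj : s.card < j) : coeff j (∏ i ∈ s, (1 - C (u i) * X)) = 0 := by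
  classical
  induction s using Finset.induction_on generalizing j with
  | empty =>
    rw [Finset.prod_empty, coeff_one, if_neg]
    simp at hj
    omega
  | insert a s ha ih =>
    rw [Finset.card_insert_of_notMem ha] at hj
    obtain ⟨j, rfl⟩ : ∃ i, j = i + 1 := ⟨j - 1, by omega⟩
    rw [Finset.prod_insert ha, sub_mul, one_mul, map_sub, ih (by omega), mul_assoc, coeff_C_mul,
      coeff_succ_X_mul, ih (by omega), mul_zero, sub_zero]

theorem mk_pow_mul {A : Type*} [CommRing A] (a : A) :
    (PowerSeries.mk fun m => a ^ m) * (1 - PowerSeries.C a * PowerSeries.X) = 1 := by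
  ext n
  rw [mul_sub, mul_one, map_sub, PowerSeries.coeff_mk, PowerSeries.coeff_one]
  rcases n with _ | n
  · simp
  · rw [← mul_assoc, PowerSeries.coeff_succ_mul_X, PowerSeries.coeff_mul_C, PowerSeries.coeff_mk,
      pow_succ, sub_self, if_neg (Nat.succ_ne_zero n)]

/-- The matrix `h (l i - j)` of the Jacobi–Trudi formula. -/
def jtMatrix {A : Type*} [Zero A] {N : ℕ} (h : ℕ → A) (l : Fin N → ℕ) : Matrix (Fin N) (Fin N) A :=
  Matrix.of fun i j => if (j : ℕ) ≤ l i then h (l i - j) else 0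

theorem vandermonde_mul_jtMatrix {A : Type*} [CommRing A] {N : ℕ} (u : Fin N → A) (h : ℕ → A)
    (hh : PowerSeries.mk h * ∏ i, (1 - PowerSeries.C (u i) * PowerSeries.X) = 1) (l : Fin N → ℕ) :
    (Matrix.vandermonde u).det * (jtMatrix h l).det =
      (Matrix.of fun i j => u j ^ l i).det := by
  classical
  let P : Fin N → PowerSeries A := fun c =>
    ∏ i ∈ Finset.univ.erase c, (1 - PowerSeries.C (u i) * PowerSeries.X)
  let E : Matrix (Fin N) (Fin N) A := Matrix.of fun j c => PowerSeries.coeff j (P c)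
  have hP : ∀ c, PowerSeries.mk h * P c = PowerSeries.mk fun m => u c ^ m := by
    intro c
    rw [← Finset.prod_erase_mul _ _ (Finset.mem_univ c), ← mul_assoc] at hh
    calc _ = PowerSeries.mk h * P c *
          ((PowerSeries.mk fun m => u c ^ m) * (1 - PowerSeries.C (u c) * PowerSeries.X)) := by
          rw [mk_pow_mul, mul_one]
      _ = PowerSeries.mk h * P c * (1 - PowerSeries.C (u c) * PowerSeries.X) *
          (PowerSeries.mk fun m => u c ^ m) := by ring
      _ = _ := by rw [hh, one_mul]
  have hmul : ∀ l : Fin N → ℕ, jtMatrix h l * E = Matrix.of fun i j => u j ^ l i := by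
    intro l
    ext i c
    have h1 := congr_arg (PowerSeries.coeff (l i)) (hP c)
    rw [PowerSeries.coeff_mk, mul_comm, PowerSeries.coeff_mul,
      Finset.Nat.sum_antidiagonal_eq_sum_range_succ_mk] at h1
    simp only [PowerSeries.coeff_mk] at h1
    rw [Matrix.of_apply, ← h1, Matrix.mul_apply]
    simp only [jtMatrix, E, Matrix.of_apply]
    rw [Fin.sum_univ_eq_sum_range
      (fun j => (if j ≤ l i then h (l i - j) else 0) * PowerSeries.coeff j (P c)) N]
    have h2 : ∀ j, N ≤ j → PowerSeries.coeff j (P c) = 0 := fun j hj => by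
      refine coeff_prod_one_sub _ _ ?_
      rw [Finset.card_erase_of_mem (Finset.mem_univ c), Finset.card_fin]
      have := c.pos
      omega
    have h4 : ∀ j ∈ Finset.range (l i + 1), PowerSeries.coeff j (P c) * h (l i - j) =
        (if j ≤ l i then h (l i - j) else 0) * PowerSeries.coeff j (P c) := fun j hj => by
      rw [Finset.mem_range] at hj
      rw [if_pos (by omega), mul_comm]
    rw [Finset.sum_congr rfl h4, Finset.sum_subset (Finset.range_mono (le_max_left N (l i + 1))),
      Finset.sum_subset (Finset.range_mono (le_max_right N (l i + 1)))]
    · intro j _ hj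
      rw [Finset.mem_range] at hj
      rw [if_neg (by omega), zero_mul]
    · intro j _ hj
      rw [Finset.mem_range] at hj
      rw [h2 _ (by omega), mul_zero]
  have h3 := congr_arg Matrix.det (hmul fun i => i)
  rw [Matrix.det_mul, Matrix.det_of_isLowerTriangular] at h3
  · rw [← hmul l, Matrix.det_mul, mul_comm]
    congr 1
    have h0 : h 0 = 1 := by
      have := congr_arg PowerSeries.constantCoeff hh
      simpa [map_prod] using this
    simp only [jtMatrix, Matrix.of_apply, le_refl, if_true, Nat.sub_self, h0, Finset.prod_const_one,
      one_mul] at h3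
    rw [h3, ← Matrix.det_transpose]
    rfl
  · intro i j hij
    have h4 : i < j := OrderDual.toDual_lt_toDual.1 hij
    rw [jtMatrix, Matrix.of_apply, if_neg (by omega)]

theorem pow_choose_div_cop {Q : ℕ} (hQ : 1 < Q) {l r : ℕ} (hr : r ≤ l) :
    (Q : ℂ) ^ (l - r).choose 2 / cop Q (l - r) = (Q : ℂ) ^ l.choose 2 / cop Q l *
      ((∏ i ∈ Finset.range r, -(Q : ℂ) ^ (i + 1)) *
        ∏ i ∈ Finset.range r, (((Q : ℂ) ^ l)⁻¹ - ((Q : ℂ) ^ i)⁻¹)) := by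
  have hQ0 : (Q : ℂ) ≠ 0 := by
    rw [Nat.cast_ne_zero]
    omega
  induction r with
  | zero => simp
  | succ r ih =>
    have ih := ih (by omega)
    rw [Finset.prod_range_succ, Finset.prod_range_succ]
    obtain ⟨m, rfl⟩ : ∃ m, l = m + (r + 1) := ⟨l - (r + 1), by omega⟩
    rw [show m + (r + 1) - r = m + 1 by omega, cop_succ, Nat.choose_succ_succ' m 1,
      Nat.choose_one_right] at ih
    rw [Nat.add_sub_cancel]
    have h0 : (cop Q m : ℂ) ≠ 0 := by exact_mod_cast (cop_pos hQ m).ne'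
    have h1 : (Q : ℂ) ^ (m + 1) - 1 ≠ 0 := by
      rw [sub_ne_zero]
      exact_mod_cast (Nat.one_lt_pow (Nat.succ_ne_zero m) hQ).ne'
    have h2 : 1 ≤ Q ^ (m + 1) := Nat.one_le_pow _ _ (by omega)
    calc _ = (Q : ℂ) ^ (m + m.choose 2) / ((cop Q m * (Q ^ (m + 1) - 1) : ℕ) : ℂ) *
          (-(Q : ℂ) ^ (r + 1) * (((Q : ℂ) ^ (m + (r + 1)))⁻¹ - ((Q : ℂ) ^ r)⁻¹)) := by
          push_cast [Nat.cast_sub h2]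
          field_simp
          ring
      _ = _ := by
          rw [ih]
          ring

theorem det_phi {Q : ℕ} (hQ : 1 < Q) {N : ℕ} (l : Fin N → ℕ) :
    (jtMatrix (fun m => (Q : ℂ) ^ m.choose 2 / cop Q m) l).det =
      (∏ i, (Q : ℂ) ^ (l i).choose 2 / cop Q (l i)) *
        ((∏ j : Fin N, ∏ i ∈ Finset.range j, -(Q : ℂ) ^ (i + 1)) *
          (Matrix.vandermonde fun i => ((Q : ℂ) ^ l i)⁻¹).det) := by
  have hQ0 : (Q : ℂ) ≠ 0 := by
    rw [Nat.cast_ne_zero]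
    omega
  rw [Matrix.det_eval_matrixOfPolynomials_eq_det_vandermonde _
    (fun j => ∏ i ∈ Finset.range j, (Polynomial.X - Polynomial.C ((Q : ℂ) ^ i)⁻¹))
    (fun j => by rw [Polynomial.natDegree_finsetProd_X_sub_C_eq_card, Finset.card_range])
    (fun j => Polynomial.monic_prod_X_sub_C _ _), ← Matrix.det_mul_row, ← Matrix.det_mul_column]
  congr 1
  ext i j
  simp only [jtMatrix, Matrix.of_apply, Polynomial.eval_prod, Polynomial.eval_sub,
    Polynomial.eval_X, Polynomial.eval_C]
  split_ifs with h
  · exact pow_choose_div_cop hQ h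
  · have h0 : ∏ x ∈ Finset.range j, (((Q : ℂ) ^ l i)⁻¹ - ((Q : ℂ) ^ x)⁻¹) = 0 :=
      Finset.prod_eq_zero (Finset.mem_range.2 (by omega : l i < j)) (sub_self _)
    rw [h0, mul_zero, mul_zero]

theorem strictMono_fin_le {N : ℕ} {l : Fin N → ℕ} (hl : StrictMono l) (i : Fin N) :
    (i : ℕ) ≤ l i := by
  obtain ⟨i, hi⟩ := i
  induction i with
  | zero => exact Nat.zero_le _
  | succ i ih =>
    exact (ih (by omega)).trans_lt (hl (Fin.mk_lt_mk.2 (Nat.lt_succ_self i)))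

theorem choose_two_mul_two (i : ℕ) : i.choose 2 * 2 + i = i * i := by
  induction i with
  | zero => rfl
  | succ i ih =>
    rw [Nat.choose_succ_succ' i 1, Nat.choose_one_right]
    nlinarith

theorem det_phi_strictMono {Q : ℕ} (hQ : 1 < Q) {N : ℕ} {l : Fin N → ℕ} (hl : StrictMono l) :
    ∃ s : ℕ, (jtMatrix (fun m => (Q : ℂ) ^ m.choose 2 / cop Q m) l).det =
      (-1) ^ s * ((Q : ℂ) ^ (∑ i, (l i - i).choose 2) *
        (∏ i, ∏ j ∈ Finset.Ioi i, ((Q : ℂ) ^ (l j - l i) - 1)) / ∏ i, (cop Q (l i) : ℂ)) := by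
  have hQ0 : (Q : ℂ) ≠ 0 := by
    rw [Nat.cast_ne_zero]
    omega
  have hle := strictMono_fin_le hl
  refine ⟨(∑ j : Fin N, (j : ℕ)) + ∑ i : Fin N, (Finset.Ioi i).card, ?_⟩
  rw [det_phi hQ, Matrix.det_vandermonde]
  have h1 : ∀ i : Fin N, ∏ j ∈ Finset.Ioi i, (((Q : ℂ) ^ l j)⁻¹ - ((Q : ℂ) ^ l i)⁻¹) =
      (-1) ^ (Finset.Ioi i).card * ((∏ j ∈ Finset.Ioi i, ((Q : ℂ) ^ l j)⁻¹) *
        ∏ j ∈ Finset.Ioi i, ((Q : ℂ) ^ (l j - l i) - 1)) := by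
    intro i
    rw [← Finset.prod_const, ← Finset.prod_mul_distrib, ← Finset.prod_mul_distrib]
    refine Finset.prod_congr rfl fun j hj => ?_
    obtain ⟨m, hm⟩ := Nat.exists_eq_add_of_lt (hl (Finset.mem_Ioi.1 hj))
    rw [show l j - l i = m + 1 by omega, hm, pow_add (Q : ℂ) (l i + m), pow_add (Q : ℂ) (l i)]
    field_simp
    ring
  have h2 : ∏ i : Fin N, ∏ j ∈ Finset.Ioi i, ((Q : ℂ) ^ l j)⁻¹ =
      ∏ j : Fin N, (((Q : ℂ) ^ l j)⁻¹) ^ (j : ℕ) := by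
    rw [Finset.prod_comm' (t' := Finset.univ) (s' := fun j => Finset.Iio j)]
    · refine Finset.prod_congr rfl fun j _ => ?_
      rw [Finset.prod_const, Fin.card_Iio]
    · simp
  have h3 : ∀ j : Fin N, ∏ i ∈ Finset.range j, -(Q : ℂ) ^ (i + 1) =
      (-1) ^ (j : ℕ) * (Q : ℂ) ^ ((j : ℕ) + 1).choose 2 := by
    intro j
    generalize (j : ℕ) = m
    induction m with
    | zero => simp
    | succ m ih =>
      rw [Finset.prod_range_succ, ih, Nat.choose_succ_succ' (m + 1) 1, Nat.choose_one_right]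
      ring
  simp only [h1, h3]
  rw [Finset.prod_mul_distrib, Finset.prod_mul_distrib, Finset.prod_mul_distrib, h2,
    Finset.prod_pow_eq_pow_sum _ _ (-1 : ℂ), Finset.prod_pow_eq_pow_sum _ _ (-1 : ℂ),
    Finset.prod_div_distrib, ← Finset.prod_pow_eq_pow_sum Finset.univ
      (fun i => (l i - (i : ℕ)).choose 2)]
  have h4 : (∏ i : Fin N, (Q : ℂ) ^ (l i).choose 2) *
      (∏ i : Fin N, (Q : ℂ) ^ ((i : ℕ) + 1).choose 2) *
      ∏ i : Fin N, (((Q : ℂ) ^ l i)⁻¹) ^ (i : ℕ) =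
      ∏ i : Fin N, (Q : ℂ) ^ (l i - (i : ℕ)).choose 2 := by
    rw [← Finset.prod_mul_distrib, ← Finset.prod_mul_distrib]
    refine Finset.prod_congr rfl fun i _ => ?_
    rw [inv_pow, mul_inv_eq_iff_eq_mul₀ (pow_ne_zero _ (pow_ne_zero _ hQ0)), ← pow_add, ← pow_mul,
      ← pow_add]
    congr 1
    obtain ⟨m, hm⟩ := Nat.exists_eq_add_of_le (hle i)
    rw [hm, Nat.add_sub_cancel_left, choose_two_add, Nat.choose_succ_succ' (i : ℕ) 1,
      Nat.choose_one_right]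
    have h6 := choose_two_mul_two (i : ℕ)
    nlinarith
  rw [← h4, pow_add]
  ring

end Alternants

end

section

section Schur

open MvPolynomial

variable {k : Type} [Field k] [Fintype k] {ι : Type} [Fintype ι] [DecidableEq ι] {N : ℕ}

theorem prod_det_eq {R : Type*} [CommRing R] (M : ι → Matrix (Fin N) (Fin N) R) :
    ∏ c, (M c).det = ∑ σ : ι → Equiv.Perm (Fin N),
      (∏ c, ((Equiv.Perm.sign (σ c) : ℤ) : R)) * ∏ c, ∏ i, M c (σ c i) i := by
  simp only [Matrix.det_apply']
  rw [Finset.prod_univ_sum, Fintype.piFinset_univ]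
  simp only [Finset.prod_mul_distrib]

/-- Change of scalars for functions. -/
def Conv.mapFun {R S : Type*} [CommRing R] [CommRing S] (φ : R →+* S) (f : Conv k R) : Conv k S :=
  fun x => φ (f x)

omit [Fintype k] in
theorem Conv.mapFun_apply {R S : Type*} [CommRing R] [CommRing S] (φ : R →+* S) (f : Conv k R)
    (x : Ir k) : Conv.mapFun φ f x = φ (f x) := rfl

/-- Change of scalars on the convolution ring. -/
def Conv.map {R S : Type*} [CommRing R] [CommRing S] (φ : R →+* S) : Conv k R →+* Conv k S where
  toFun := Conv.mapFun φ
  map_one' := by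
    ext x
    simp only [Conv.mapFun_apply, Conv.one_apply]
    split_ifs <;> simp
  map_zero' := by
    ext x
    simp only [Conv.mapFun_apply, Conv.zero_apply, map_zero]
  map_add' f g := by
    ext x
    simp only [Conv.mapFun_apply, Conv.add_apply, map_add]
  map_mul' f g := by
    ext x
    simp only [Conv.mapFun_apply, Conv.mul_apply, map_sum, map_mul, map_natCast]

theorem Conv.map_apply {R S : Type*} [CommRing R] [CommRing S] (φ : R →+* S) (f : Conv k R)
    (x : Ir k) : Conv.map φ f x = φ (f x) := rfl

/-- Evaluation as an additive homomorphism. -/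
def Conv.evalHom {R : Type*} [CommRing R] (x : Ir k) : Conv k R →+ R where
  toFun f := f x
  map_zero' := Conv.zero_apply x
  map_add' f g := Conv.add_apply f g x

theorem Conv.sum_apply {R κ : Type*} [CommRing R] (s : Finset κ) (f : κ → Conv k R) (x : Ir k) :
    (∑ i ∈ s, f i) x = ∑ i ∈ s, f i x :=
  map_sum (Conv.evalHom x) f s

theorem Conv.intCast_mul_apply {R : Type*} [CommRing R] (n : ℤ) (f : Conv k R) (x : Ir k) :
    ((n : Conv k R) * f) x = n * f x := by
  rw [← zsmul_eq_mul, ← zsmul_eq_mul]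
  exact map_zsmul (Conv.evalHom x) n f

/-- The generating function of the products of members of divided power sequences. -/
noncomputable def theta (e : ι → ℕ → Ir k) (N : ℕ) : Conv k (MvPolynomial (ι × Fin N) ℤ) :=
  ∏ i : ι × Fin N, dE (e i.1) (X i)

/-- Determinantal expressions in the members of divided power sequences. -/
noncomputable def schur (e : ι → ℕ → Ir k) (l : ι → Fin N → ℕ) : Conv k ℤ :=
  ∏ c, (jtMatrix (fun m => ind1 ℤ (e c m)) (l c)).det

variable {ψ : AddChar k ℂ} {ρ : ι → Ir k} {e : ι → ℕ → Ir k}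

open Classical in
theorem coeff_prod_dE (he : ∀ c, DivSeq ψ (ρ c) (e c)) (s : Finset (ι × Fin N))
    (m : ι × Fin N →₀ ℕ) (x : Ir k) :
    coeff m ((∏ i ∈ s, (dE (e i.1) (X i) : Conv k (MvPolynomial (ι × Fin N) ℤ))) x) =
      if m.support ⊆ s then (∏ i ∈ s, ind1 ℤ (e i.1 (m i))) x else 0 := by
  induction s using Finset.induction_on generalizing m x with
  | empty =>
    simp only [Finset.prod_empty, Finset.subset_empty, Finsupp.support_eq_empty, Conv.one_apply]
    by_cases hx : x = one k
    · rw [if_pos hx, if_pos hx, coeff_one]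
      simp only [eq_comm]
    · rw [if_neg hx, if_neg hx, coeff_zero, ite_self]
  | insert i s hi ih =>
    rw [Finset.prod_insert hi, Finset.prod_insert hi, Conv.mul_apply, Conv.mul_apply, coeff_sum]
    trans ∑ p ∈ pairs k x.deg, if m.support ⊆ insert i s then
      (cn p.1 p.2 x : ℤ) * (ind1 ℤ (e i.1 (m i)) p.1 * (∏ j ∈ s, ind1 ℤ (e j.1 (m j))) p.2) else 0
    swap
    · split_ifs
      · rfl
      · exact Finset.sum_const_zero
    refine Finset.sum_congr rfl fun p _ => ?_
    rw [← map_natCast (C : ℤ →+* MvPolynomial (ι × Fin N) ℤ), coeff_C_mul]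
    by_cases hp : ∃ t, p.1 = e i.1 t
    · obtain ⟨t, ht⟩ := hp
      rw [ht, (he i.1).dE_apply, X_pow_eq_monomial, coeff_monomial_mul', one_mul, ih, ind1_apply,
        (he i.1).injective.eq_iff]
      by_cases htm : t = m i
      · subst htm
        have h1 : Finsupp.single i (m i) ≤ m := by simp
        have h2 : (m - Finsupp.single i (m i)).support ⊆ s ↔ m.support ⊆ insert i s := by
          have h4 : m - Finsupp.single i (m i) = m.erase i := by
            ext j
            by_cases hj : j = i
            · subst hj
              simp
            · rw [Finsupp.erase_ne hj, Finsupp.tsub_apply, Finsupp.single_eq_of_ne hj,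
                Nat.sub_zero]
          rw [h4, Finsupp.support_erase, Finset.subset_insert_iff]
        have h3 : (∏ j ∈ s, ind1 ℤ (e j.1 ((m - Finsupp.single i (m i)) j))) =
            ∏ j ∈ s, ind1 ℤ (e j.1 (m j)) := by
          refine Finset.prod_congr rfl fun j hj => ?_
          have : i ≠ j := fun hij => hi (hij ▸ hj)
          simp [this]
        rw [if_pos h1, if_pos rfl, h3]
        simp only [h2, one_mul, mul_ite, mul_zero]
      · rw [if_neg htm, zero_mul, mul_zero, ite_self]
        split_ifs with h1 h2
        · have h3 : i ∈ (m - Finsupp.single i t).support := by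
            rw [Finsupp.mem_support_iff]
            have := h1 i
            simp only [Finsupp.single_eq_same, Finsupp.coe_tsub, Pi.sub_apply] at this ⊢
            omega
          exact absurd (h2 h3) hi
        · rw [mul_zero]
        · rw [mul_zero]
    · rw [dE_eq_zero (by simpa using hp), zero_mul, coeff_zero, mul_zero, ind1_apply,
        if_neg (fun h => hp ⟨_, h⟩), zero_mul, mul_zero, ite_self]

theorem coeff_theta (he : ∀ c, DivSeq ψ (ρ c) (e c)) (m : ι × Fin N →₀ ℕ) (x : Ir k) :
    coeff m (theta e N x) = (∏ c, ∏ i, ind1 ℤ (e c (m (c, i)))) x := by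
  classical
  rw [theta, coeff_prod_dE he, if_pos (Finset.subset_univ _), Fintype.prod_prod_type]

variable (ι N) in
/-- The product of Vandermonde determinants. -/
noncomputable def vander : MvPolynomial (ι × Fin N) ℤ :=
  ∏ c, (Matrix.vandermonde fun i => X (c, i)).det

/-- A family of exponents as a finitely supported function. -/
noncomputable def expo (l : ι → Fin N → ℕ) : ι × Fin N →₀ ℕ :=
  Finsupp.equivFunOnFinite.symm fun i => l i.1 i.2

theorem expo_apply (l : ι → Fin N → ℕ) (i : ι × Fin N) : expo l i = l i.1 i.2 := rfl

theorem prod_X_pow (l : ι → Fin N → ℕ) :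
    ∏ c, ∏ i, (X (c, i) : MvPolynomial (ι × Fin N) ℤ) ^ l c i = monomial (expo l) 1 := by
  rw [monomial_eq, C_1, one_mul, Finsupp.prod_fintype _ _ fun _ => pow_zero _,
    Fintype.prod_prod_type]
  rfl

theorem coeff_vander_mul_theta (he : ∀ c, DivSeq ψ (ρ c) (e c)) (l : ι → Fin N → ℕ) (x : Ir k) :
    coeff (expo l) (vander ι N * theta e N x) = schur e l x := by
  classical
  rw [vander, schur, prod_det_eq, prod_det_eq, Finset.sum_mul, coeff_sum]
  trans ∑ σ : ι → Equiv.Perm (Fin N), (∏ c, ((Equiv.Perm.sign (σ c) : ℤ))) *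
    (∏ c, ∏ i, jtMatrix (fun m => ind1 ℤ (e c m)) (l c) (σ c i) i) x
  · refine Finset.sum_congr rfl fun σ _ => ?_
    have h1 : ∏ c, ∏ i, (Matrix.vandermonde fun i => (X (c, i) : MvPolynomial (ι × Fin N) ℤ))
        (σ c i) i = monomial (expo fun c i => (((σ c).symm i : Fin N) : ℕ)) 1 := by
      rw [← prod_X_pow]
      refine Finset.prod_congr rfl fun c _ => ?_
      rw [← Equiv.prod_comp (σ c) fun i => (X (c, i) : MvPolynomial (ι × Fin N) ℤ) ^
        (((σ c).symm i : Fin N) : ℕ)]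
      simp [Matrix.vandermonde_apply]
    have h2 : (∏ c, (((Equiv.Perm.sign (σ c) : ℤ)) : MvPolynomial (ι × Fin N) ℤ)) =
        C (∏ c, ((Equiv.Perm.sign (σ c) : ℤ))) := by
      rw [map_prod]
      simp
    rw [h1, h2, mul_assoc, coeff_C_mul, coeff_monomial_mul', one_mul, coeff_theta he]
    congr 1
    split_ifs with hle
    · suffices h : (∏ c, ∏ i, ind1 ℤ (e c ((expo l - expo fun c i =>
          (((σ c).symm i : Fin N) : ℕ)) (c, i)))) =
          ∏ c, ∏ i, jtMatrix (fun m => ind1 ℤ (e c m)) (l c) (σ c i) i from congr_fun h x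
      refine Finset.prod_congr rfl fun c _ => ?_
      rw [← Equiv.prod_comp (σ c) fun i => ind1 ℤ (e c (((expo l) - expo fun c i =>
        (((σ c).symm i : Fin N) : ℕ)) (c, i)))]
      refine Finset.prod_congr rfl fun i _ => ?_
      have h3 := hle (c, σ c i)
      rw [expo_apply, expo_apply] at h3
      simp only [Equiv.symm_apply_apply] at h3
      rw [jtMatrix, Matrix.of_apply, if_pos h3, Finsupp.tsub_apply, expo_apply, expo_apply]
      simp
    · rw [Finsupp.le_def, not_forall] at hle
      obtain ⟨⟨c, i⟩, hi⟩ := hle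
      rw [Finset.prod_eq_zero (Finset.mem_univ c), Conv.zero_apply]
      refine Finset.prod_eq_zero (Finset.mem_univ ((σ c).symm i)) ?_
      rw [jtMatrix, Matrix.of_apply, if_neg]
      rw [expo_apply, expo_apply] at hi
      simpa using hi
  · rw [Conv.sum_apply]
    refine Finset.sum_congr rfl fun σ _ => ?_
    rw [← Int.cast_prod, Conv.intCast_mul_apply, Int.cast_id]

end Schur

end

section

section Schur

variable {k : Type} [Field k] [Fintype k] {ι : Type} [Fintype ι] [DecidableEq ι] {N : ℕ}
variable {ψ : AddChar k ℂ} {ρ : ι → Ir k} {e : ι → ℕ → Ir k}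

theorem Conv.map_ind1 {R S : Type*} [CommRing R] [CommRing S] (φ : R →+* S) (x : Ir k) :
    Conv.map φ (ind1 R x) = ind1 S x := by
  classical
  ext y
  rw [Conv.map_apply, ind1_apply, ind1_apply]
  split_ifs <;> simp

open PowerSeries in
theorem pser_det_jtMatrix {A : Type*} [CommRing A] {f : Conv k A} (hf : IsMult f) {ρ : Ir k}
    {e : ℕ → Ir k} (he : DivSeq ψ ρ e) (l : Fin N → ℕ) :
    X ^ (ρ.deg * ∑ i : Fin N, (i : ℕ)) *
      hf.pairing (Conv.map (Int.castRingHom A) (jtMatrix (fun m => ind1 ℤ (e m)) l).det) =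
      X ^ (ρ.deg * ∑ i, l i) * C (jtMatrix (fun m => f (e m)) l).det := by
  rw [RingHom.map_det, RingHom.map_det, RingHom.map_det, Finset.mul_sum, Finset.mul_sum,
    ← Finset.prod_pow_eq_pow_sum, ← Finset.prod_pow_eq_pow_sum, ← Matrix.det_mul_row,
    ← Matrix.det_mul_column]
  congr 1
  ext1 i j
  simp only [jtMatrix, Matrix.of_apply, RingHom.mapMatrix_apply, Matrix.map_apply]
  split_ifs with h
  · rw [Conv.map_ind1]
    change X ^ (ρ.deg * (j : ℕ)) * pser f (ind1 A (e (l i - j))) = _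
    rw [pser_ind1, monomial_eq_C_mul_X_pow, he.deg]
    obtain ⟨m, hm⟩ := Nat.exists_eq_add_of_le h
    rw [hm, Nat.add_sub_cancel_left]
    ring
  · simp

theorem sum_mul_schur {A : Type*} [CommRing A] {f : Conv k A} (hf : IsMult f)
    (he : ∀ c, DivSeq ψ (ρ c) (e c)) (l : ι → Fin N → ℕ) (n : ℕ) :
    ∑ x ∈ lev k n, f x * (schur e l x : A) =
      if n + ∑ c, (ρ c).deg * ∑ i : Fin N, (i : ℕ) = ∑ c, (ρ c).deg * ∑ i, l c i then
        ∏ c, (jtMatrix (fun m => f (e c m)) (l c)).det else 0 := by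
  have h : PowerSeries.X ^ (∑ c, (ρ c).deg * ∑ i : Fin N, (i : ℕ)) *
      hf.pairing (Conv.map (Int.castRingHom A) (schur e l)) =
          PowerSeries.X ^ (∑ c, (ρ c).deg * ∑ i, l c i) *
        PowerSeries.C (∏ c, (jtMatrix (fun m => f (e c m)) (l c)).det) := by
    rw [schur, map_prod, map_prod, map_prod, ← Finset.prod_pow_eq_pow_sum,
      ← Finset.prod_pow_eq_pow_sum, ← Finset.prod_mul_distrib, ← Finset.prod_mul_distrib]
    exact Finset.prod_congr rfl fun c _ => pser_det_jtMatrix hf (he c) (l c)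
  have h1 := congr_arg (PowerSeries.coeff (n + ∑ c, (ρ c).deg * ∑ i : Fin N, (i : ℕ))) h
  rw [PowerSeries.coeff_X_pow_mul, mul_comm, PowerSeries.coeff_C_mul, PowerSeries.coeff_X_pow,
    mul_ite, mul_one, mul_zero] at h1
  rw [← h1]
  exact (coeff_pser _ _ _).symm

open MvPolynomial

theorem isMult_theta (he : ∀ c, DivSeq ψ (ρ c) (e c)) : IsMult (theta e N) :=
  IsMult.prod _ fun i _ => (he i.1).isMult_dE _

theorem ser_theta (he : ∀ c, DivSeq ψ (ρ c) (e c)) (hρ : Function.Injective ρ) (c : ι) :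
    (PowerSeries.mk fun m => theta e N (e c m)) *
      ∏ i, (1 - PowerSeries.C (X (c, i) : MvPolynomial (ι × Fin N) ℤ) * PowerSeries.X) = 1 := by
  have h : (PowerSeries.mk fun m => theta e N (e c m)) = (he c).ser (theta e N) := by
    ext1 m
    rw [(he c).coeff_ser, PowerSeries.coeff_mk]
  rw [h, theta, map_prod, Fintype.prod_prod_type, Finset.prod_eq_single c,
    ← Finset.prod_mul_distrib]
  · refine Finset.prod_eq_one fun i _ => ?_
    rw [(he c).ser_dE, mk_pow_mul]
  · intro c' _ hne
    exact Finset.prod_eq_one fun i _ => (he c).ser_dE_of_ne (he c') (hρ.ne hne.symm) _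
  · intro h
    exact absurd (Finset.mem_univ c) h

theorem eq_one_of_strictMono {l l' : Fin N → ℕ} (hl : StrictMono l) (hl' : StrictMono l')
    {σ : Equiv.Perm (Fin N)} (h : ∀ i, l i = l' (σ i)) : σ = 1 := by
  have hσ : StrictMono σ := fun i j hij => by
    rw [← hl'.lt_iff_lt, ← h, ← h]
    exact hl hij
  ext i
  have := Subsingleton.elim (hσ.orderIsoOfSurjective σ σ.surjective) (OrderIso.refl _)
  have h2 := DFunLike.congr_fun this i
  rw [Equiv.Perm.one_apply]
  exact congr_arg Fin.val h2

theorem sum_schur_mul_schur (he : ∀ c, DivSeq ψ (ρ c) (e c)) (hρ : Function.Injective ρ)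
    {l l' : ι → Fin N → ℕ} (hl : ∀ c, StrictMono (l c)) (hl' : ∀ c, StrictMono (l' c)) (n : ℕ) :
    ∑ x ∈ lev k n, schur e l x * schur e l' x = if l = l' ∧
      n + ∑ c, (ρ c).deg * ∑ i : Fin N, (i : ℕ) = ∑ c, (ρ c).deg * ∑ i, l' c i then 1 else 0 := by
  have h1 : ∀ x ∈ lev k n, coeff (expo l) (vander ι N * theta e N x *
      ((schur e l' x : ℤ) : MvPolynomial (ι × Fin N) ℤ)) = schur e l x * schur e l' x := by
    intro x _
    rw [← coeff_vander_mul_theta he l, mul_comm _ (Int.cast _),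
      ← eq_intCast (C : ℤ →+* MvPolynomial (ι × Fin N) ℤ), coeff_C_mul, mul_comm]
  rw [← Finset.sum_congr rfl h1, ← coeff_sum]
  simp only [mul_assoc]
  rw [← Finset.mul_sum, sum_mul_schur (isMult_theta (N := N) he) he l' n]
  have h2 : coeff (expo l) (vander ι N *
      ∏ c, (jtMatrix (fun m => theta e N (e c m)) (l' c)).det) = if l = l' then 1 else 0 := by
    rw [vander, ← Finset.prod_mul_distrib, Finset.prod_congr rfl fun c _ =>
      vandermonde_mul_jtMatrix _ _ (ser_theta he hρ c) (l' c), prod_det_eq, coeff_sum]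
    have h3 : ∀ σ : ι → Equiv.Perm (Fin N), coeff (expo l)
        ((∏ c, (((Equiv.Perm.sign (σ c) : ℤ)) : MvPolynomial (ι × Fin N) ℤ)) *
          ∏ c, ∏ i, (Matrix.of fun i j => (X (c, j) : MvPolynomial (ι × Fin N) ℤ) ^ l' c i)
            (σ c i) i) = if l = l' ∧ σ = 1 then 1 else 0 := by
      intro σ
      have h4 : (∏ c, (((Equiv.Perm.sign (σ c) : ℤ)) : MvPolynomial (ι × Fin N) ℤ)) =
          C (∏ c, ((Equiv.Perm.sign (σ c) : ℤ))) := by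
        rw [map_prod]
        simp
      have h5 := prod_X_pow (fun c i => l' c (σ c i))
      simp only [Matrix.of_apply]
      rw [h4, h5, coeff_C_mul, coeff_monomial]
      by_cases hlσ : ∀ c i, l c i = l' c (σ c i)
      · have hσ : σ = 1 := funext fun c => eq_one_of_strictMono (hl c) (hl' c) (hlσ c)
        have hll : l = l' := by
          ext c i
          rw [hlσ, hσ]
          rfl
        subst hσ hll
        simp
      · rw [if_neg, if_neg, mul_zero]
        · rintro ⟨rfl, rfl⟩
          exact hlσ fun _ _ => rfl
        · intro h6
          exact hlσ fun c i => (DFunLike.congr_fun h6 (c, i)).symm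
    rw [Finset.sum_congr rfl fun σ _ => h3 σ]
    by_cases hll : l = l' <;> simp [hll]
  by_cases hn : n + ∑ c, (ρ c).deg * ∑ i : Fin N, (i : ℕ) = ∑ c, (ρ c).deg * ∑ i, l' c i
  · rw [if_pos hn, h2]
    simp only [hn, and_true]
  · rw [if_neg hn, mul_zero, coeff_zero, if_neg (fun h => hn h.2)]

end Schur

end

section

section Rows

variable {N : ℕ}

/-- The strictly increasing sequence whose gaps are prescribed by `m`. -/
def rows (m : Fin N → ℕ) (i : Fin N) : ℕ := i + ∑ j ∈ Finset.Iic i, m j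

theorem Iic_succ {i : ℕ} (h : i + 1 < N) :
    Finset.Iic (⟨i + 1, h⟩ : Fin N) =
      insert ⟨i + 1, h⟩ (Finset.Iic (⟨i, (Nat.lt_succ_self i).trans h⟩ : Fin N)) := by
  ext j
  simp only [Finset.mem_Iic, Finset.mem_insert, Fin.le_def, Fin.ext_iff]
  omega

theorem Iic_zero (h : 0 < N) : Finset.Iic (⟨0, h⟩ : Fin N) = {⟨0, h⟩} := by
  ext j
  simp only [Finset.mem_Iic, Finset.mem_singleton, Fin.le_def, Fin.ext_iff]
  omega

theorem rows_zero (m : Fin N → ℕ) (h : 0 < N) : rows m ⟨0, h⟩ = m ⟨0, h⟩ := by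
  rw [rows, Iic_zero, Finset.sum_singleton, zero_add]

theorem rows_succ (m : Fin N → ℕ) {i : ℕ} (h : i + 1 < N) :
    rows m ⟨i + 1, h⟩ = rows m ⟨i, (Nat.lt_succ_self i).trans h⟩ + m ⟨i + 1, h⟩ + 1 := by
  rw [rows, rows, Iic_succ, Finset.sum_insert (by simp)]
  ring

theorem rows_strictMono (m : Fin N → ℕ) : StrictMono (rows m) := fun i j hij =>
  add_lt_add_of_lt_of_le hij (Finset.sum_le_sum_of_subset (Finset.Iic_subset_Iic.2 hij.le))

theorem rows_injective : Function.Injective (rows (N := N)) := fun m m' h => by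
  have h := congr_fun h
  ext ⟨i, hi⟩
  rcases i with _ | i
  · rw [← rows_zero m, h, rows_zero]
  · have h1 := h ⟨i + 1, hi⟩
    rw [rows_succ, rows_succ, h] at h1
    omega

theorem exists_rows_eq {l : Fin N → ℕ} (hl : StrictMono l) : ∃ m, rows m = l := by
  refine ⟨fun i => (l i - i) - if h : (i : ℕ) = 0 then 0 else
    l ⟨i - 1, by omega⟩ - (i - 1), ?_⟩
  ext ⟨i, hi⟩
  induction i with
  | zero => simp [rows_zero]
  | succ i ih =>
    have h1 := strictMono_fin_le hl ⟨i, (Nat.lt_succ_self i).trans hi⟩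
    have h2 := hl (show (⟨i, (Nat.lt_succ_self i).trans hi⟩ : Fin N) < ⟨i + 1, hi⟩ by simp)
    rw [rows_succ, ih]
    simp only [Nat.add_eq_zero_iff, one_ne_zero, and_false, dite_false, Nat.add_sub_cancel] at h1 ⊢
    omega

theorem sum_rows (m : Fin N → ℕ) :
    ∑ i, rows m i = ∑ i : Fin N, (i : ℕ) + ∑ j : Fin N, (N - j) * m j := by
  simp only [rows, Finset.sum_add_distrib]
  congr 1
  rw [Finset.sum_comm' (t' := Finset.univ) (s' := fun j => Finset.Ici j)]
  · refine Finset.sum_congr rfl fun j _ => ?_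
    rw [Finset.sum_const, Fin.card_Ici, smul_eq_mul]
  · simp

/-- The weight of a label. -/
def lw {ι : Type} [Fintype ι] (d : ι → ℕ) (m : ι → Fin N → ℕ) : ℕ :=
  ∑ c, d c * ∑ j : Fin N, (N - j) * m c j

end Rows

section Schur

variable {k : Type} [Field k] [Fintype k] {ι : Type} [Fintype ι] [DecidableEq ι] {N : ℕ}
variable {ψ : AddChar k ℂ} {ρ : ι → Ir k} {e : ι → ℕ → Ir k}

theorem sum_schur_mul_schur_rows (he : ∀ c, DivSeq ψ (ρ c) (e c)) (hρ : Function.Injective ρ)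
    (m m' : ι → Fin N → ℕ) (n : ℕ) :
    ∑ x ∈ lev k n, schur e (fun c => rows (m c)) x * schur e (fun c => rows (m' c)) x =
      if m = m' ∧ n = lw (fun c => (ρ c).deg) m' then 1 else 0 := by
  rw [sum_schur_mul_schur he hρ (fun c => rows_strictMono _) (fun c => rows_strictMono _)]
  simp only [sum_rows, mul_add, Finset.sum_add_distrib]
  congr 1
  refine propext (and_congr ⟨fun h => funext fun c => rows_injective (congr_fun h c), fun h => by
    rw [h]⟩ ?_)
  rw [add_comm, add_right_inj]
  rfl

theorem exists_schur_ne_zero (he : ∀ c, DivSeq ψ (ρ c) (e c)) (hρ : Function.Injective ρ)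
    (m : ι → Fin N → ℕ) : ∃ x : Ir k, x.deg = lw (fun c => (ρ c).deg) m ∧
      schur e (fun c => rows (m c)) x ^ 2 = 1 ∧
      ∀ y, schur e (fun c => rows (m c)) y ≠ 0 → y = x := by
  have h := fun n => sum_schur_mul_schur_rows he hρ m m n
  simp only [← pow_two, true_and] at h
  obtain ⟨x, hx, h1, h2⟩ := exists_unique_of_sum_eq_one (fun _ _ => sq_nonneg _)
    ((h (lw (fun c => (ρ c).deg) m)).trans (if_pos rfl))
  refine ⟨x, mem_lev.1 hx, h1, fun y hy => ?_⟩
  by_cases hd : y.deg = lw (fun c => (ρ c).deg) m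
  · exact h2 y (mem_lev.2 hd) (pow_ne_zero 2 hy)
  · have h3 := h y.deg
    rw [if_neg hd] at h3
    exact absurd ((Finset.sum_eq_zero_iff_of_nonneg fun _ _ => sq_nonneg _).1 h3 y (mem_lev.2 rfl))
      (pow_ne_zero 2 hy)

/-- The irreducible character with a given label. -/
noncomputable def irr (he : ∀ c, DivSeq ψ (ρ c) (e c)) (hρ : Function.Injective ρ)
    (m : ι → Fin N → ℕ) : Ir k := (exists_schur_ne_zero he hρ m).choose

variable (he : ∀ c, DivSeq ψ (ρ c) (e c)) (hρ : Function.Injective ρ) (m : ι → Fin N → ℕ)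

theorem irr_deg : (irr he hρ m).deg = lw (fun c => (ρ c).deg) m :=
  (exists_schur_ne_zero he hρ m).choose_spec.1

theorem schur_irr_sq : schur e (fun c => rows (m c)) (irr he hρ m) ^ 2 = 1 :=
  (exists_schur_ne_zero he hρ m).choose_spec.2.1

theorem eq_irr {y : Ir k} (h : schur e (fun c => rows (m c)) y ≠ 0) : y = irr he hρ m :=
  (exists_schur_ne_zero he hρ m).choose_spec.2.2 y h

theorem schur_irr_ne_zero : schur e (fun c => rows (m c)) (irr he hρ m) ≠ 0 := fun h => by
  have := schur_irr_sq he hρ m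
  rw [h] at this
  norm_num at this

theorem irr_injective : Function.Injective (irr he hρ (N := N)) := fun m m' h => by
  by_contra hne
  have h1 := sum_schur_mul_schur_rows he hρ m m' (irr he hρ m).deg
  rw [if_neg fun h => hne h.1, Finset.sum_eq_single (irr he hρ m)] at h1
  · rcases mul_eq_zero.1 h1 with h2 | h2
    · exact schur_irr_ne_zero he hρ m h2
    · rw [h] at h2
      exact schur_irr_ne_zero he hρ m' h2
  · intro y _ hy
    by_contra h2
    exact hy (eq_irr he hρ m (left_ne_zero_of_mul h2))
  · intro h2
    exact absurd (mem_lev.2 rfl) h2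

theorem sum_mul_schur_rows {A : Type*} [CommRing A] (f : Conv k A) :
    ∑ x ∈ lev k (lw (fun c => (ρ c).deg) m), f x * (schur e (fun c => rows (m c)) x : A) =
      f (irr he hρ m) * (schur e (fun c => rows (m c)) (irr he hρ m) : A) := by
  refine Finset.sum_eq_single _ (fun y _ hy => ?_) fun h => ?_
  · have : schur e (fun c => rows (m c)) y = 0 := by
      by_contra h2
      exact hy (eq_irr he hρ m h2)
    rw [this, Int.cast_zero, mul_zero]
  · exact absurd (mem_lev.2 (irr_deg he hρ m)) h

theorem phi_irr (hψ : ψ ≠ 1) : ∃ s : ℕ, phi (irr he hρ m) = (-1) ^ s *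
    ∏ c, (((Fintype.card k ^ (ρ c).deg : ℕ) : ℂ) ^ (∑ i, (rows (m c) i - i).choose 2) *
        (∏ i, ∏ j ∈ Finset.Ioi i,
          (((Fintype.card k ^ (ρ c).deg : ℕ) : ℂ) ^ (rows (m c) j - rows (m c) i) - 1)) /
        ∏ i, (cop (Fintype.card k ^ (ρ c).deg) (rows (m c) i) : ℂ)) := by
  have hQ : ∀ c, 1 < Fintype.card k ^ (ρ c).deg := fun c =>
    Nat.one_lt_pow (he c).pos.ne' one_lt_card
  choose s hs using fun c => det_phi_strictMono (hQ c) (rows_strictMono (m c))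
  have h := sum_mul_schur isMult_phi he (fun c => rows (m c)) (lw (fun c => (ρ c).deg) m)
  rw [sum_mul_schur_rows he hρ m, if_pos] at h
  · simp only [phiC_apply, fun c => (he c).phi_eq hψ] at h
    rw [Finset.prod_congr rfl fun c _ => hs c, Finset.prod_mul_distrib,
      Finset.prod_pow_eq_pow_sum] at h
    rcases sq_eq_one_iff.1 (schur_irr_sq he hρ m) with h1 | h1
    · rw [h1, Int.cast_one, mul_one] at h
      exact ⟨_, h⟩
    · rw [h1, Int.cast_neg, Int.cast_one, mul_neg_one, neg_eq_iff_eq_neg] at h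
      refine ⟨∑ c, s c + 1, h.trans ?_⟩
      rw [pow_succ]
      ring
  · simp only [sum_rows, mul_add, Finset.sum_add_distrib]
    exact add_comm _ _

theorem exists_eq_irr {x : Ir k} (hx : theta e N x ≠ 0) : ∃ m, x = irr he hρ m (N := N) := by
  have hv : vander ι N ≠ 0 := by
    refine Finset.prod_ne_zero_iff.2 fun c _ =>
      Matrix.det_vandermonde_ne_zero_iff.2 fun i j hij => ?_
    simpa using MvPolynomial.X_injective hij
  obtain ⟨l, hl⟩ := MvPolynomial.ne_zero_iff.1 (mul_ne_zero hv hx)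
  have hl' : l = expo fun c i => l (c, i) := by
    ext
    rfl
  rw [hl', coeff_vander_mul_theta he] at hl
  have hinj : ∀ c, Function.Injective fun i => l (c, i) := by
    intro c i j hij
    by_contra hne
    refine hl ?_
    have : schur e (fun c i => l (c, i)) = 0 := by
      refine Finset.prod_eq_zero (Finset.mem_univ c) (Matrix.det_zero_of_row_eq hne ?_)
      ext1 b
      simp only [jtMatrix, Matrix.of_apply]
      simp only at hij
      rw [hij]
    rw [this, Conv.zero_apply]
  have hmono : ∀ c, StrictMono ((fun i => l (c, i)) ∘ Tuple.sort fun i => l (c, i)) := fun c =>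
    (Tuple.monotone_sort _).strictMono_of_injective ((hinj c).comp (Equiv.injective _))
  choose m hm using fun c => exists_rows_eq (hmono c)
  refine ⟨m, eq_irr he hρ m fun h0 => hl ?_⟩
  have h1 : schur e (fun c => rows (m c)) =
      ((∏ c, ((Equiv.Perm.sign (Tuple.sort fun i => l (c, i)) : ℤˣ) : ℤ) : ℤ) : Conv k ℤ) *
        schur e (fun c i => l (c, i)) := by
    rw [schur, schur, Int.cast_prod, ← Finset.prod_mul_distrib]
    refine Finset.prod_congr rfl fun c _ => ?_
    rw [← Matrix.det_permute, hm]
    rfl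
  rw [h1, Conv.intCast_mul_apply, Int.cast_id] at h0
  refine (mul_eq_zero.1 h0).resolve_left (Finset.prod_ne_zero_iff.2 fun c _ => Units.ne_zero _)

end Schur

end

section

section Complete

variable {k : Type} [Field k] [Fintype k] {ι : Type} [Fintype ι] [DecidableEq ι] {N : ℕ}
variable {ψ : AddChar k ℂ} {ρ : ι → Ir k} {e : ι → ℕ → Ir k}

theorem Conv.one_nonneg (x : Ir k) : 0 ≤ (1 : Conv k ℤ) x := by
  classical
  rw [Conv.one_apply]
  split_ifs <;> simp

theorem Conv.prod_nonneg {κ : Type*} {f : κ → Conv k ℤ} (s : Finset κ)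
    (h : ∀ i ∈ s, ∀ x, 0 ≤ f i x) : ∀ x, 0 ≤ (∏ i ∈ s, f i) x :=
  Finset.prod_induction f (fun g => ∀ x, 0 ≤ g x) (fun _ _ => Conv.mul_nonneg)
    (Conv.one_nonneg (k := k)) h

theorem dE_one_nonneg (e : ℕ → Ir k) (x : Ir k) : 0 ≤ dE e (1 : ℤ) x := by
  by_cases h : ∃ m, x = e m
  · rw [dE, dif_pos h, one_pow]
    exact zero_le_one
  · rw [dE, dif_neg h]

theorem Conv.map_dE {R S : Type*} [CommRing R] [CommRing S] (φ : R →+* S) (e : ℕ → Ir k) (t : R) :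
    Conv.map φ (dE e t) = dE e (φ t) := by
  ext x
  rw [Conv.map_apply, dE, dE]
  split_ifs
  · exact map_pow _ _ _
  · exact map_zero φ

/-- The sum of the products of members of divided power sequences, one for each sequence. -/
noncomputable def gE (e : ι → ℕ → Ir k) : Conv k ℤ := ∏ c, dE (e c) 1

theorem gE_nonneg (e : ι → ℕ → Ir k) (x : Ir k) : 0 ≤ gE e x :=
  Conv.prod_nonneg _ (fun c _ => dE_one_nonneg (e c)) x

theorem gE_pow_nonneg (e : ι → ℕ → Ir k) (n : ℕ) (x : Ir k) : 0 ≤ (gE e ^ n) x := by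
  rw [← Fintype.card_fin n, ← Finset.card_univ, ← Finset.prod_const]
  exact Conv.prod_nonneg _ (fun _ _ => gE_nonneg e) x

theorem map_theta (e : ι → ℕ → Ir k) :
    Conv.map (MvPolynomial.eval fun _ => 1) (theta e N) = gE e ^ N := by
  rw [theta, map_prod, Fintype.prod_prod_type, gE, ← Finset.prod_pow]
  refine Finset.prod_congr rfl fun c _ => ?_
  simp only [Conv.map_dE, MvPolynomial.eval_X, Finset.prod_const, Finset.card_univ,
    Fintype.card_fin]

theorem isMult_gE (he : ∀ c, DivSeq ψ (ρ c) (e c)) : IsMult (gE e) :=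
  IsMult.prod _ fun c _ => (he c).isMult_dE _

theorem gE_apply (he : ∀ c, DivSeq ψ (ρ c) (e c)) (hρ : Function.Injective ρ) (c : ι) (m : ℕ) :
    gE e (e c m) = 1 := by
  rw [← (he c).coeff_ser (gE e), gE, map_prod, Finset.prod_eq_single c]
  · rw [(he c).ser_dE, PowerSeries.coeff_mk, one_pow]
  · intro c' _ hne
    exact (he c).ser_dE_of_ne (he c') (hρ.ne hne.symm) _
  · intro h
    exact absurd (Finset.mem_univ c) h

theorem gE_pow_pos_of_le (he : ∀ c, DivSeq ψ (ρ c) (e c)) {x : Ir k} {m n : ℕ} (hmn : m ≤ n)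
    (h : 0 < (gE e ^ m) x) : 0 < (gE e ^ n) x := by
  induction n, hmn using Nat.le_induction with
  | base => exact h
  | succ n _ ih =>
    rw [pow_succ]
    refine Conv.mul_pos_of (gE_pow_nonneg e n) (gE_nonneg e) ih (b := one k) ?_ ?_
    · rw [(isMult_gE he).one]
      exact one_pos
    · rw [cn_one_right]
      simp

theorem gE_pow_pos (he : ∀ c, DivSeq ψ (ρ c) (e c)) (hρ : Function.Injective ρ) {x : Ir k}
    (hx : ∀ y, IsCusp y → y.deg < x.deg ∨ y = x → y ∈ Set.range ρ) {N : ℕ} (hN : x.deg ≤ N) :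
    0 < (gE e ^ N) x := by

  refine gE_pow_pos_of_le he hN ?_
  clear hN
  induction h : x.deg using Nat.strong_induction_on generalizing x with
  | _ n ih =>
    subst h
    by_cases h1 : x = one k
    · rw [h1, deg_one, pow_zero, IsMult.one'.one]
      exact one_pos
    by_cases h2 : IsCusp x
    · obtain ⟨c, rfl⟩ := hx x h2 (Or.inr rfl)
      refine gE_pow_pos_of_le he h2.pos ?_
      have h3 := gE_apply he hρ c 1
      rw [(he c).one] at h3
      rw [pow_one, h3]
      exact one_pos
    · obtain ⟨a, b, hab, ha, hb⟩ := exists_of_not_isCusp h2 h1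
      have hd := deg_of_cn_ne_zero hab
      have ha' : 0 < a.deg := Nat.pos_of_ne_zero fun h => ha (eq_one_of_deg h)
      have hb' : 0 < b.deg := Nat.pos_of_ne_zero fun h => hb (eq_one_of_deg h)
      rw [← hd, pow_add]
      refine Conv.mul_pos_of (gE_pow_nonneg e _) (gE_pow_nonneg e _) (ih a.deg (by omega) ?_ rfl)
        (ih b.deg (by omega) ?_ rfl) hab
      · intro y hy h3
        refine hx y hy (Or.inl ?_)
        rcases h3 with h3 | rfl <;> omega
      · intro y hy h3
        refine hx y hy (Or.inl ?_)
        rcases h3 with h3 | rfl <;> omega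

theorem theta_ne_zero (he : ∀ c, DivSeq ψ (ρ c) (e c)) (hρ : Function.Injective ρ) {x : Ir k}
    (hx : ∀ y, IsCusp y → y.deg < x.deg ∨ y = x → y ∈ Set.range ρ) (hN : x.deg ≤ N) :
    theta e N x ≠ 0 := fun h => by
  have h1 := gE_pow_pos he hρ hx hN
  rw [← map_theta, Conv.map_apply, h, map_zero] at h1
  exact lt_irrefl _ h1

theorem IsCusp.prod_eq_zero {R κ : Type*} [CommRing R] {x : Ir k} (hx : IsCusp x) (s : Finset κ)
    {f : κ → Conv k R} (h : ∀ i ∈ s, f i x = 0) : (∏ i ∈ s, f i) x = 0 := by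
  classical
  refine Finset.prod_induction f (fun g => g x = 0) (fun f g hf hg => ?_) ?_ h
  · by_contra h0
    obtain ⟨a, b, hab, ha, hb⟩ := Conv.exists_of_mul_ne_zero h0
    rcases hx.eq_one_or a b hab with rfl | rfl
    · rw [cn_one_left] at hab
      have : x = b := by
        by_contra h1
        exact hab (if_neg h1)
      exact hb (this ▸ hg)
    · rw [cn_one_right] at hab
      have : x = a := by
        by_contra h1
        exact hab (if_neg h1)
      exact ha (this ▸ hf)
  · rw [Conv.one_apply, if_neg hx.ne_one]

theorem dE_isCusp (he : ∀ c, DivSeq ψ (ρ c) (e c)) {R : Type*} [CommRing R] {x : Ir k}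
    (hx : IsCusp x) (hxρ : x ∉ Set.range ρ) (c : ι) (t : R) : dE (e c) t x = 0 :=
  dE_eq_zero fun _ hm => hxρ ⟨c, ((he c).eq_one_of_isCusp hx hm).symm⟩

theorem schur_isCusp (he : ∀ c, DivSeq ψ (ρ c) (e c)) {x : Ir k} (hx : IsCusp x)
    (hxρ : x ∉ Set.range ρ) (l : ι → Fin N → ℕ) : schur e l x = 0 := by
  have h : theta e N x = 0 := hx.prod_eq_zero _ fun i _ => dE_isCusp he hx hxρ i.1 _
  rw [← coeff_vander_mul_theta he, h, mul_zero, MvPolynomial.coeff_zero]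

theorem irr_mem_labels (he : ∀ c, DivSeq ψ (ρ c) (e c)) (hρ : Function.Injective ρ) {n : ℕ}
    {m : ι → Fin n → ℕ} (hm : lw (fun c => (ρ c).deg) m = n) :
    (irr he hρ m).deg = n ∧ (IsCusp (irr he hρ m) → irr he hρ m ∈ Set.range ρ) := by
  refine ⟨by rw [irr_deg, hm], fun hc => ?_⟩
  by_contra hn
  exact schur_irr_ne_zero he hρ m (schur_isCusp he hc hn _)

/-- Labels parametrize the irreducible characters in a complete range of degrees. -/
theorem irr_bijective (he : ∀ c, DivSeq ψ (ρ c) (e c)) (hρ : Function.Injective ρ) (n : ℕ)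
    (h : ∀ y, IsCusp y → y.deg < n → y ∈ Set.range ρ) :
    Function.Bijective (fun m => ⟨irr he hρ m.1, irr_mem_labels he hρ m.2⟩ :
      {m : ι → Fin n → ℕ // lw (fun c => (ρ c).deg) m = n} →
        {x : Ir k // x.deg = n ∧ (IsCusp x → x ∈ Set.range ρ)}) := by
  refine ⟨?_, ?_⟩
  · intro m m' hm
    exact Subtype.ext (irr_injective he hρ (congr_arg Subtype.val hm))
  · rintro ⟨x, hx, hc⟩
    obtain ⟨m, hm⟩ := exists_eq_irr he hρ (N := n) (theta_ne_zero he hρ (x := x) (fun y hy h1 => by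
      rcases h1 with h1 | rfl
      · exact h y hy (h1.trans_eq hx)
      · exact hc hy) hx.le)
    refine ⟨⟨m, ?_⟩, Subtype.ext hm.symm⟩
    rw [← irr_deg he hρ, ← hm, hx]

theorem pser_gE (he : ∀ c, DivSeq ψ (ρ c) (e c)) {f : Conv k ℤ} (hf : IsMult f)
    (h : ∀ c m, f (e c m) = 1) :
    pser f (gE e) = ∏ c, PowerSeries.mk fun m => if (ρ c).deg ∣ m then 1 else 0 := by
  refine (map_prod hf.pairing _ _).trans (Finset.prod_congr rfl fun c _ => ?_)
  ext m
  refine ((he c).coeff_pser_dE f 1 m).trans ?_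
  rw [h, one_pow, mul_one, PowerSeries.coeff_mk]

/-- Counting of multiplicities via generating functions. -/
theorem coeff_prod_mk_dvd (d : ι → ℕ) (hd : ∀ c, 0 < d c) (n : ℕ) :
    PowerSeries.coeff n (∏ c, PowerSeries.mk fun m => if d c ∣ m then (1 : ℤ) else 0) =
      Nat.card {m : ι → ℕ // ∑ c, d c * m c = n} := by
  classical
  rw [PowerSeries.coeff_prod]
  simp only [PowerSeries.coeff_mk, Finset.prod_ite_zero, Finset.prod_const_one]
  rw [Finset.sum_ite, Finset.sum_const_zero, add_zero, Finset.sum_const, nsmul_one,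
    ← Nat.card_eq_finsetCard, Nat.cast_inj]
  refine Nat.card_congr (Equiv.ofBijective (fun l => ⟨fun c => l.1 c / d c, ?_⟩) ⟨?_, ?_⟩)
  · have h := l.2
    simp only [Finset.mem_filter, Finset.mem_finsuppAntidiag, Finset.mem_univ, true_imp_iff] at h
    exact Eq.trans (Finset.sum_congr rfl fun c _ => Nat.mul_div_cancel' (h.2 c)) h.1.1
  · intro l l' hll
    have h := l.2
    have h' := l'.2
    simp only [Finset.mem_filter, Finset.mem_finsuppAntidiag, Finset.mem_univ, true_imp_iff] at h h'
    ext c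
    have h1 := congr_fun (congr_arg Subtype.val hll) c
    simp only at h1
    rw [← Nat.mul_div_cancel' (h.2 c), h1, Nat.mul_div_cancel' (h'.2 c)]
  · rintro ⟨m, hm⟩
    refine ⟨⟨Finsupp.equivFunOnFinite.symm fun c => d c * m c, ?_⟩, ?_⟩
    · simp only [Finset.mem_filter, Finset.mem_finsuppAntidiag, Finset.mem_univ, true_imp_iff]
      exact ⟨⟨hm, Finset.subset_univ _⟩, fun c => Dvd.intro _ rfl⟩
    · ext c
      exact Nat.mul_div_cancel_left _ (hd c)

theorem sum_cusp_wh_sq_le (hψ : ψ ≠ 1) (he : ∀ c, DivSeq ψ (ρ c) (e c))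
    (hρ : Function.Injective ρ) (n : ℕ) (hn : ∀ c, (ρ c).deg < n + 1) {s : Finset (Ir k)}
    (hs : ∀ x ∈ s, IsCusp x ∧ x.deg = n + 1) :
    ∑ x ∈ s, wh ψ x ^ 2 + Nat.card {m : ι → ℕ // ∑ c, (ρ c).deg * m c = n + 1} +
      Fintype.card k ^ n ≤ Fintype.card k ^ (n + 1) := by
  have h1 : ∀ {f : Conv k ℤ}, IsMult f → (∀ c m, f (e c m) = 1) →
      ∑ x ∈ lev k (n + 1), f x * gE e x =
        Nat.card {m : ι → ℕ // ∑ c, (ρ c).deg * m c = n + 1} := by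
    intro f hf hf1
    rw [← coeff_pser, pser_gE he hf hf1, coeff_prod_mk_dvd _ fun c => (he c).pos]
  have h2 := h1 (isMult_gE he) (gE_apply he hρ)
  have h3 := h1 (isMult_whZ hψ) fun c m => by rw [whZ_apply, (he c).wh, Nat.cast_one]
  have h4 : ∑ x ∈ s, (wh ψ x : ℤ) ^ 2 ≤ ∑ x ∈ lev k (n + 1), ((wh ψ x : ℤ) - gE e x) ^ 2 := by
    trans ∑ x ∈ s, ((wh ψ x : ℤ) - gE e x) ^ 2
    · refine (Finset.sum_congr rfl fun x hx => ?_).le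
      obtain ⟨hc, hd⟩ := hs x hx
      have : gE e x = 0 := hc.prod_eq_zero _ fun c _ => dE_isCusp he hc (fun ⟨c, hcx⟩ => by
        have := hn c
        rw [hcx, hd] at this
        exact lt_irrefl _ this) c 1
      rw [this, sub_zero]
    · exact Finset.sum_le_sum_of_subset_of_nonneg (fun x hx => mem_lev.2 (hs x hx).2)
        fun _ _ _ => sq_nonneg _
  have h5 : ∑ x ∈ lev k (n + 1), ((wh ψ x : ℤ) - gE e x) ^ 2 =
      ∑ x ∈ lev k (n + 1), (wh ψ x : ℤ) ^ 2 - 2 * ∑ x ∈ lev k (n + 1), whZ ψ x * gE e x +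
        ∑ x ∈ lev k (n + 1), gE e x * gE e x := by
    rw [Finset.mul_sum, ← Finset.sum_sub_distrib, ← Finset.sum_add_distrib]
    refine Finset.sum_congr rfl fun x _ => ?_
    rw [whZ_apply]
    ring
  have h6 := sum_wh_sq hψ n
  rw [h5, h2, h3] at h4
  generalize Nat.card _ = M at *
  zify at h6 ⊢
  linarith

end Complete

end

section

section Labels

variable {T J : Type*} [Fintype T] [Fintype J]

theorem exists_equiv_of_card_fiber_eq {T T' : Type*} [Finite T] [Finite T'] (d : T → ℕ)
    (d' : T' → ℕ) (h : ∀ i, Nat.card {t // d t = i} = Nat.card {t // d' t = i}) :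
    ∃ σ : T ≃ T', ∀ t, d' (σ t) = d t := by
  have σ := fun i => (Finite.card_eq.1 (h i)).some
  exact ⟨(Equiv.sigmaFiberEquiv d).symm.trans ((Equiv.sigmaCongrRight σ).trans
    (Equiv.sigmaFiberEquiv d')), fun t => (σ (d t) ⟨t, rfl⟩).2⟩

theorem le_of_sum_eq {d : T → ℕ} {w : J → ℕ} (hd : ∀ t, 0 < d t) (hw : ∀ j, 0 < w j)
    {m : T → J → ℕ} {n : ℕ} (hm : ∑ t, d t * ∑ j, w j * m t j = n) (t : T) (j : J) :
    m t j ≤ n := by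
  calc m t j ≤ w j * m t j := Nat.le_mul_of_pos_left _ (hw j)
    _ ≤ ∑ j, w j * m t j := Finset.single_le_sum (f := fun j => w j * m t j)
      (fun _ _ => Nat.zero_le _) (Finset.mem_univ j)
    _ ≤ d t * ∑ j, w j * m t j := Nat.le_mul_of_pos_left _ (hd t)
    _ ≤ ∑ t, d t * ∑ j, w j * m t j :=
      Finset.single_le_sum (f := fun t => d t * ∑ j, w j * m t j) (fun _ _ => Nat.zero_le _)
        (Finset.mem_univ t)
    _ = n := hm

theorem finite_labels {d : T → ℕ} {w : J → ℕ} (hd : ∀ t, 0 < d t) (hw : ∀ j, 0 < w j) (n : ℕ) :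
    Finite {m : T → J → ℕ // ∑ t, d t * ∑ j, w j * m t j = n} := by
  refine Finite.of_injective (β := T → J → Fin (n + 1))
    (fun m t j => ⟨m.1 t j, Nat.lt_succ_of_le (le_of_sum_eq hd hw m.2 t j)⟩) fun m m' h => ?_
  ext t j
  exact congr_arg Fin.val (congr_fun (congr_fun h t) j)

/-- Among the labels of size `n`, those supported in degree `n` are concentrated at one place. -/
theorem card_labels_split (d : T → ℕ) (w : J → ℕ) (hw : ∀ j, 0 < w j) {j₀ : J}
    (hj : ∀ j, w j = 1 ↔ j = j₀) {n : ℕ} (hn : 0 < n) (hd0 : ∀ t, 0 < d t) (hd : ∀ t, d t ≤ n) :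
    Nat.card {m : T → J → ℕ // ∑ t, d t * ∑ j, w j * m t j = n} =
      Nat.card {t // d t = n} +
        Nat.card {m : {t // d t < n} → J → ℕ // ∑ t, d t.1 * ∑ j, w j * m t j = n} := by
  classical
  have key : ∀ (m : T → J → ℕ), ∑ t, d t * ∑ j, w j * m t j = n → ∀ t j, d t = n → m t j ≠ 0 →
      m = fun t' j' => if t' = t ∧ j' = j₀ then 1 else 0 := by
    intro m hm t j ht hmt
    have h1 : ∑ a : T × J, d a.1 * (w a.2 * m a.1 a.2) = n := by
      rw [Fintype.sum_prod_type]
      simpa only [Finset.mul_sum] using hm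
    rw [← Finset.add_sum_erase _ _ (Finset.mem_univ (t, j))] at h1
    simp only [ht] at h1
    have h2 : 0 < w j * m t j := Nat.mul_pos (hw j) (Nat.pos_of_ne_zero hmt)
    have h3 : w j * m t j = 1 := by
      refine le_antisymm ?_ h2
      by_contra h
      have : n * 2 ≤ n * (w j * m t j) := Nat.mul_le_mul_left _ (by omega)
      omega
    rw [h3, mul_one, Nat.add_eq_left, Finset.sum_eq_zero_iff] at h1
    obtain ⟨hwj, hmj⟩ := mul_eq_one.1 h3
    obtain rfl := (hj j).1 hwj
    funext t' j'
    split_ifs with h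
    · rw [h.1, h.2, hmj]
    · have := h1 (t', j') (Finset.mem_erase.2 ⟨fun h' => h (Prod.ext_iff.1 h'), Finset.mem_univ _⟩)
      simpa [(hd0 _).ne', (hw _).ne'] using this
  have hext : ∀ m : {t // d t < n} → J → ℕ,
      ∑ t, d t * ∑ j, w j * (if h : d t < n then m ⟨t, h⟩ j else 0) =
        ∑ t : {t // d t < n}, d t.1 * ∑ j, w j * m t j := by
    intro m
    rw [← Finset.sum_filter_of_ne (p := fun t => d t < n)]
    · rw [Finset.sum_subtype (p := fun t => d t < n) _ (by simp)]
      exact Finset.sum_congr rfl fun t _ => by simp [t.2]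
    · intro t _ h
      by_contra h1
      exact h (by simp [h1])
  have h1w := (hj j₀).2 rfl
  have fin1 := finite_labels (d := fun t : {t // d t < n} => d t.1) (fun t => hd0 t.1) hw n
  rw [← Nat.card_sum]
  symm
  refine Nat.card_congr (Equiv.ofBijective (Sum.elim
    (fun t => ⟨fun t' j' => if t' = t.1 ∧ j' = j₀ then 1 else 0, ?_⟩)
    (fun m => ⟨fun t j => if h : d t < n then m.1 ⟨t, h⟩ j else 0, (hext m.1).trans m.2⟩)) ⟨?_, ?_⟩)
  · simp [ite_and, h1w, t.2]
  · rintro (t | m) (t' | m') h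
    · have h1 := congr_fun (congr_fun (congr_arg Subtype.val h) t) j₀
      simp only [Sum.elim_inl, and_true, if_true] at h1
      by_cases h2 : t.1 = t'.1
      · rw [Subtype.ext h2]
      · simp [h2] at h1
    · have h1 := congr_fun (congr_fun (congr_arg Subtype.val h) t) j₀
      simp [t.2] at h1
    · have h1 := congr_fun (congr_fun (congr_arg Subtype.val h) t') j₀
      simp [t'.2] at h1
    · congr 1
      ext t j
      have h1 := congr_fun (congr_fun (congr_arg Subtype.val h) t) j
      simpa [t.2] using h1
  · rintro ⟨m, hm⟩
    by_cases h : ∃ t j, d t = n ∧ m t j ≠ 0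
    · obtain ⟨t, j, ht, hmt⟩ := h
      exact ⟨Sum.inl ⟨t, ht⟩, Subtype.ext (key m hm t j ht hmt).symm⟩
    · push Not at h
      have h2 : (fun t j => if h : d t < n then m t j else 0) = m := by
        funext t j
        split_ifs with h1
        · rfl
        · exact (h t j (le_antisymm (hd t) (not_lt.1 h1))).symm
      refine ⟨Sum.inr ⟨fun t j => m t j, ?_⟩, Subtype.ext h2⟩
      refine (hext _).symm.trans (Eq.trans (Finset.sum_congr rfl fun t _ => ?_) hm)
      congr 1
      exact Finset.sum_congr rfl fun j _ => congr_arg _ (congr_fun (congr_fun h2 t) j)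

end Labels

end

section

section Transport

variable {T T' J : Type*} [Fintype T] [Fintype T'] [Fintype J]

theorem sum_labels_comp (σ : T ≃ T') {d : T → ℕ} {d' : T' → ℕ} (hσ : ∀ t, d' (σ t) = d t)
    (w : J → ℕ) (m : T' → J → ℕ) :
    ∑ t, d t * ∑ j, w j * m (σ t) j = ∑ t, d' t * ∑ j, w j * m t j := by
  rw [← σ.sum_comp]
  exact Finset.sum_congr rfl fun t _ => by rw [hσ]

theorem card_labels_transport (σ : T ≃ T') {d : T → ℕ} {d' : T' → ℕ} (hσ : ∀ t, d' (σ t) = d t)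
    (w : J → ℕ) (n : ℕ) :
    Nat.card {m : T → J → ℕ // ∑ t, d t * ∑ j, w j * m t j = n} =
      Nat.card {m : T' → J → ℕ // ∑ t, d' t * ∑ j, w j * m t j = n} := by
  refine (Nat.card_congr ((σ.symm.arrowCongr (Equiv.refl _)).subtypeEquiv fun m => ?_)).symm
  rw [← sum_labels_comp σ hσ w m]
  rfl

theorem card_labels_unit (d : T → ℕ) (n : ℕ) :
    Nat.card {m : T → ℕ // ∑ t, d t * m t = n} =
      Nat.card {m : T → Unit → ℕ // ∑ t, d t * ∑ j, 1 * m t j = n} :=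
  Nat.card_congr (((Equiv.refl T).arrowCongr (Equiv.funUnique Unit ℕ).symm).subtypeEquiv fun m => by
    simp [Equiv.arrowCongr])

end Transport

section Count

variable {k : Type} [Field k] [Fintype k] {ψ : AddChar k ℂ}

theorem card_lev (n : ℕ) : (lev k n).card = Nat.card (ConjClasses (GL (Fin n) k)) := by
  rw [← card_irrSet, lev, Finset.card_map, Finset.card_univ, Nat.card_eq_fintype_card]

instance (n : ℕ) : Finite {x : Ir k // IsCusp x ∧ x.deg < n} :=
  Finite.of_injective (β := upto k n) (fun x => ⟨x.1, mem_upto.2 x.2.2.le⟩) fun _ _ h =>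
    Subtype.ext (congr_arg (fun z => z.1) h)

noncomputable instance (n : ℕ) : Fintype {x : Ir k // IsCusp x ∧ x.deg < n} := Fintype.ofFinite _

theorem card_nested_fiber {T : Type*} {p q : T → Prop} {d : T → ℕ} {i : ℕ}
    (h : ∀ t, d t = i → p t) (h' : ∀ t, d t = i → q t) :
    Nat.card {t : {t : {t // p t} // q t} // d t.1.1 = i} = Nat.card {t // d t = i} :=
  Nat.card_congr ⟨fun t => ⟨t.1.1.1, t.2⟩, fun t => ⟨⟨⟨t.1, h _ t.2⟩, h' _ t.2⟩, t.2⟩,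
    fun _ => rfl, fun _ => rfl⟩

/-- Cuspidal characters are counted by any degree-labelled type that has the right numbers of
labels, and they have multiplicity one in the Gelfand–Graev character. -/
theorem cusp_count (hψ : ψ ≠ 1) {T : Type} (d : T → ℕ) (hd : ∀ t, 0 < d t)
    [∀ n, Fintype {t // d t ≤ n}]
    (h1 : ∀ n, 0 < n → Nat.card (ConjClasses (GL (Fin n) k)) =
      Nat.card {m : {t // d t ≤ n} → Fin n → ℕ //
        ∑ t, d t.1 * ∑ j : Fin n, (n - j) * m t j = n})
    (h2 : ∀ n, Fintype.card k ^ (n + 1) ≤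
      Nat.card {m : {t // d t ≤ n + 1} → ℕ // ∑ t, d t.1 * m t = n + 1} + Fintype.card k ^ n)
    (n : ℕ) : (∀ x : Ir k, IsCusp x → x.deg = n → wh ψ x = 1) ∧
      Nat.card {x : Ir k // IsCusp x ∧ x.deg = n} = Nat.card {t // d t = n} := by
  classical
  induction n using Nat.strong_induction_on with
  | _ n ih =>
  rcases n with _ | n
  · have i1 : IsEmpty {x : Ir k // IsCusp x ∧ x.deg = 0} := ⟨fun x => x.2.1.pos.ne' x.2.2⟩
    have i2 : IsEmpty {t // d t = 0} := ⟨fun t => (hd t.1).ne' t.2⟩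
    exact ⟨fun x hx h => absurd h hx.pos.ne', by simp⟩
  set C := {x : Ir k // IsCusp x ∧ x.deg < n + 1} with hC
  have hdiv : ∀ c : C, ∃ e, DivSeq ψ c.1 e := fun c =>
    c.2.1.exists_divSeq hψ ((ih _ c.2.2).1 _ c.2.1 rfl)
  choose e he using hdiv
  have hinj : Function.Injective (Subtype.val : C → Ir k) := Subtype.val_injective
  obtain ⟨σ, hσ⟩ := exists_equiv_of_card_fiber_eq
    (T := {t : {t // d t ≤ n + 1} // d t.1 < n + 1}) (T' := C) (fun t => d t.1.1)
    (fun c => c.1.deg) (fun i => by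
      by_cases hi : i < n + 1
      · rw [card_nested_fiber (fun t h => h.trans_le hi.le) (fun t h => h.trans_lt hi),
          ← (ih i hi).2]
        exact Nat.card_congr ⟨fun x => ⟨⟨x.1, x.2.1, x.2.2.trans_lt hi⟩, x.2.2⟩,
          fun x => ⟨x.1.1, x.1.2.1, x.2⟩, fun _ => rfl, fun _ => rfl⟩
      · have i1 : IsEmpty {t : {t : {t // d t ≤ n + 1} // d t.1 < n + 1} // d t.1.1 = i} :=
          ⟨fun t => hi (t.2 ▸ t.1.2)⟩
        have i2 : IsEmpty {c : C // c.1.deg = i} := ⟨fun t => hi (t.2 ▸ t.1.2.2)⟩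
        simp)
  have hNn : Nat.card {t : {t // d t ≤ n + 1} // d t.1 = n + 1} = Nat.card {t // d t = n + 1} :=
    Nat.card_congr ⟨fun t => ⟨t.1.1, t.2⟩, fun t => ⟨⟨t.1, t.2.le⟩, t.2⟩, fun _ => rfl,
      fun _ => rfl⟩
  have hcard : ((lev k (n + 1)).filter IsCusp).card = Nat.card {t // d t = n + 1} := by
    have e1 := h1 (n + 1) n.succ_pos
    rw [card_labels_split (fun t : {t // d t ≤ n + 1} => d t.1)
      (fun j : Fin (n + 1) => n + 1 - j) (fun j => by omega) (j₀ := Fin.last n) (fun j => by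
        rw [Fin.ext_iff, Fin.val_last]; omega) (n := n + 1) n.succ_pos (fun t => hd t.1)
        (fun t => t.2), hNn,
      card_labels_transport σ (d' := fun c : C => c.1.deg) hσ, ← card_lev] at e1
    have e2 := Nat.card_congr (Equiv.ofBijective _ (irr_bijective he hinj (n + 1)
      fun y hy hyn => ⟨⟨y, hy, hyn⟩, rfl⟩))
    have e3 : Nat.card {x : Ir k // x.deg = n + 1 ∧
        (IsCusp x → x ∈ Set.range (Subtype.val : C → Ir k))} =
        ((lev k (n + 1)).filter fun x => ¬ IsCusp x).card := by
      rw [← Nat.card_eq_finsetCard]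
      refine Nat.card_congr (Equiv.subtypeEquivRight fun x => ?_)
      rw [Finset.mem_filter, mem_lev]
      refine and_congr_right fun hx => ⟨fun h hc => ?_, fun h hc => absurd hc h⟩
      obtain ⟨c, rfl⟩ := h hc
      exact c.2.2.ne hx
    have e4 := Finset.card_filter_add_card_filter_not (s := lev k (n + 1)) IsCusp
    rw [← e3, ← e2] at e4
    have e5 := e4.trans e1
    exact Nat.add_right_cancel e5
  have hcard' : Nat.card {x : Ir k // IsCusp x ∧ x.deg = n + 1} = Nat.card {t // d t = n + 1} := by
    rw [← hcard, ← Nat.card_eq_finsetCard]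
    refine Nat.card_congr (Equiv.subtypeEquivRight fun x => ?_)
    rw [Finset.mem_filter, mem_lev, and_comm]
  refine ⟨?_, hcard'⟩
  have f1 := sum_cusp_wh_sq_le hψ he hinj n (fun c => c.2.2)
    (s := (lev k (n + 1)).filter IsCusp) fun x hx =>
      ⟨(Finset.mem_filter.1 hx).2, mem_lev.1 (Finset.mem_filter.1 hx).1⟩
  have f2 := h2 n
  rw [card_labels_unit, card_labels_split (fun t : {t // d t ≤ n + 1} => d t.1) (fun _ : Unit => 1)
    (fun _ => one_pos) (j₀ := ()) (fun j => by simp) (n := n + 1) n.succ_pos (fun t => hd t.1)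
      (fun t => t.2),
    hNn, ← hcard, card_labels_transport σ (d' := fun c : C => c.1.deg) hσ, ← card_labels_unit] at f2
  have f3 : ∑ x ∈ (lev k (n + 1)).filter IsCusp, wh ψ x ^ 2 ≤
      ∑ x ∈ (lev k (n + 1)).filter IsCusp, 1 := by
    rw [← Finset.card_eq_sum_ones]
    omega
  have f4 : ∀ x ∈ (lev k (n + 1)).filter IsCusp, 1 ≤ wh ψ x ^ 2 := fun x hx =>
    Nat.pow_pos ((Finset.mem_filter.1 hx).2.wh_pos hψ)
  intro x hx hxn
  have f5 := (Finset.sum_eq_sum_iff_of_le f4).1 (le_antisymm (Finset.sum_le_sum f4) f3) x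
    (Finset.mem_filter.2 ⟨mem_lev.2 hxn, hx⟩)
  exact (Nat.pow_eq_one.1 f5.symm).resolve_right two_ne_zero

end Count

end

section

section RowArithmetic

variable {N : ℕ}

theorem rows_sub (m : Fin N → ℕ) (i : Fin N) : rows m i - i = ∑ j ∈ Finset.Iic i, m j := by
  rw [rows, Nat.add_sub_cancel_left]

theorem le_rows_sub (m : Fin N → ℕ) {i j : Fin N} (h : i < j) :
    m j ≤ rows m j - rows m i - 1 := by
  have h1 : m j + ∑ t ∈ Finset.Iic i, m t ≤ ∑ t ∈ Finset.Iic j, m t := by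
    rw [← Finset.sum_insert (f := m) (by simpa using h)]
    refine Finset.sum_le_sum_of_subset fun t ht => ?_
    rcases Finset.mem_insert.1 ht with rfl | ht
    · simp
    · exact Finset.mem_Iic.2 ((Finset.mem_Iic.1 ht).trans h.le)
  have h2 : (i : ℕ) < j := h
  rw [rows, rows]
  omega

theorem prod_row_dvd (q : ℕ) (m : Fin N → ℕ) (j : Fin N) :
    (∏ i ∈ Finset.Iio j, (q ^ (rows m j - rows m i) - 1)) * cop q (m j) ∣ cop q (rows m j) := by
  classical
  have hlt : ∀ i ∈ Finset.Iio j, rows m i < rows m j := fun i hi =>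
    rows_strictMono m (Finset.mem_Iio.1 hi)
  have h1 : ∏ i ∈ Finset.Iio j, (q ^ (rows m j - rows m i) - 1) =
      ∏ r ∈ (Finset.Iio j).image fun i => rows m j - rows m i - 1, (q ^ (r + 1) - 1) := by
    rw [Finset.prod_image]
    · refine Finset.prod_congr rfl fun i hi => ?_
      rw [Nat.sub_add_cancel (Nat.sub_pos_of_lt (hlt i hi))]
    · intro i hi i' hi' h
      have h1 := hlt i hi
      have h2 := hlt i' hi'
      exact (rows_strictMono m).injective (by simp only at h; omega)
  rw [h1, cop, cop, ← Finset.prod_union]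
  · refine Finset.prod_dvd_prod_of_subset _ _ _ fun r hr => ?_
    rw [Finset.mem_range]
    rcases Finset.mem_union.1 hr with hr | hr
    · obtain ⟨i, hi, rfl⟩ := Finset.mem_image.1 hr
      have := hlt i hi
      omega
    · refine (Finset.mem_range.1 hr).trans_le ?_
      rw [rows]
      exact (Finset.single_le_sum (f := m) (fun _ _ => Nat.zero_le _)
        (Finset.mem_Iic.2 le_rfl)).trans (Nat.le_add_left _ _)
  · rw [Finset.disjoint_left]
    intro r hr hr'
    obtain ⟨i, hi, rfl⟩ := Finset.mem_image.1 hr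
    exact (Finset.mem_range.1 hr').not_ge (le_rows_sub m (Finset.mem_Iio.1 hi))

theorem prod_rows_dvd (q : ℕ) (m : Fin N → ℕ) :
    (∏ i, ∏ j ∈ Finset.Ioi i, (q ^ (rows m j - rows m i) - 1)) * ∏ j, cop q (m j) ∣
      ∏ j, cop q (rows m j) := by
  rw [Finset.prod_comm' (t' := Finset.univ) (s' := Finset.Iio) (by simp),
    ← Finset.prod_mul_distrib]
  exact Finset.prod_dvd_prod_of_dvd _ _ fun j _ => prod_row_dvd q m j

/-- The exponent of `q` in the degree of the character with label `m`. -/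
def expQ {ι : Type} [Fintype ι] (d : ι → ℕ) (m : ι → Fin N → ℕ) : ℕ :=
  ∑ c, d c * ∑ i, (rows (m c) i - i).choose 2

variable {ι : Type} [Fintype ι] {d : ι → ℕ} {m : ι → Fin N → ℕ}

theorem sum_rows_sub (m : Fin N → ℕ) :
    ∑ i, (rows m i - i) = ∑ j : Fin N, (N - j) * m j := by
  simp only [rows_sub]
  rw [Finset.sum_comm' (t' := Finset.univ) (s' := Finset.Ici) (by simp)]
  exact Finset.sum_congr rfl fun j _ => by rw [Finset.sum_const, Fin.card_Ici, smul_eq_mul]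

theorem expQ_le (hd : ∀ c, 0 < d c) {n : ℕ} (h : lw d m = n) : expQ d m ≤ n.choose 2 := by
  have h1 : ∑ c, d c * ∑ i, (rows (m c) i - i) = n := by
    simp only [sum_rows_sub]
    exact h
  have h2 : ∀ c i, rows (m c) i - i ≤ n := fun c i => by
    calc rows (m c) i - i ≤ ∑ i : Fin N, (rows (m c) i - i) :=
          Finset.single_le_sum (f := fun i : Fin N => rows (m c) i - i) (fun _ _ => Nat.zero_le _)
            (Finset.mem_univ i)
      _ ≤ d c * ∑ i : Fin N, (rows (m c) i - i) := Nat.le_mul_of_pos_left _ (hd c)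
      _ ≤ n := (Finset.single_le_sum (f := fun c => d c * ∑ i : Fin N, (rows (m c) i - i))
          (fun _ _ => Nat.zero_le _) (Finset.mem_univ c)).trans_eq h1
  have h3 : ∀ c i, 2 * (rows (m c) i - i).choose 2 ≤ (rows (m c) i - i) * (n - 1) := fun c i => by
    rw [Nat.choose_two_right, mul_comm, Nat.div_two_mul_two_of_even (Nat.even_mul_pred_self _)]
    exact Nat.mul_le_mul_left _ (Nat.sub_le_sub_right (h2 c i) 1)
  have h4 : 2 * expQ d m ≤ n * (n - 1) := by
    rw [expQ, ← h1, Finset.mul_sum, h1, ← h1, Finset.sum_mul, h1]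
    refine Finset.sum_le_sum fun c _ => ?_
    rw [mul_left_comm, mul_assoc, Finset.mul_sum, Finset.sum_mul]
    exact Nat.mul_le_mul_left _ (Finset.sum_le_sum fun i _ => h3 c i)
  rw [Nat.choose_two_right, Nat.le_div_iff_mul_le two_pos, mul_comm]
  exact h4

/-- Labels of regular semisimple classes: at most one part, equal to one, in each place. -/
def IsReg (m : ι → Fin N → ℕ) : Prop := ∀ c j, m c j ≤ 1 ∧ ((j : ℕ) + 1 ≠ N → m c j = 0)

theorem expQ_eq_zero (hm : IsReg m) : expQ d m = 0 := by
  refine Finset.sum_eq_zero fun c _ => ?_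
  rw [Finset.sum_eq_zero, mul_zero]
  intro i _
  refine Nat.choose_eq_zero_of_lt ?_
  rw [rows_sub]
  have h0 : ∀ j ∈ Finset.Iic i, j ≠ i → m c j = 0 := fun j hj hji => (hm c j).2 (by
    have : j < i := lt_of_le_of_ne (Finset.mem_Iic.1 hj) hji
    have := i.2
    omega)
  rw [Finset.sum_eq_single i h0 (by simp)]
  exact Nat.lt_succ_of_le (hm c i).1

end RowArithmetic

section Degree

variable {k : Type} [Field k] [Fintype k] {ι : Type} [Fintype ι] [DecidableEq ι] {N : ℕ}
variable {ψ : AddChar k ℂ} {ρ : ι → Ir k} {e : ι → ℕ → Ir k}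

theorem coprime_pow_sub_one {p q : ℕ} (hq : p ∣ q) (hq1 : 0 < q) {r : ℕ} (hr : r ≠ 0) :
    Nat.Coprime p (q ^ r - 1) := by
  have h1 : p ∣ q ^ r := dvd_pow hq hr
  have h2 : 1 ≤ q ^ r := Nat.one_le_pow _ _ hq1
  rw [Nat.coprime_comm]
  have h3 : (q ^ r - 1).Coprime (q ^ r) := by
    rw [Nat.coprime_comm]
    exact (Nat.coprime_self_sub_right h2).2 (Nat.coprime_one_right _)
  exact Nat.Coprime.coprime_dvd_right h1 h3

theorem coprime_cop {p q : ℕ} (hq : p ∣ q) (hq1 : 0 < q) (n : ℕ) : Nat.Coprime p (cop q n) :=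
  Nat.Coprime.prod_right fun _ _ => coprime_pow_sub_one hq hq1 (Nat.succ_ne_zero _)

/-- The degree formula, in the natural numbers. -/
theorem degree_irr_mul (he : ∀ c, DivSeq ψ (ρ c) (e c)) (hρ : Function.Injective ρ)
    (m : ι → Fin N → ℕ) (hψ : ψ ≠ 1) {n : ℕ} {χ : irrSet (GL (Fin n) k)}
    (hχ : irr he hρ m = ⟨n, χ⟩) :
    degree χ * ∏ c, ∏ i, cop (Fintype.card k ^ (ρ c).deg) (rows (m c) i) =
      Fintype.card k ^ expQ (fun c => (ρ c).deg) m *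
        (∏ c, ∏ i, ∏ j ∈ Finset.Ioi i,
          ((Fintype.card k ^ (ρ c).deg) ^ (rows (m c) j - rows (m c) i) - 1)) *
        cop (Fintype.card k) n := by
  obtain ⟨s, hs⟩ := phi_irr he hρ m hψ
  have hQ : ∀ c, 1 < Fintype.card k ^ (ρ c).deg := fun c =>
    Nat.one_lt_pow (he c).pos.ne' one_lt_card
  have hφ : phi (⟨n, χ⟩ : Ir k) = degree χ / cop (Fintype.card k) n :=
    congr_arg (· / (cop (Fintype.card k) n : ℂ)) (irr_one_eq χ)
  have hA : (∏ c, ∏ i, (cop (Fintype.card k ^ (ρ c).deg) (rows (m c) i) : ℂ)) ≠ 0 :=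
    Finset.prod_ne_zero_iff.2 fun c _ => Finset.prod_ne_zero_iff.2 fun i _ => by
      exact_mod_cast (cop_pos (hQ c) _).ne'
  rw [hχ, hφ, Finset.prod_div_distrib, Finset.prod_mul_distrib, mul_div_assoc', div_eq_div_iff
    (cop_ne_zero n) hA] at hs
  have hE : (∏ c, ((Fintype.card k ^ (ρ c).deg : ℕ) : ℂ) ^ (∑ i, (rows (m c) i - i).choose 2)) =
      (Fintype.card k : ℂ) ^ expQ (fun c => (ρ c).deg) m := by
    rw [expQ, ← Finset.prod_pow_eq_pow_sum]
    exact Finset.prod_congr rfl fun c _ => by rw [pow_mul, Nat.cast_pow]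
  have hB : (∏ c, ∏ i, ∏ j ∈ Finset.Ioi i,
      (((Fintype.card k ^ (ρ c).deg : ℕ) : ℂ) ^ (rows (m c) j - rows (m c) i) - 1)) =
      ((∏ c, ∏ i, ∏ j ∈ Finset.Ioi i,
          ((Fintype.card k ^ (ρ c).deg) ^ (rows (m c) j - rows (m c) i) - 1) : ℕ) : ℂ) := by
    push_cast
    refine Finset.prod_congr rfl fun c _ => Finset.prod_congr rfl fun i _ =>
      Finset.prod_congr rfl fun j _ => ?_
    rw [Nat.cast_sub (Nat.one_le_pow _ _ (hQ c).le)]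
    push_cast
    rfl
  rw [hE, hB] at hs
  have hpos : 0 < degree χ * ∏ c, ∏ i, cop (Fintype.card k ^ (ρ c).deg) (rows (m c) i) :=
    Nat.mul_pos (degree_pos χ) (Finset.prod_pos fun c _ => Finset.prod_pos fun i _ =>
      cop_pos (hQ c) _)
  generalize (∏ c, ∏ i, ∏ j ∈ Finset.Ioi i,
    ((Fintype.card k ^ (ρ c).deg) ^ (rows (m c) j - rows (m c) i) - 1) : ℕ) = B at hs ⊢
  rcases neg_one_pow_eq_or ℂ s with h1 | h1
  · rw [h1, one_mul] at hs
    exact_mod_cast hs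
  · exfalso
    rw [h1, neg_one_mul, neg_mul, eq_neg_iff_add_eq_zero] at hs
    have h2 : degree χ * ∏ c, ∏ i, cop (Fintype.card k ^ (ρ c).deg) (rows (m c) i) +
        Fintype.card k ^ expQ (fun c => (ρ c).deg) m * B * cop (Fintype.card k) n = 0 := by
      exact_mod_cast hs
    omega

/-- The part of the degree prime to the characteristic. -/
theorem degree_mul_dvd (he : ∀ c, DivSeq ψ (ρ c) (e c)) (hρ : Function.Injective ρ)
    (m : ι → Fin N → ℕ) (hψ : ψ ≠ 1) {n : ℕ} {χ : irrSet (GL (Fin n) k)}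
    (hχ : irr he hρ m = ⟨n, χ⟩) :
    degree χ * ∏ c, ∏ i, cop (Fintype.card k ^ (ρ c).deg) (m c i) ∣
      Fintype.card k ^ expQ (fun c => (ρ c).deg) m * cop (Fintype.card k) n := by
  have hQ : ∀ c, 1 < Fintype.card k ^ (ρ c).deg := fun c =>
    Nat.one_lt_pow (he c).pos.ne' one_lt_card
  have h1 := Finset.prod_dvd_prod_of_dvd _ _ fun c (_ : c ∈ Finset.univ) =>
    prod_rows_dvd (Fintype.card k ^ (ρ c).deg) (m c)
  rw [Finset.prod_mul_distrib] at h1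
  have h2 := Nat.mul_dvd_mul_left (degree χ) h1
  rw [degree_irr_mul he hρ m hψ hχ, mul_left_comm, mul_assoc (_ ^ _),
    mul_left_comm (_ ^ _)] at h2
  refine Nat.dvd_of_mul_dvd_mul_left (Finset.prod_pos fun c _ => Finset.prod_pos fun i _ =>
    Finset.prod_pos fun j hj => ?_) h2
  refine Nat.sub_pos_of_lt (Nat.one_lt_pow ?_ (hQ c))
  exact Nat.sub_ne_zero_of_lt (rows_strictMono _ (Finset.mem_Ioi.1 hj))

/-- The power of `q` in the degree. -/
theorem degree_dvd (he : ∀ c, DivSeq ψ (ρ c) (e c)) (hρ : Function.Injective ρ)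
    (m : ι → Fin N → ℕ) (hψ : ψ ≠ 1) {n : ℕ} {χ : irrSet (GL (Fin n) k)}
    (hχ : irr he hρ m = ⟨n, χ⟩) :
    degree χ ∣ Fintype.card k ^ expQ (fun c => (ρ c).deg) m * cop (Fintype.card k) n :=
  (Dvd.intro _ rfl).trans (degree_mul_dvd he hρ m hψ hχ)

end Degree

end

section

section Layers

variable {R : Type} [CommRing R] {M M₁ : Type} [AddCommGroup M] [Module R M] [AddCommGroup M₁]
  [Module R M₁]

/-- The `f`-torsion vectors that are divisible by `f ^ j`. -/
def lay (M : Type) [AddCommGroup M] [Module R M] (f : R) (j : ℕ) : Submodule R M :=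
  LinearMap.ker (LinearMap.lsmul R M f) ⊓ LinearMap.range (LinearMap.lsmul R M (f ^ j))

theorem mem_lay {f : R} {j : ℕ} {x : M} : x ∈ lay M f j ↔ f • x = 0 ∧ ∃ y, f ^ j • y = x :=
  Iff.rfl

theorem mem_lay_zero {f : R} {x : M} : x ∈ lay M f 0 ↔ f • x = 0 := by
  simp [mem_lay]

theorem lay_anti (f : R) (j : ℕ) : lay M f (j + 1) ≤ lay M f j := fun x hx => by
  obtain ⟨h, y, hy⟩ := mem_lay.1 hx
  exact mem_lay.2 ⟨h, f • y, by rw [← hy, pow_succ, mul_smul]⟩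

theorem map_mem_lay (T : M →ₗ[R] M₁) {f : R} {j : ℕ} {x : M} (hx : x ∈ lay M f j) :
    T x ∈ lay M₁ f j := by
  obtain ⟨h, y, hy⟩ := mem_lay.1 hx
  exact mem_lay.2 ⟨by rw [← map_smul, h, map_zero], T y, by rw [← map_smul, hy]⟩

theorem card_lay_congr (e : M ≃ₗ[R] M₁) (f : R) (j : ℕ) :
    Nat.card (lay M f j) = Nat.card (lay M₁ f j) :=
  Nat.card_congr (e.toEquiv.subtypeEquiv fun x => ⟨map_mem_lay e.toLinearMap, fun h => by
    simpa using map_mem_lay e.symm.toLinearMap h⟩)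

theorem card_lay_pi {I : Type} [Fintype I] {N : I → Type} [∀ i, AddCommGroup (N i)]
    [∀ i, Module R (N i)] (f : R) (j : ℕ) :
    Nat.card (lay (∀ i, N i) f j) = ∏ i, Nat.card (lay (N i) f j) := by
  rw [← Nat.card_pi]
  have h : ∀ x : ∀ i, N i, x ∈ lay (∀ i, N i) f j ↔ ∀ i, x i ∈ lay (N i) f j := by
    intro x
    simp only [mem_lay, forall_and, funext_iff, Pi.smul_apply, Pi.zero_apply]
    refine and_congr_right fun _ => ⟨fun ⟨y, hy⟩ i => ⟨y i, hy i⟩, fun h => ?_⟩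
    choose y hy using h
    exact ⟨y, hy⟩
  exact Nat.card_congr ⟨fun x i => ⟨x.1 i, (h x.1).1 x.2 i⟩, fun x => ⟨fun i => x i, (h _).2
    fun i => (x i).2⟩, fun _ => rfl, fun _ => rfl⟩

/-- The graded pieces. -/
abbrev Gr (M : Type) [AddCommGroup M] [Module R M] (f : R) (j : ℕ) : Type :=
  lay M f j ⧸ (lay M f (j + 1)).submoduleOf (lay M f j)

/-- Endomorphisms act on the graded pieces. -/
def grEnd (M : Type) [AddCommGroup M] [Module R M] (f : R) (j : ℕ) :
    Module.End R M →* Module.End R (Gr M f j) where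
  toFun T := Submodule.mapQ _ _ (T.restrict fun _ hx => map_mem_lay T hx) fun _ hx =>
    map_mem_lay T hx
  map_one' := by
    ext x
    rfl
  map_mul' S T := by
    ext x
    rfl

theorem sub_mem_of_grEnd_eq_one {f : R} {j : ℕ} {T : Module.End R M} (h : grEnd M f j T = 1)
    {x : M} (hx : x ∈ lay M f j) : T x - x ∈ lay M f (j + 1) := by
  have h1 := LinearMap.congr_fun h (Submodule.Quotient.mk ⟨x, hx⟩)
  exact (Submodule.Quotient.eq ((lay M f (j + 1)).submoduleOf (lay M f j))).1 h1

theorem smul_gr (f : R) (j : ℕ) (x : Gr M f j) : f • x = 0 := by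
  obtain ⟨⟨x, hx⟩, rfl⟩ := Submodule.Quotient.mk_surjective _ x
  rw [← Submodule.Quotient.mk_smul]
  have : f • (⟨x, hx⟩ : lay M f j) = 0 := Subtype.ext (mem_lay.1 hx).1
  rw [this, Submodule.Quotient.mk_zero]

theorem card_gr_mul [Finite M] (f : R) (j : ℕ) :
    Nat.card (Gr M f j) * Nat.card (lay M f (j + 1)) = Nat.card (lay M f j) := by
  rw [Submodule.card_eq_card_quotient_mul_card ((lay M f (j + 1)).submoduleOf (lay M f j)),
    mul_comm]
  congr 1
  exact Nat.card_congr (Submodule.submoduleOfEquivOfLe (lay_anti f j)).symm.toEquiv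

theorem pow_apply_mem_lay {f : R} {t : Module.End R M}
    (h : ∀ j, ∀ x ∈ lay M f j, t x ∈ lay M f (j + 1)) (j : ℕ) {x : M} (hx : f • x = 0) :
    (t ^ j) x ∈ lay M f j := by
  induction j with
  | zero => exact mem_lay_zero.2 hx
  | succ j ih =>
    rw [pow_succ', Module.End.mul_apply]
    exact h j _ ih

theorem pow_apply_eq_zero {t : Module.End R M} {l : List R}
    (h : ∀ f ∈ l, ∀ x : M, f • x = 0 → t x = 0) {x : M} (hx : l.prod • x = 0) :
    (t ^ l.length) x = 0 := by
  induction l generalizing x with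
  | nil => simpa using hx
  | cons f l ih =>
    rw [List.length_cons, pow_succ, Module.End.mul_apply]
    refine ih (fun g hg => h g (List.mem_cons_of_mem _ hg)) ?_
    rw [← map_smul]
    refine h f List.mem_cons_self _ ?_
    rwa [← mul_smul, ← List.prod_cons]

/-- An automorphism acting trivially on all graded pieces has `p`-power order. -/
theorem pow_char_eq_one {p : ℕ} [Fact p.Prime] [CharP (Module.End R M) p] {l : List R} {n : ℕ}
    (hl : ∀ x : M, l.prod • x = 0) (hn : ∀ f ∈ l, lay M f n = ⊥) {u : Module.End R M}
    (hu : ∀ f ∈ l, ∀ j < n, grEnd M f j u = 1) : ∃ a, u ^ p ^ a = 1 := by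
  have h1 : ((u - 1) ^ n) ^ l.length = 0 := by
    ext x
    refine pow_apply_eq_zero (fun f hf x hx => ?_) (hl x)
    rw [← Submodule.mem_bot R, ← hn f hf]
    refine pow_apply_mem_lay (fun j x hx => ?_) n hx
    rcases lt_or_ge j n with h | h
    · exact sub_mem_of_grEnd_eq_one (hu f hf j h) hx
    · have h2 := antitone_nat_of_succ_le (lay_anti (M := M) f) h hx
      rw [hn f hf, Submodule.mem_bot] at h2
      rw [h2, map_zero]
      exact zero_mem _
  rw [← pow_mul] at h1
  refine ⟨n * l.length, ?_⟩
  have h2 : (u - 1) ^ p ^ (n * l.length) = 0 :=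
    pow_eq_zero_of_le (Nat.lt_pow_self (Fact.out : p.Prime).one_lt).le h1
  have h3 := add_pow_char_pow_of_commute (p := p) (n := n * l.length)
    (Commute.one_right (u - 1))
  rwa [h2, one_pow, zero_add, sub_add_cancel] at h3

theorem eq_one_of_semisimple {I : Type} [Fintype I] [DecidableEq I] {N : I → Type}
    [∀ i, AddCommGroup (N i)] [∀ i, Module R (N i)] {f : I → R} (hf : ∀ i (x : N i), f i • x = 0)
    (h1 : ∀ i, lay (∀ i, N i) (f i) 1 = ⊥) {u : Module.End R (∀ i, N i)}
    (hu : ∀ i, grEnd (∀ i, N i) (f i) 0 u = 1) : u = 1 := by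
  refine LinearMap.pi_ext fun i x => ?_
  have h2 : Pi.single i x ∈ lay (∀ i, N i) (f i) 0 := by
    rw [mem_lay_zero, ← Pi.single_smul, hf, Pi.single_zero]
  have h3 := sub_mem_of_grEnd_eq_one (hu i) h2
  rw [zero_add, h1, Submodule.mem_bot, sub_eq_zero] at h3
  exact h3

end Layers

end

section

open Polynomial

section Cyclic

variable {k : Type} [Field k] [Fintype k]

/-- The cyclic module of a polynomial. -/
abbrev Cyc (g : k[X]) : Type := k[X] ⧸ Ideal.span {g}

omit [Fintype k] in
theorem smul_cyc (g : k[X]) (x : Cyc g) : g • x = 0 := by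
  obtain ⟨x, rfl⟩ := Submodule.Quotient.mk_surjective _ x
  rw [← Submodule.Quotient.mk_smul, Submodule.Quotient.mk_eq_zero]
  exact Ideal.mul_mem_right _ _ (Ideal.mem_span_singleton_self g)

theorem finite_cyc {g : k[X]} (hg : g ≠ 0) : Finite (Cyc g) := by
  have : Module.Finite k (Cyc g) := (AdjoinRoot.powerBasis hg).finite
  exact Module.finite_of_finite k

theorem card_cyc {g : k[X]} (hg : g ≠ 0) : Nat.card (Cyc g) = Fintype.card k ^ g.natDegree := by
  have : Module.Finite k (Cyc g) := (AdjoinRoot.powerBasis hg).finite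
  rw [Module.natCard_eq_pow_finrank (K := k), finrank_quotient_span_eq_natDegree,
    Nat.card_eq_fintype_card]

omit [Fintype k] in
theorem lay_cyc_of_isCoprime {f g : k[X]} (h : IsCoprime f g) (j : ℕ) : lay (Cyc g) f j = ⊥ := by
  rw [eq_bot_iff]
  intro x hx
  obtain ⟨a, b, hab⟩ := h
  rw [Submodule.mem_bot, ← one_smul k[X] x, ← hab, add_smul, mul_smul, mul_smul, (mem_lay.1 hx).1,
    smul_cyc, smul_zero, smul_zero, add_zero]

omit [Fintype k] in
theorem lay_cyc_of_le (f : k[X]) {e j : ℕ} (h : e ≤ j) : lay (Cyc (f ^ e)) f j = ⊥ := by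
  rw [eq_bot_iff]
  intro x hx
  obtain ⟨-, y, rfl⟩ := mem_lay.1 hx
  rw [Submodule.mem_bot, ← Nat.sub_add_cancel h, pow_add, mul_smul, smul_cyc, smul_zero]

theorem card_lay_cyc {f : k[X]} (hf : f ≠ 0) {e j : ℕ} (h : j < e) :
    Nat.card (lay (Cyc (f ^ e)) f j) = Fintype.card k ^ f.natDegree := by
  rw [← card_cyc hf]
  obtain ⟨e, rfl⟩ := Nat.exists_eq_add_one_of_ne_zero (Nat.ne_zero_of_lt h)
  let φ : k[X] →ₗ[k[X]] Cyc (f ^ (e + 1)) :=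
    (Submodule.mkQ _).comp (LinearMap.lsmul k[X] k[X] (f ^ e))
  have hφ : ∀ x, φ x = Submodule.Quotient.mk (f ^ e * x) := fun x => rfl
  have hker : LinearMap.ker φ = Ideal.span {f} := by
    ext x
    rw [LinearMap.mem_ker, hφ, Submodule.Quotient.mk_eq_zero, Ideal.mem_span_singleton,
      Ideal.mem_span_singleton, pow_succ]
    exact mul_dvd_mul_iff_left (pow_ne_zero _ hf)
  have hrange : LinearMap.range φ = lay (Cyc (f ^ (e + 1))) f j := by
    ext x
    rw [LinearMap.mem_range, mem_lay]
    constructor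
    · rintro ⟨y, rfl⟩
      refine ⟨?_, Submodule.Quotient.mk (f ^ (e - j) * y), ?_⟩
      · rw [hφ, ← Submodule.Quotient.mk_smul, Submodule.Quotient.mk_eq_zero,
          Ideal.mem_span_singleton, smul_eq_mul, ← mul_assoc, ← pow_succ']
        exact dvd_mul_right _ _
      · rw [hφ, ← Submodule.Quotient.mk_smul, smul_eq_mul, ← mul_assoc, ← pow_add,
          Nat.add_sub_cancel' (Nat.le_of_lt_succ h)]
    · rintro ⟨h1, -⟩
      obtain ⟨y, rfl⟩ := Submodule.Quotient.mk_surjective _ x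
      rw [← Submodule.Quotient.mk_smul, Submodule.Quotient.mk_eq_zero, Ideal.mem_span_singleton,
        smul_eq_mul, pow_succ'] at h1
      obtain ⟨z, rfl⟩ := (mul_dvd_mul_iff_left hf).1 h1
      exact ⟨z, rfl⟩
  rw [← hrange]
  exact Nat.card_congr ((Submodule.quotEquivOfEq _ _ hker.symm).trans
    φ.quotKerEquivRange).symm.toEquiv

end Cyclic

section LabelModule

variable {k : Type} [Field k] {ι : Type} [Fintype ι] {N : ℕ}

/-- The torsion module attached to a label: `m c j` copies of `k[X] / π c ^ (N - j)`. -/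
abbrev Md (π : ι → k[X]) (m : ι → Fin N → ℕ) : Type :=
  ∀ i : Σ c, Σ j, Fin (m c j), Cyc (π i.1 ^ (N - i.2.1 : ℕ))

variable [Fintype k] {π : ι → k[X]}

theorem card_Md (hπ : ∀ c, (π c).Monic) (m : ι → Fin N → ℕ) :
    Nat.card (Md π m) = Fintype.card k ^ lw (fun c => (π c).natDegree) m := by
  rw [Nat.card_pi, Fintype.prod_sigma, lw, ← Finset.prod_pow_eq_pow_sum]
  refine Finset.prod_congr rfl fun c _ => ?_
  rw [Fintype.prod_sigma, Finset.mul_sum, ← Finset.prod_pow_eq_pow_sum]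
  refine Finset.prod_congr rfl fun j _ => ?_
  have h1 := fun i : Fin (m c j) => card_cyc ((hπ c).pow (N - j : ℕ)).ne_zero
  refine (Finset.prod_congr rfl fun i _ => h1 i).trans ?_
  rw [Finset.prod_const, Finset.card_univ, Fintype.card_fin, (hπ c).natDegree_pow, ← pow_mul]
  congr 1
  ring

theorem finite_Md (hπ : ∀ c, (π c).Monic) (m : ι → Fin N → ℕ) : Finite (Md π m) := by
  have := fun i : Σ c, Σ j, Fin (m c j) => finite_cyc ((hπ i.1).pow (N - i.2.1 : ℕ)).ne_zero
  infer_instance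

omit [Fintype k] [Fintype ι] in
theorem isCoprime_of_ne (hπ : ∀ c, (π c).Monic) (hi : ∀ c, Irreducible (π c))
    (hinj : Function.Injective π) {c c' : ι} (h : c ≠ c') : IsCoprime (π c) (π c') := by
  refine (EuclideanDomain.dvd_or_coprime _ _ (hi c)).resolve_left fun hd => h (hinj ?_)
  exact eq_of_monic_of_associated (hπ c) (hπ c') ((hi c).associated_of_dvd (hi c') hd)

theorem card_lay_Md (hπ : ∀ c, (π c).Monic) (hi : ∀ c, Irreducible (π c))
    (hinj : Function.Injective π) (m : ι → Fin N → ℕ) (c : ι) (t : ℕ) :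
    Nat.card (lay (Md π m) (π c) t) = (Fintype.card k ^ (π c).natDegree) ^
      ∑ j ∈ Finset.univ.filter (fun j : Fin N => t + (j : ℕ) < N), m c j := by
  rw [card_lay_pi, Fintype.prod_sigma, Finset.prod_eq_single c]
  · rw [Fintype.prod_sigma, Finset.sum_filter, ← Finset.prod_pow_eq_pow_sum]
    refine Finset.prod_congr rfl fun j _ => ?_
    split_ifs with h
    · refine (Finset.prod_congr rfl fun i _ => card_lay_cyc (hπ c).ne_zero
        (Nat.lt_sub_of_add_lt h)).trans ?_
      rw [Finset.prod_const, Finset.card_univ, Fintype.card_fin]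
    · rw [pow_zero]
      refine Finset.prod_eq_one fun i _ => ?_
      rw [lay_cyc_of_le (π c) (e := N - (j : ℕ)) (by omega)]
      exact Nat.card_unique
  · intro c' _ hc
    refine Finset.prod_eq_one fun i _ => ?_
    rw [lay_cyc_of_isCoprime (isCoprime_of_ne hπ hi hinj hc.symm).pow_right]
    exact Nat.card_unique
  · exact fun h => absurd (Finset.mem_univ c) h

theorem card_lay_Md_rev (hπ : ∀ c, (π c).Monic) (hi : ∀ c, Irreducible (π c))
    (hinj : Function.Injective π) (m : ι → Fin N → ℕ) (c : ι) (j : Fin N) :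
    Nat.card (lay (Md π m) (π c) j.rev) =
      (Fintype.card k ^ (π c).natDegree) ^ m c j * Nat.card (lay (Md π m) (π c) (j.rev + 1)) := by
  classical
  rw [card_lay_Md hπ hi hinj, card_lay_Md hπ hi hinj, ← pow_add]
  congr 1
  have h1 : (Finset.univ.filter fun t : Fin N => (j.rev : ℕ) + t < N) =
      insert j (Finset.univ.filter fun t : Fin N => (j.rev : ℕ) + 1 + t < N) := by
    ext t
    simp only [Finset.mem_filter, Finset.mem_univ, true_and, Finset.mem_insert, Fin.val_rev,
      Fin.ext_iff]
    omega
  rw [h1, Finset.sum_insert]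
  simp only [Finset.mem_filter, Finset.mem_univ, true_and, Fin.val_rev]
  omega

theorem card_gr_Md (hπ : ∀ c, (π c).Monic) (hi : ∀ c, Irreducible (π c))
    (hinj : Function.Injective π) (m : ι → Fin N → ℕ) (c : ι) (j : Fin N) :
    Nat.card (Gr (Md π m) (π c) j.rev) = (Fintype.card k ^ (π c).natDegree) ^ m c j := by
  have := finite_Md hπ m
  have h := card_gr_mul (M := Md π m) (π c) j.rev
  rw [card_lay_Md_rev hπ hi hinj] at h
  exact Nat.eq_of_mul_eq_mul_right Nat.card_pos h

/-- A label is determined by its module. -/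
theorem eq_of_linearEquiv (hπ : ∀ c, (π c).Monic) (hi : ∀ c, Irreducible (π c))
    (hinj : Function.Injective π) {m m' : ι → Fin N → ℕ} (e : Md π m ≃ₗ[k[X]] Md π m') :
    m = m' := by
  funext c j
  have := finite_Md hπ m'
  have h := card_lay_Md_rev hπ hi hinj m c j
  rw [card_lay_congr e, card_lay_congr e, card_lay_Md_rev hπ hi hinj m'] at h
  have h1 := Nat.eq_of_mul_eq_mul_right Nat.card_pos h
  exact (Nat.pow_right_injective (Nat.one_lt_pow (hi c).natDegree_pos.ne' one_lt_card) h1).symm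

end LabelModule

end

section

open Polynomial

theorem card_dvd_of_ker {G H : Type} [Group G] [Group H] (Φ : G →* H) :
    Nat.card G ∣ Nat.card H * Nat.card Φ.ker := by
  rw [Subgroup.card_eq_card_quotient_mul_card_subgroup Φ.ker,
    Nat.card_congr (QuotientGroup.quotientKerEquivRange Φ).toEquiv]
  exact mul_dvd_mul_right (Subgroup.card_subgroup_dvd_card _) _

section Units

variable {k : Type} [Field k] [Fintype k]

/-- The automorphism group of a module killed by an irreducible polynomial. -/
theorem card_units_of_smul_eq_zero {M : Type} [AddCommGroup M] [Module k[X] M] [Finite M]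
    {f : k[X]} (hf : Irreducible f) (h : ∀ x : M, f • x = 0) {a : ℕ}
    (hc : Nat.card M = (Fintype.card k ^ f.natDegree) ^ a) :
    Nat.card (Module.End k[X] M)ˣ = (Fintype.card k ^ f.natDegree) ^ (a.choose 2) *
      cop (Fintype.card k ^ f.natDegree) a := by
  have hmax : (Ideal.span {f}).IsMaximal := PrincipalIdealRing.isMaximal_of_irreducible hf
  let : Field (Cyc f) := Ideal.Quotient.field _
  have htor : Module.IsTorsionBySet k[X] M (Ideal.span {f} : Ideal k[X]) :=
    (Module.isTorsionBySet_span_singleton_iff f).2 h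
  let : Module (Cyc f) M := htor.module
  have : IsScalarTower k[X] (Cyc f) M := htor.isScalarTower
  have hs : Function.Surjective (algebraMap k[X] (Cyc f)) := Ideal.Quotient.mk_surjective
  have hfin : Finite (Cyc f) := finite_cyc hf.ne_zero
  let : Fintype (Cyc f) := Fintype.ofFinite _
  have hcard : Fintype.card (Cyc f) = Fintype.card k ^ f.natDegree := by
    rw [← Nat.card_eq_fintype_card, card_cyc hf.ne_zero]
  have : Module.Finite (Cyc f) M := Module.Finite.of_finite
  have h1 : Module.finrank (Cyc f) M = a := by
    rw [Module.natCard_eq_pow_finrank (K := Cyc f), Nat.card_eq_fintype_card, hcard] at hc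
    refine Nat.pow_right_injective ?_ hc
    exact Nat.one_lt_pow hf.natDegree_pos.ne' one_lt_card
  let e : Module.End k[X] M ≃* Module.End (Cyc f) M :=
    { toFun := fun T => LinearMap.extendScalarsOfSurjective hs T
      invFun := fun T => LinearMap.restrictScalars k[X] T
      left_inv := fun T => rfl
      right_inv := fun T => rfl
      map_mul' := fun S T => rfl }
  rw [Nat.card_congr (Units.mapEquiv e).toEquiv, card_units_End (k := Cyc f), h1, hcard]

end Units

section Centralizer

variable {k : Type} [Field k] [Fintype k] {ι : Type} [Fintype ι] {N : ℕ} {π : ι → k[X]}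

/-- The action of automorphisms on all graded pieces. -/
noncomputable def grHom (π : ι → k[X]) (m : ι → Fin N → ℕ) :
    (Module.End k[X] (Md π m))ˣ →*
      ∀ c, ∀ j : Fin N, (Module.End k[X] (Gr (Md π m) (π c) j.rev))ˣ :=
  MonoidHom.pi fun c => MonoidHom.pi fun j => Units.map (grEnd (Md π m) (π c) j.rev)

theorem card_grHom_codomain (hπ : ∀ c, (π c).Monic) (hi : ∀ c, Irreducible (π c))
    (hinj : Function.Injective π) (m : ι → Fin N → ℕ) :
    Nat.card (∀ c, ∀ j : Fin N, (Module.End k[X] (Gr (Md π m) (π c) j.rev))ˣ) =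
      ∏ c, ∏ j, ((Fintype.card k ^ (π c).natDegree) ^ (m c j).choose 2 *
        cop (Fintype.card k ^ (π c).natDegree) (m c j)) := by
  have := finite_Md hπ m
  have hGr : ∀ c t, Finite (Gr (Md π m) (π c) t) := fun c t => Quotient.finite _
  rw [Nat.card_pi]
  refine Finset.prod_congr rfl fun c _ => ?_
  rw [Nat.card_pi]
  refine Finset.prod_congr rfl fun j _ => ?_
  exact card_units_of_smul_eq_zero (hi c) (smul_gr _ _) (card_gr_Md hπ hi hinj m c j)

omit [Fintype k] in
theorem grEnd_of_mem_ker {m : ι → Fin N → ℕ} {u : (Module.End k[X] (Md π m))ˣ}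
    (hu : u ∈ (grHom π m).ker) (c : ι) {j : ℕ} (hj : j < N) :
    grEnd (Md π m) (π c) j u = 1 := by
  have h1 := congr_fun (congr_fun (MonoidHom.mem_ker.1 hu) c) (Fin.rev ⟨j, hj⟩)
  have h2 := congrArg Units.val h1
  have h3 : grEnd (Md π m) (π c) ((Fin.rev (Fin.rev ⟨j, hj⟩) : Fin N) : ℕ) u = 1 := h2
  rwa [Fin.rev_rev] at h3

omit [Fintype k] in
theorem prod_smul_Md (m : ι → Fin N → ℕ) (x : Md π m) :
    (((Finset.univ : Finset (Σ c, Σ j, Fin (m c j))).toList).flatMap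
      fun i => List.replicate (N - i.2.1 : ℕ) (π i.1)).prod • x = 0 := by
  funext i
  have h : π i.1 ^ (N - i.2.1 : ℕ) ∣
      (((Finset.univ : Finset (Σ c, Σ j, Fin (m c j))).toList).flatMap
      fun i => List.replicate (N - i.2.1 : ℕ) (π i.1)).prod := by
    rw [List.flatMap, List.prod_flatten, List.map_map, Finset.prod_map_toList]
    refine dvd_trans (dvd_of_eq ?_) (Finset.dvd_prod_of_mem _ (Finset.mem_univ i))
    rw [Function.comp_apply, List.prod_replicate]
  obtain ⟨g, hg⟩ := h
  rw [Pi.smul_apply, hg, mul_comm, mul_smul, smul_cyc, smul_zero, Pi.zero_apply]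

theorem lay_Md_eq_bot (hπ : ∀ c, (π c).Monic) (hi : ∀ c, Irreducible (π c))
    (hinj : Function.Injective π) (m : ι → Fin N → ℕ) (c : ι) {t : ℕ}
    (ht : ∀ j : Fin N, t + j < N → m c j = 0) : lay (Md π m) (π c) t = ⊥ := by
  have := finite_Md hπ m
  have h := card_lay_Md hπ hi hinj m c t
  rw [Finset.sum_eq_zero fun j hj => ht j (Finset.mem_filter.1 hj).2, pow_zero] at h
  exact (Submodule.eq_bot_iff _).2 fun x hx => congrArg Subtype.val
    ((Nat.card_eq_one_iff_unique.1 h).1.elim ⟨x, hx⟩ 0)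

/-- The order of the automorphism group of the module of a label. -/
theorem card_units_Md_dvd (p : ℕ) [Fact p.Prime] [CharP k p] (hπ : ∀ c, (π c).Monic)
    (hi : ∀ c, Irreducible (π c)) (hinj : Function.Injective π) (m : ι → Fin N → ℕ) :
    ∃ a, Nat.card (Module.End k[X] (Md π m))ˣ ∣
      p ^ a * ∏ c, ∏ j, cop (Fintype.card k ^ (π c).natDegree) (m c j) := by
  have hfin := finite_Md hπ m
  have hE : Finite (Module.End k[X] (Md π m)) :=
      Finite.of_injective (fun T => (T : Md π m → Md π m))
    DFunLike.coe_injective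
  have h1 : IsPGroup p (grHom π m).ker := by
    rcases subsingleton_or_nontrivial (Md π m) with hs | hs
    · have : Subsingleton (Module.End k[X] (Md π m)) := inferInstance
      exact fun g => ⟨0, Subtype.ext (Units.ext (Subsingleton.elim _ _))⟩
    · have hinj' : Function.Injective (((Algebra.lsmul k[X] k[X] (Md π m)).toRingHom).comp
        (C : k →+* k[X])) := RingHom.injective _
      have : CharP (Module.End k[X] (Md π m)) p := charP_of_injective_ringHom hinj' p
      intro g
      have h2 : ∃ a, (g.1.1 : Module.End k[X] (Md π m)) ^ p ^ a = 1 := by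
        refine pow_char_eq_one (n := N) (prod_smul_Md (π := π) m) (fun f hf => ?_)
          (fun f hf j hj => ?_)
        all_goals obtain ⟨i, -, hi'⟩ := List.mem_flatMap.1 hf
        all_goals rw [List.eq_of_mem_replicate hi']
        · exact lay_Md_eq_bot hπ hi hinj m _ fun j hj => by omega
        · exact grEnd_of_mem_ker g.2 _ hj
      obtain ⟨a, ha⟩ := h2
      exact ⟨a, Subtype.ext (Units.ext ha)⟩
  obtain ⟨a, ha⟩ := IsPGroup.iff_card.1 h1
  obtain ⟨s, -, hs⟩ := FiniteField.card k p
  have h2 := card_dvd_of_ker (grHom π m)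
  rw [card_grHom_codomain hπ hi hinj, ha] at h2
  refine ⟨a + ∑ c, ∑ j, s * (π c).natDegree * ((m c j).choose 2), h2.trans (dvd_of_eq ?_)⟩
  simp only [Finset.prod_mul_distrib, pow_add, ← Finset.prod_pow_eq_pow_sum]
  have h3 : ∀ c j, (Fintype.card k ^ (π c).natDegree) ^ ((m c j).choose 2) =
      p ^ (s * (π c).natDegree * ((m c j).choose 2)) := by
    intro c j
    rw [hs, ← pow_mul, ← pow_mul, mul_assoc]
  simp only [h3]
  ring

theorem coprime_card_units_Md {p : ℕ} (hp : p ∣ Fintype.card k) (hπ : ∀ c, (π c).Monic)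
    (hi : ∀ c, Irreducible (π c)) (hinj : Function.Injective π) {m : ι → Fin N → ℕ}
    (hm : IsReg m) : Nat.Coprime p (Nat.card (Module.End k[X] (Md π m))ˣ) := by
  have hlay : ∀ c, lay (Md π m) (π c) 1 = ⊥ := fun c =>
    lay_Md_eq_bot hπ hi hinj m c fun j hj => (hm c j).2 (by omega)
  have hN : ∀ i : Σ c, Σ j, Fin (m c j), (N - i.2.1 : ℕ) = 1 := by
    rintro ⟨c, j, i⟩
    have h1 : (j : ℕ) + 1 = N := by
      by_contra h
      have h2 := (hm c j).2 h
      exact Nat.not_lt_zero (i : ℕ) (h2 ▸ i.2)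
    show N - (j : ℕ) = 1
    omega
  have hker : Nat.card (grHom π m).ker = 1 := by
    rw [Nat.card_eq_one_iff_unique]
    refine ⟨⟨fun a b => ?_⟩, ⟨1⟩⟩
    have key : ∀ u : (grHom π m).ker, u = 1 := by
      classical
      intro u
      refine Subtype.ext (Units.ext ?_)
      refine eq_one_of_semisimple (f := fun i : Σ c, Σ j, Fin (m c j) => π i.1) (fun i x => ?_)
        (fun i => hlay i.1) fun i => grEnd_of_mem_ker u.2 _ (Nat.zero_lt_of_lt i.2.1.2)
      have h := smul_cyc (π i.1 ^ (N - i.2.1 : ℕ)) x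
      have h1 : π i.1 ^ (N - i.2.1 : ℕ) = π i.1 := by rw [hN i, pow_one]
      exact (congrArg (fun g : k[X] => g • x) h1.symm).trans h
    rw [key a, key b]
  have h2 := card_dvd_of_ker (grHom π m)
  rw [card_grHom_codomain hπ hi hinj, hker, mul_one] at h2
  refine Nat.Coprime.coprime_dvd_right h2 (Nat.Coprime.prod_right fun c _ =>
    Nat.Coprime.prod_right fun j _ => ?_)
  rw [Nat.choose_eq_zero_of_lt (Nat.lt_succ_of_le (hm c j).1), pow_zero, one_mul]
  exact coprime_cop (hp.trans (dvd_pow_self _ (hi c).natDegree_pos.ne'))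
    (pow_pos Fintype.card_pos _) _

end Centralizer

end

section

open Polynomial

section Rep

variable {k : Type} [Field k] {n : ℕ}

/-- Invertible matrices as linear automorphisms. -/
noncomputable def glLin (k : Type) [Field k] (n : ℕ) :
    GL (Fin n) k ≃* ((Fin n → k) ≃ₗ[k] (Fin n → k)) :=
  Matrix.GeneralLinearGroup.toLin.trans (LinearMap.GeneralLinearGroup.generalLinearEquiv k _)

variable {M : Type} [AddCommGroup M] [Module k M] [Module k[X] M] [IsScalarTower k k[X] M]
  {M₁ : Type} [AddCommGroup M₁] [Module k M₁] [Module k[X] M₁] [IsScalarTower k k[X] M₁]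

/-- The matrix `g` represents the multiplication by `X` on `M`. -/
def IsRep (φ : M ≃ₗ[k] (Fin n → k)) (g : GL (Fin n) k) : Prop :=
  ∀ x, φ ((X : k[X]) • x) = glLin k n g (φ x)

theorem map_polynomial_smul (T : M →ₗ[k] M₁) (hT : ∀ x, T ((X : k[X]) • x) = (X : k[X]) • T x)
    (f : k[X]) (x : M) : T (f • x) = f • T x := by
  induction f using Polynomial.induction_on generalizing x with
  | C a =>
    rw [← mul_one (C a), ← smul_eq_C_mul, smul_assoc, smul_assoc, map_smul, one_smul, one_smul]
  | add p q hp hq => rw [add_smul, map_add, hp, hq, add_smul]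
  | monomial n a h =>
    rw [pow_succ, ← mul_assoc, mul_smul, h, hT, ← mul_smul]

variable {φ : M ≃ₗ[k] (Fin n → k)} {g : GL (Fin n) k} {φ' : M₁ ≃ₗ[k] (Fin n → k)}
  {g' : GL (Fin n) k}

/-- Intertwiners are the isomorphisms of the associated modules. -/
noncomputable def intertwinerEquiv (h : IsRep φ g) (h' : IsRep φ' g') :
    {x : GL (Fin n) k // x * g = g' * x} ≃ (M ≃ₗ[k[X]] M₁) where
  toFun x :=
    { φ.trans ((glLin k n x.1).trans φ'.symm) with
      map_smul' := map_polynomial_smul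
        (φ.trans ((glLin k n x.1).trans φ'.symm) : M →ₗ[k] M₁) fun y => by
        have h1 := LinearEquiv.congr_fun (congrArg (glLin k n) x.2) (φ y)
        rw [map_mul, map_mul] at h1
        have h2 : glLin k n x.1 (glLin k n g (φ y)) = glLin k n g' (glLin k n x.1 (φ y)) := h1
        apply φ'.injective
        simp only [LinearEquiv.coe_coe, LinearEquiv.trans_apply, LinearEquiv.apply_symm_apply]
        rw [h y, h', LinearEquiv.apply_symm_apply, h2] }
  invFun e := ⟨(glLin k n).symm (φ.symm.trans ((e.restrictScalars k).trans φ')), by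
    apply (glLin k n).injective
    rw [map_mul, map_mul, MulEquiv.apply_symm_apply]
    ext1 v
    obtain ⟨y, rfl⟩ := φ.surjective v
    simp only [LinearEquiv.mul_apply, LinearEquiv.trans_apply, LinearEquiv.symm_apply_apply,
      LinearEquiv.restrictScalars_apply]
    rw [← h y, LinearEquiv.symm_apply_apply, ← h', map_smul]⟩
  left_inv x := by
    apply Subtype.ext
    apply (glLin k n).injective
    ext1 v
    simp
  right_inv e := by
    ext v
    simp

theorem isConj_iff_nonempty_linearEquiv (h : IsRep φ g) (h' : IsRep φ' g') :
    IsConj g g' ↔ Nonempty (M ≃ₗ[k[X]] M₁) := by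
  rw [isConj_iff, ← (intertwinerEquiv h h').nonempty_congr, nonempty_subtype]
  simp only [mul_inv_eq_iff_eq_mul]

theorem card_class_mul [Fintype k] (h : IsRep φ g) :
    (ConjClasses.mk g).carrier.ncard * Nat.card (Module.End k[X] M)ˣ = Nat.card (GL (Fin n) k) := by
  have h1 : Nat.card (Module.End k[X] M)ˣ = Nat.card (Subgroup.centralizer {g}) := by
    rw [Nat.card_congr (LinearMap.GeneralLinearGroup.generalLinearEquiv k[X] M).toEquiv,
      ← Nat.card_congr (intertwinerEquiv h h)]
    exact Nat.card_congr (Equiv.subtypeEquivRight fun x =>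
        Subgroup.mem_centralizer_singleton_iff.symm)
  have h2 := MulAction.index_stabilizer (ConjAct (GL (Fin n) k)) g
  rw [ConjAct.orbit_eq_carrier_conjClasses] at h2
  rw [h1, ← h2, ConjAct.stabilizer_eq_centralizer]
  exact Subgroup.index_mul_card _

theorem exists_isRep [Module.Finite k M] (hn : Module.finrank k M = n)
    (hX : ∀ x : M, (X : k[X]) • x = 0 → x = 0) :
    ∃ (φ : M ≃ₗ[k] (Fin n → k)) (g : GL (Fin n) k), IsRep φ g := by
  have φ : M ≃ₗ[k] (Fin n → k) := LinearEquiv.ofFinrankEq _ _ (by rw [hn, Module.finrank_fin_fun])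
  let T : M →ₗ[k] M := (Algebra.lsmul k k M (X : k[X]))
  have hT : Function.Injective T := (injective_iff_map_eq_zero _).2 hX
  let e : M ≃ₗ[k] M := LinearEquiv.ofInjectiveEndo T hT
  refine ⟨φ, (glLin k n).symm (φ.symm.trans (e.trans φ)), fun x => ?_⟩
  rw [MulEquiv.apply_symm_apply, LinearEquiv.trans_apply, LinearEquiv.symm_apply_apply]
  rfl

theorem isRep_aeval (g : GL (Fin n) k) :
    IsRep (Module.AEval'.of (glLin k n g : (Fin n → k) →ₗ[k] (Fin n → k))).symm g := by
  intro x
  obtain ⟨y, rfl⟩ := (Module.AEval'.of (glLin k n g : (Fin n → k) →ₗ[k] (Fin n → k))).surjective x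
  rw [Module.AEval'.X_smul_of, LinearEquiv.symm_apply_apply, LinearEquiv.symm_apply_apply]
  rfl

end Rep

end

section

open Polynomial

section Drop

/-- Trivial factors of a product of modules may be dropped. -/
theorem nonempty_equiv_pi_subtype {R : Type} [Ring R] {I : Type} (N : I → Type)
    [∀ i, AddCommGroup (N i)] [∀ i, Module R (N i)] (P : I → Prop)
    (h : ∀ i, ¬ P i → Subsingleton (N i)) :
    Nonempty ((∀ i, N i) ≃ₗ[R] ∀ i : {i // P i}, N i) := by
  classical
  refine ⟨LinearEquiv.ofBijective (LinearMap.pi fun i : {i // P i} => LinearMap.proj i.1)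
    ⟨fun f g hfg => funext fun i => ?_, fun f => ⟨fun i => if hi : P i then f ⟨i, hi⟩ else 0, ?_⟩⟩⟩
  · by_cases hi : P i
    · exact congr_fun hfg ⟨i, hi⟩
    · exact (h i hi).elim _ _
  · funext i
    simp [i.2]

/-- A finite set over `ι × κ` is a disjoint union of standard finite sets. -/
theorem exists_equiv_sigma_fin {I ι κ : Type} [Finite I] (t : I → ι) (s : I → κ) :
    ∃ (m : ι → κ → ℕ) (E : (Σ c, Σ j, Fin (m c j)) ≃ I),
      ∀ i, t (E i) = i.1 ∧ s (E i) = i.2.1 := by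
  let m : ι → κ → ℕ := fun c j => Nat.card {i // t i = c ∧ s i = j}
  let e : ∀ c j, Fin (m c j) ≃ {i // t i = c ∧ s i = j} := fun c j => (Finite.equivFin _).symm
  let F : (Σ c, Σ j, Fin (m c j)) → I := fun i => (e i.1 i.2.1 i.2.2).1
  have hF : ∀ i, t (F i) = i.1 ∧ s (F i) = i.2.1 := fun i => (e i.1 i.2.1 i.2.2).2
  have hb : Function.Bijective F := by
    constructor
    · rintro ⟨c, j, i⟩ ⟨c', j', i'⟩ h
      have h1 := hF ⟨c, j, i⟩
      have h2 := hF ⟨c', j', i'⟩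
      rw [h] at h1
      obtain rfl : c = c' := h1.1.symm.trans h2.1
      obtain rfl : j = j' := h1.2.symm.trans h2.2
      obtain rfl : i = i' := (e c j).injective (Subtype.ext h)
      rfl
    · intro i
      refine ⟨⟨t i, s i, (e _ _).symm ⟨i, rfl, rfl⟩⟩, ?_⟩
      simp [F]
  exact ⟨m, Equiv.ofBijective F hb, hF⟩

end Drop

section Classification

variable {k : Type} [Field k] [Fintype k] {ι : Type} [Fintype ι] {n : ℕ} {π : ι → k[X]}

omit [Fintype k] in
theorem X_smul_cyc {g : k[X]} (h : IsCoprime X g) {x : Cyc g} (hx : (X : k[X]) • x = 0) :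
    x = 0 := by
  obtain ⟨a, b, hab⟩ := h
  rw [← one_smul k[X] x, ← hab, add_smul, mul_smul, mul_smul, hx, smul_cyc, smul_zero, smul_zero,
    add_zero]

omit [Fintype k] [Fintype ι] in
theorem X_smul_Md (hπ : ∀ c, (π c).Monic) (hi : ∀ c, Irreducible (π c)) (hX : ∀ c, π c ≠ X)
    {m : ι → Fin n → ℕ} {x : Md π m} (hx : (X : k[X]) • x = 0) : x = 0 := by
  funext i
  refine X_smul_cyc (IsCoprime.pow_right ?_) (congr_fun hx i)
  refine (EuclideanDomain.dvd_or_coprime _ _ irreducible_X).resolve_left fun hd => hX i.1 ?_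
  exact (eq_of_monic_of_associated monic_X (hπ i.1)
    (irreducible_X.associated_of_dvd (hi i.1) hd)).symm

theorem finrank_Md (hπ : ∀ c, (π c).Monic) (m : ι → Fin n → ℕ) :
    Module.finrank k (Md π m) = lw (fun c => (π c).natDegree) m := by
  have := finite_Md hπ m
  have h := card_Md hπ m
  rw [Module.natCard_eq_pow_finrank (K := k), Nat.card_eq_fintype_card] at h
  exact Nat.pow_right_injective one_lt_card h

/-- The elementary divisors of a matrix. -/
theorem exists_equiv_Md {M : Type} [AddCommGroup M] [Module k[X] M] [Module.Finite k[X] M]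
    (htor : Module.IsTorsion k[X] M) (hcard : Nat.card M = Fintype.card k ^ n)
    (hX : ∀ x : M, (X : k[X]) • x = 0 → x = 0)
    (hall : ∀ f : k[X], f.Monic → Irreducible f → f ≠ X → f.natDegree ≤ n → f ∈ Set.range π) :
    ∃ m : ι → Fin n → ℕ, Nonempty (M ≃ₗ[k[X]] Md π m) := by
  classical
  obtain ⟨I, _, p, hp, e, ⟨E⟩⟩ := Module.equiv_directSum_of_isTorsion htor
  have E1 : M ≃ₗ[k[X]] ∀ i, Cyc (p i ^ e i) := E.trans (DirectSum.linearEquivFunOnFintype _ _ _)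
  have hfin : ∀ i, Finite (Cyc (p i ^ e i)) := fun i => finite_cyc (pow_ne_zero _ (hp i).ne_zero)
  have hdeg : ∀ i, e i * (p i).natDegree ≤ n := by
    intro i
    have h1 : Nat.card (Cyc (p i ^ e i)) ∣ Nat.card M := by
      rw [Nat.card_congr E1.toEquiv, Nat.card_pi]
      exact Finset.dvd_prod_of_mem _ (Finset.mem_univ i)
    rw [hcard, card_cyc (pow_ne_zero _ (hp i).ne_zero), natDegree_pow] at h1
    exact (Nat.pow_dvd_pow_iff_le_right one_lt_card).1 h1
  have hnX : ∀ i, e i ≠ 0 → ¬ X ∣ p i := by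
    rintro i hi hd
    obtain ⟨y, hy⟩ : X ∣ p i ^ e i := hd.trans (dvd_pow_self _ hi)
    have h1 : (X : k[X]) • (Submodule.Quotient.mk y : Cyc (p i ^ e i)) = 0 := by
      rw [← Submodule.Quotient.mk_smul, Submodule.Quotient.mk_eq_zero, smul_eq_mul, ← hy]
      exact Ideal.mem_span_singleton_self _
    have h2 := hX (E1.symm (Pi.single i (Submodule.Quotient.mk y)))
      (by rw [← map_smul, ← Pi.single_smul, h1, Pi.single_zero, map_zero])
    rw [LinearEquiv.map_eq_zero_iff, Pi.single_eq_zero_iff, Submodule.Quotient.mk_eq_zero,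
      Ideal.mem_span_singleton, hy] at h2
    have hy0 : y ≠ 0 := by
      rintro rfl
      rw [mul_zero] at hy
      exact pow_ne_zero _ (hp i).ne_zero hy
    have h3 : X * y ∣ 1 * y := by rwa [one_mul]
    exact irreducible_X.not_isUnit (isUnit_of_dvd_one ((mul_dvd_mul_iff_right hy0).1 h3))
  have ht : ∀ i : {i // e i ≠ 0}, ∃ c, π c = normalize (p i.1) := by
    rintro ⟨i, hi⟩
    refine hall _ (monic_normalize (hp i).ne_zero)
      ((normalize_associated _).irreducible_iff.2 (hp i)) (fun h => hnX i hi ?_) ?_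
    · rw [← h]
      exact (normalize_associated _).dvd
    · rw [natDegree_eq_of_degree_eq (degree_normalize (p := p i))]
      exact (Nat.le_mul_of_pos_left _ (Nat.pos_of_ne_zero hi)).trans (hdeg i)
  choose t ht using ht
  have hs : ∀ i : {i // e i ≠ 0}, ∃ j : Fin n, n - j = e i.1 := by
    rintro ⟨i, hi⟩
    have h1 := (Nat.le_mul_of_pos_right (e i) (hp i).natDegree_pos).trans (hdeg i)
    exact ⟨⟨n - e i, by omega⟩, Nat.sub_sub_self h1⟩
  choose s hs using hs
  obtain ⟨m, F, hF⟩ := exists_equiv_sigma_fin t s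
  obtain ⟨E2⟩ := nonempty_equiv_pi_subtype (R := k[X]) (fun i => Cyc (p i ^ e i))
    (fun i => e i ≠ 0) (fun i hi => by
      rw [not_not.1 hi, pow_zero]
      exact Submodule.Quotient.subsingleton_iff.2 Ideal.span_singleton_one)
  refine ⟨m, ⟨E1.trans (E2.trans ((LinearEquiv.piCongrLeft k[X]
    (fun i : {i // e i ≠ 0} => Cyc (p i.1 ^ e i.1)) F).symm.trans
      (LinearEquiv.piCongrRight fun i => Submodule.quotEquivOfEq _ _ ?_)))⟩⟩
  have h3 : π i.1 ^ (n - i.2.1 : ℕ) = normalize (p (F i).1) ^ e (F i).1 := by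
    have h4 := hs (F i)
    rw [(hF i).2] at h4
    rw [h4, ← ht, (hF i).1]
  rw [h3, Ideal.span_singleton_eq_span_singleton]
  exact (normalize_associated _).symm.pow_pow

/-- The conjugacy classes of `GL n` are parametrized by labels. -/
theorem exists_classes (hπ : ∀ c, (π c).Monic) (hi : ∀ c, Irreducible (π c))
    (hinj : Function.Injective π) (hX : ∀ c, π c ≠ X)
    (hall : ∀ f : k[X], f.Monic → Irreducible f → f ≠ X → f.natDegree ≤ n → f ∈ Set.range π) :
    ∃ K : {m : ι → Fin n → ℕ // lw (fun c => (π c).natDegree) m = n} → ConjClasses (GL (Fin n) k),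
      Function.Bijective K ∧ ∀ m, (K m).carrier.ncard * Nat.card (Module.End k[X] (Md π m.1))ˣ =
        Nat.card (GL (Fin n) k) := by
  have h1 : ∀ m : {m : ι → Fin n → ℕ // lw (fun c => (π c).natDegree) m = n},
      ∃ (φ : Md π m.1 ≃ₗ[k] (Fin n → k)) (g : GL (Fin n) k), IsRep φ g := by
    intro m
    have := finite_Md hπ m.1
    exact exists_isRep ((finrank_Md hπ m.1).trans m.2) fun x => X_smul_Md hπ hi hX
  choose φ g hg using h1
  refine ⟨fun m => ConjClasses.mk (g m), ⟨fun m m' h => ?_, fun c => ?_⟩,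
    fun m => card_class_mul (hg m)⟩
  · obtain ⟨e⟩ := (isConj_iff_nonempty_linearEquiv (hg m) (hg m')).1
      (ConjClasses.mk_eq_mk_iff_isConj.1 h)
    exact Subtype.ext (eq_of_linearEquiv hπ hi hinj e)
  · obtain ⟨x, rfl⟩ := ConjClasses.exists_rep c
    have hx := isRep_aeval x
    have hcard : Nat.card (Module.AEval' (glLin k n x : (Fin n → k) →ₗ[k] (Fin n → k))) =
        Fintype.card k ^ n := by
      rw [← Nat.card_congr (Module.AEval'.of _).toEquiv]
      simp
    obtain ⟨m, ⟨e⟩⟩ := exists_equiv_Md (π := π)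
      (Module.AEval.isTorsion_of_finiteDimensional k (Fin n → k)
        (glLin k n x : (Fin n → k) →ₗ[k] (Fin n → k))) hcard (fun y hy => by
          have h2 := hx y
          rw [hy, map_zero, eq_comm, LinearEquiv.map_eq_zero_iff, LinearEquiv.map_eq_zero_iff] at h2
          exact h2) hall
    have hm : lw (fun c => (π c).natDegree) m = n := by
      have h2 := card_Md hπ m
      rw [← Nat.card_congr e.toEquiv, hcard] at h2
      exact (Nat.pow_right_injective one_lt_card h2).symm
    exact ⟨⟨m, hm⟩, ConjClasses.mk_eq_mk_iff_isConj.2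
      ((isConj_iff_nonempty_linearEquiv (hg ⟨m, hm⟩) hx).2 ⟨e.symm⟩)⟩

end Classification

end

section

open Polynomial

section Count

variable {k : Type} [Field k] [Fintype k] {ι : Type} [Fintype ι] {n : ℕ} {π : ι → k[X]}

theorem finite_monic (n : ℕ) : Finite {f : k[X] // f.Monic ∧ f.natDegree = n} :=
  Finite.of_equiv _ ((monicEquivDegreeLT n).trans (degreeLTEquiv k n).toEquiv).symm

theorem card_monic (n : ℕ) :
    Nat.card {f : k[X] // f.Monic ∧ f.natDegree = n} = Fintype.card k ^ n := by
  rw [Nat.card_congr ((monicEquivDegreeLT n).trans (degreeLTEquiv k n).toEquiv)]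
  simp

theorem finite_multiplicities {d : ι → ℕ} (hd : ∀ c, 0 < d c) (n : ℕ) :
    Finite {m : ι → ℕ // ∑ c, d c * m c = n} := by
  refine Finite.of_injective (β := ι → Fin (n + 1)) (fun m c => ⟨m.1 c, ?_⟩) fun m m' h => ?_
  · have h1 := Finset.single_le_sum (f := fun c => d c * m.1 c) (fun _ _ => Nat.zero_le _)
      (Finset.mem_univ c)
    rw [m.2] at h1
    exact Nat.lt_succ_of_le ((Nat.le_mul_of_pos_left _ (hd c)).trans h1)
  · ext c
    exact congr_arg Fin.val (congr_fun h c)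

omit [Fintype k] in
/-- Factorization of monic polynomials not divisible by `X`. -/
theorem exists_multiplicities (hinj : Function.Injective π)
    (hall : ∀ f : k[X], f.Monic → Irreducible f → f ≠ X → f.natDegree ≤ n → f ∈ Set.range π)
    {f : k[X]} (hf : f.Monic) (hn : f.natDegree = n) (hX : ¬ X ∣ f) :
    ∃ m : ι → ℕ, ∏ c, π c ^ m c = f := by
  classical
  have hmem : ∀ g ∈ UniqueFactorizationMonoid.normalizedFactors f, g ∈ Set.range π := by
    intro g hg
    have hgi := UniqueFactorizationMonoid.irreducible_of_normalized_factor g hg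
    have hgd := UniqueFactorizationMonoid.dvd_of_mem_normalizedFactors hg
    refine hall g ?_ hgi (fun h => hX (h ▸ hgd)) (hn ▸ natDegree_le_of_dvd hgd hf.ne_zero)
    rw [← UniqueFactorizationMonoid.normalize_normalized_factor g hg]
    exact monic_normalize hgi.ne_zero
  refine ⟨fun c => (UniqueFactorizationMonoid.normalizedFactors f).count (π c), ?_⟩
  have h1 := UniqueFactorizationMonoid.prod_normalizedFactors_eq hf.ne_zero
  rw [hf.normalize_eq_self, Finset.prod_multiset_count] at h1
  refine Eq.trans ?_ h1
  refine (Finset.prod_image (s := Finset.univ) (g := π)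
    (f := fun g => g ^ (UniqueFactorizationMonoid.normalizedFactors f).count g)
    hinj.injOn).symm.trans ?_
  refine (Finset.prod_subset (fun g hg => ?_) fun g _ hg => ?_).symm
  · obtain ⟨c, rfl⟩ := hmem g (Multiset.mem_toFinset.1 hg)
    exact Finset.mem_image_of_mem _ (Finset.mem_univ c)
  · rw [Multiset.count_eq_zero_of_notMem (fun h => hg (Multiset.mem_toFinset.2 h)), pow_zero]

theorem card_pow_le (hπ : ∀ c, (π c).Monic) (hi : ∀ c, Irreducible (π c))
    (hinj : Function.Injective π)
    (hall : ∀ f : k[X], f.Monic → Irreducible f → f ≠ X → f.natDegree ≤ n + 1 → f ∈ Set.range π) :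
    Fintype.card k ^ (n + 1) ≤
      Nat.card {m : ι → ℕ // ∑ c, (π c).natDegree * m c = n + 1} + Fintype.card k ^ n := by
  have := finite_monic (k := k) n
  have := finite_multiplicities (d := fun c => (π c).natDegree) (fun c => (hi c).natDegree_pos)
    (n + 1)
  have hdeg : ∀ m : ι → ℕ, (∏ c, π c ^ m c).natDegree = ∑ c, (π c).natDegree * m c := by
    intro m
    rw [natDegree_prod_of_monic _ _ fun c _ => (hπ c).pow _]
    refine Finset.sum_congr rfl fun c _ => ?_
    rw [(hπ c).natDegree_pow, mul_comm]
  rw [← card_monic n, ← card_monic (k := k) (n + 1), ← Nat.card_sum]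
  refine Nat.card_le_card_of_surjective (Sum.elim
    (fun m => ⟨∏ c, π c ^ m.1 c, monic_prod_of_monic _ _ fun c _ => (hπ c).pow _,
      (hdeg m.1).trans m.2⟩)
    (fun f => ⟨X * f.1, monic_X.mul f.2.1, by
      rw [monic_X.natDegree_mul f.2.1, natDegree_X, f.2.2, add_comm]⟩)) ?_
  rintro ⟨f, hf, hn⟩
  by_cases hX : X ∣ f
  · obtain ⟨g, rfl⟩ := hX
    have hg : g.Monic := monic_X.of_mul_monic_left hf
    refine ⟨Sum.inr ⟨g, hg, ?_⟩, rfl⟩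
    rw [monic_X.natDegree_mul hg, natDegree_X] at hn
    omega
  · obtain ⟨m, rfl⟩ := exists_multiplicities hinj hall hf hn hX
    exact ⟨Sum.inl ⟨m, (hdeg m).symm.trans hn⟩, rfl⟩

theorem card_multiplicities_le {d : ι → ℕ} (hd : ∀ c, 0 < d c) (n : ℕ) :
    Nat.card {m : ι → ℕ // ∑ c, d c * m c = n + 1} ≤
      Nat.card {m : ι → Fin (n + 1) → ℕ // lw d m = n + 1} := by
  classical
  have : Finite {m : ι → Fin (n + 1) → ℕ // lw d m = n + 1} :=
    finite_labels (w := fun j : Fin (n + 1) => n + 1 - (j : ℕ)) hd (fun j => by omega) _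
  refine Nat.card_le_card_of_injective
    (fun m => ⟨fun c j => if j = Fin.last n then m.1 c else 0, ?_⟩) fun m m' h => ?_
  · refine Eq.trans ?_ m.2
    refine Finset.sum_congr rfl fun c _ => ?_
    rw [Finset.sum_eq_single (Fin.last n) (fun j _ hj => by simp [hj]) (by simp)]
    simp
  · ext c
    have h1 := congr_fun (congr_fun (congrArg Subtype.val h) c) (Fin.last n)
    simpa using h1

theorem sum_support_le {d : ι → ℕ} (hd : ∀ c, 0 < d c) {m : ι → Fin (n + 1) → ℕ}
    (hm : lw d m = n + 1) (hr : ¬ IsReg m) : ∑ c with m c ≠ 0, d c ≤ n := by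
  classical
  let w : ι → ℕ := fun c => ∑ j : Fin (n + 1), (n + 1 - (j : ℕ)) * m c j
  have hle : ∀ c (j : Fin (n + 1)), (n + 1 - (j : ℕ)) * m c j ≤ w c := fun c j =>
    Finset.single_le_sum (f := fun j : Fin (n + 1) => (n + 1 - (j : ℕ)) * m c j)
      (fun _ _ => Nat.zero_le _) (Finset.mem_univ j)
  have hw : ∀ c, m c ≠ 0 → 1 ≤ w c := by
    intro c hc
    obtain ⟨j, hj⟩ := Function.ne_iff.1 hc
    exact (Nat.mul_pos (by omega) (Nat.pos_of_ne_zero hj)).trans_le (hle c j)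
  obtain ⟨c₀, hc₀⟩ : ∃ c, 2 ≤ w c := by
    simp only [IsReg, not_forall] at hr
    obtain ⟨c, j, h⟩ := hr
    refine ⟨c, le_trans ?_ (hle c j)⟩
    rw [not_and_or, not_le, Classical.not_imp] at h
    rcases h with h | ⟨h1, h2⟩
    · exact le_trans (Nat.succ_le_of_lt h) (Nat.le_mul_of_pos_left _ (by omega))
    · exact Nat.mul_le_mul (show 2 ≤ n + 1 - (j : ℕ) by omega) (Nat.pos_of_ne_zero h2)
  have h1 : ∑ c with m c ≠ 0, d c + d c₀ ≤ ∑ c, d c * w c := by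
    have h3 : d c₀ = ∑ c, if c = c₀ then d c else 0 := by simp
    rw [Finset.sum_filter, h3, ← Finset.sum_add_distrib]
    refine Finset.sum_le_sum fun c _ => ?_
    have h4 := hw c
    split_ifs with h5 h6 h6
    · rw [h6]
      nlinarith
    · have := h4 h5
      nlinarith
    · rw [h6]
      nlinarith
    · exact Nat.zero_le _
  have h2 : ∑ c, d c * w c = n + 1 := hm
  have := hd c₀
  omega

/-- Irregular labels are rare. -/
theorem card_irregular_le (hπ : ∀ c, (π c).Monic) (hi : ∀ c, Irreducible (π c))
    (hinj : Function.Injective π) (hX : ∀ c, π c ≠ X) :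
    Nat.card {m : ι → Fin (n + 1) → ℕ // lw (fun c => (π c).natDegree) m = n + 1 ∧ ¬ IsReg m} ≤
      (n + 2) ^ ((n + 1) * (n + 1)) * Fintype.card k ^ n := by
  classical
  have := finite_monic (k := k) n
  have hd : ∀ c, 0 < (π c).natDegree := fun c => (hi c).natDegree_pos
  have hr : ∀ g : {f : k[X] // f.Monic ∧ f.natDegree = n},
      ∃ r : ι → Fin (n + 1), Set.InjOn r {c | π c ∣ g.1} := by
    rintro ⟨g, hg, hgn⟩
    have h1 : ∏ c with π c ∣ g, π c ∣ g :=
      Finset.prod_dvd_of_coprime (fun c _ c' _ h => isCoprime_of_ne hπ hi hinj h)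
        fun c hc => (Finset.mem_filter.1 hc).2
    have h2 := natDegree_le_of_dvd h1 hg.ne_zero
    rw [natDegree_prod_of_monic _ _ fun c _ => hπ c, hgn] at h2
    have h3 : (Finset.univ.filter fun c => π c ∣ g).card ≤ n := by
      rw [Finset.card_eq_sum_ones]
      exact (Finset.sum_le_sum fun c _ => hd c).trans h2
    have h4 : Nonempty ({c // π c ∣ g} ↪ Fin (n + 1)) := by
      refine Function.Embedding.nonempty_of_card_le ?_
      rw [Fintype.card_subtype, Fintype.card_fin]
      omega
    obtain ⟨E⟩ := h4
    refine ⟨fun c => if h : π c ∣ g then E ⟨c, h⟩ else 0, fun c hc c' hc' h => ?_⟩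
    have h5 : E ⟨c, hc⟩ = E ⟨c', hc'⟩ := by
      simpa only [dif_pos (show π c ∣ g from hc), dif_pos (show π c' ∣ g from hc')] using h
    exact congrArg Subtype.val (E.injective h5)
  choose r hr using hr
  have hcard : Nat.card ((Fin (n + 1) → Fin (n + 1) → Fin (n + 2)) ×
      {f : k[X] // f.Monic ∧ f.natDegree = n}) =
      (n + 2) ^ ((n + 1) * (n + 1)) * Fintype.card k ^ n := by
    rw [Nat.card_prod, card_monic]
    simp [pow_mul]
  rw [← hcard]
  refine (Nat.card_mono (t := Set.range fun (x : (Fin (n + 1) → Fin (n + 1) → Fin (n + 2)) ×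
    {f : k[X] // f.Monic ∧ f.natDegree = n}) (c : ι) (j : Fin (n + 1)) =>
      if π c ∣ x.2.1 then (x.1 (r x.2 c) j : ℕ) else 0) (Set.finite_range _) ?_).trans
      (Finite.card_range_le _)
  rintro m ⟨hm, hreg⟩
  have hS := sum_support_le hd hm hreg
  have hne : Nonempty ι := by
    by_contra h
    rw [not_nonempty_iff] at h
    exact hreg fun c => h.elim c
  let g : k[X] := X ^ (n - ∑ c with m c ≠ 0, (π c).natDegree) * ∏ c with m c ≠ 0, π c
  have hp : (∏ c with m c ≠ 0, π c).Monic := monic_prod_of_monic _ _ fun c _ => hπ c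
  have hg : g.Monic := (monic_X_pow _).mul hp
  have hgn : g.natDegree = n := by
    rw [(monic_X_pow _).natDegree_mul hp, natDegree_X_pow,
      natDegree_prod_of_monic _ _ fun c _ => hπ c, Nat.sub_add_cancel hS]
  have hdvd : ∀ c, π c ∣ g ↔ m c ≠ 0 := by
    intro c
    refine ⟨fun h => ?_, fun h => (Finset.dvd_prod_of_mem π
      (Finset.mem_filter.2 ⟨Finset.mem_univ c, h⟩)).mul_left _⟩
    rcases (hi c).prime.dvd_or_dvd h with h | h
    · have h1 := (hi c).prime.dvd_of_dvd_pow h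
      exact absurd (eq_of_monic_of_associated (hπ c) monic_X
        ((hi c).associated_of_dvd irreducible_X h1)) (hX c)
    · obtain ⟨c', hc', h1⟩ := (hi c).prime.exists_mem_finset_dvd h
      rw [hinj (eq_of_monic_of_associated (hπ c) (hπ c')
        ((hi c).associated_of_dvd (hi c') h1))]
      exact (Finset.mem_filter.1 hc').2
  refine ⟨(fun i j => ⟨m (Function.invFunOn (r ⟨g, hg, hgn⟩) {c | π c ∣ g} i) j,
    Nat.lt_succ_of_le (le_of_sum_eq (w := fun j : Fin (n + 1) => n + 1 - (j : ℕ)) hd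
      (fun j => by omega) hm _ _)⟩, ⟨g, hg, hgn⟩), ?_⟩
  funext c j
  by_cases hc : m c = 0
  · have h1 : ¬ π c ∣ g := fun h => (hdvd c).1 h hc
    simp only [if_neg h1, hc, Pi.zero_apply]
  · have h1 : π c ∣ g := (hdvd c).2 hc
    have h2 := (hr ⟨g, hg, hgn⟩).leftInvOn_invFunOn h1
    simp only [if_pos h1]
    rw [h2]

end Count

end

section

open Polynomial

section Arithmetic

theorem dvd_of_dvd_pow_mul {p a b u s S : ℕ} (hu : Nat.Coprime p u) (ha : a ∣ p ^ s * u)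
    (hb : p ^ s ∣ b) (h : a ∣ p ^ S * b) : a ∣ b := by
  obtain ⟨x, y, hx, hy, rfl⟩ := Nat.dvd_mul.1 ha
  have h1 : Nat.Coprime p y := hu.coprime_dvd_right hy
  refine Nat.Coprime.mul_dvd_of_dvd_of_dvd ?_ (hx.trans hb) ?_
  · exact (h1.pow_left s).coprime_dvd_left hx
  · exact (h1.symm.pow_right S).dvd_of_dvd_mul_left ((Dvd.intro_left x rfl).trans h)

theorem prod_dvd_prod_of_card_le {L : Type*} [Fintype L] {D K E : L → ℕ} {R : L → Prop}
    {p q r t u : ℕ} (hq : q = p ^ r) (hu : Nat.Coprime p u) (h : ∀ m, ∃ s, D m ∣ p ^ s * K m)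
    (hD : ∀ m, D m ∣ q ^ E m * u) (hR : ∀ m, R m → E m = 0) (hE : ∀ m, E m ≤ t)
    (hK : ∀ m, R m → q ^ t ∣ K m) (hc : Nat.card {m // ¬ R m} ≤ Nat.card {m // R m}) :
    ∏ m, D m ∣ ∏ m, K m := by
  classical
  choose s hs using h
  have hcr : Nat.card {m // R m} = (Finset.univ.filter R).card := by
    rw [Nat.card_eq_fintype_card, Fintype.card_subtype]
  have hcn : Nat.card {m // ¬ R m} = (Finset.univ.filter fun m => ¬ R m).card := by
    rw [Nat.card_eq_fintype_card, Fintype.card_subtype]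
  have h1 : ∏ m, D m ∣ p ^ (r * ∑ m, E m) * u ^ Fintype.card L := by
    have := Finset.prod_dvd_prod_of_dvd _ _ fun m (_ : m ∈ Finset.univ) => hD m
    rwa [Finset.prod_mul_distrib, Finset.prod_pow_eq_pow_sum, Finset.prod_const,
      Finset.card_univ, hq, ← pow_mul] at this
  have h2 : ∏ m, D m ∣ p ^ (∑ m, s m) * ∏ m, K m := by
    have := Finset.prod_dvd_prod_of_dvd _ _ fun m (_ : m ∈ Finset.univ) => hs m
    rwa [Finset.prod_mul_distrib, Finset.prod_pow_eq_pow_sum] at this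
  have h3 : ∑ m, E m ≤ t * Nat.card {m // R m} := by
    rw [← Finset.sum_filter_add_sum_filter_not _ R,
      Finset.sum_eq_zero (s := Finset.univ.filter R) fun m hm => hR m (Finset.mem_filter.1 hm).2,
      zero_add]
    refine (Finset.sum_le_card_nsmul _ _ t fun m _ => hE m).trans ?_
    rw [← hcn, smul_eq_mul, mul_comm]
    exact Nat.mul_le_mul_left _ hc
  have h4 : q ^ (t * Nat.card {m // R m}) ∣ ∏ m, K m := by
    rw [hcr, pow_mul, ← Finset.prod_const]
    exact (Finset.prod_dvd_prod_of_dvd _ _ fun m hm => hK m (Finset.mem_filter.1 hm).2).trans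
      (Finset.prod_dvd_prod_of_subset _ _ _ (Finset.filter_subset _ _))
  refine dvd_of_dvd_pow_mul (hu.pow_right _) h1 ?_ h2
  rw [pow_mul, ← hq]
  exact (pow_dvd_pow _ h3).trans h4

end Arithmetic

variable {k : Type} [Field k] [Fintype k] {ψ : AddChar k ℂ}

theorem card_subtype_fiber {T : Type*} {p : T → Prop} {d : T → ℕ} {i : ℕ}
    (h : ∀ t, d t = i → p t) :
    Nat.card {t : {t // p t} // d t.1 = i} = Nat.card {t // d t = i} :=
  Nat.card_congr ⟨fun t => ⟨t.1.1, t.2⟩, fun t => ⟨⟨t.1, h _ t.2⟩, t.2⟩,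
    fun _ => rfl, fun _ => rfl⟩

/-- A common labelling of the small cuspidal characters and of the small irreducible
polynomials. -/
theorem exists_labels (hψ : ψ ≠ 1) (n : ℕ) :
    ∃ (ι : Type) (_ : Fintype ι) (π : ι → k[X]) (ρ : ι → Ir k) (e : ι → ℕ → Ir k),
      (∀ c, (π c).Monic) ∧ (∀ c, Irreducible (π c)) ∧ Function.Injective π ∧ (∀ c, π c ≠ X) ∧
      (∀ f : k[X], f.Monic → Irreducible f → f ≠ X → f.natDegree ≤ n → f ∈ Set.range π) ∧
      (∀ c, DivSeq ψ (ρ c) (e c)) ∧ Function.Injective ρ ∧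
      (∀ x, IsCusp x → x.deg ≤ n → x ∈ Set.range ρ) ∧ ∀ c, (ρ c).deg = (π c).natDegree := by
  classical
  let T := {f : k[X] // f.Monic ∧ Irreducible f ∧ f ≠ X}
  let d : T → ℕ := fun t => t.1.natDegree
  have hd : ∀ t, 0 < d t := fun t => t.2.2.1.natDegree_pos
  have hfin : ∀ n, Finite {t // d t ≤ n} := fun n => by
    have := fun i => finite_monic (k := k) i
    refine Finite.of_injective (β := Σ i : Fin (n + 1), {f : k[X] // f.Monic ∧ f.natDegree = i})
      (fun t => ⟨⟨d t.1, Nat.lt_succ_of_le t.2⟩, t.1.1, t.1.2.1, rfl⟩) fun t t' h => ?_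
    have h' := congrArg (fun z : Σ i : Fin (n + 1), {f : k[X] // f.Monic ∧ f.natDegree = i} =>
      z.2.1) h
    exact Subtype.ext (Subtype.ext h')
  let _ : ∀ n, Fintype {t // d t ≤ n} := fun n => Fintype.ofFinite _
  have hm : ∀ n, ∀ c : {t // d t ≤ n}, c.1.1.Monic := fun _ c => c.1.2.1
  have hi : ∀ n, ∀ c : {t // d t ≤ n}, Irreducible c.1.1 := fun _ c => c.1.2.2.1
  have hX : ∀ n, ∀ c : {t // d t ≤ n}, c.1.1 ≠ X := fun _ c => c.1.2.2.2
  have hinj : ∀ n, Function.Injective fun c : {t // d t ≤ n} => c.1.1 := fun _ c c' h =>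
    Subtype.ext (Subtype.ext h)
  have hall : ∀ n, ∀ f : k[X], f.Monic → Irreducible f → f ≠ X → f.natDegree ≤ n →
      f ∈ Set.range fun c : {t // d t ≤ n} => c.1.1 := fun n f h1 h2 h3 h4 =>
    ⟨⟨⟨f, h1, h2, h3⟩, h4⟩, rfl⟩
  have hcount := cusp_count hψ d hd (fun n _ => by
      obtain ⟨K, hK, -⟩ := exists_classes (hm n) (hi n) (hinj n) (hX n) (hall n)
      exact (Nat.card_eq_of_bijective K hK).symm)
    fun n => card_pow_le (hm _) (hi _) (hinj _) (hall _)
  obtain ⟨σ, hσ⟩ := exists_equiv_of_card_fiber_eq (T := {t // d t ≤ n})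
    (T' := {x : Ir k // IsCusp x ∧ x.deg < n + 1}) (fun t => d t.1) (fun x => x.1.deg) fun i => by
      by_cases h : i < n + 1
      · rw [(card_subtype_fiber (p := fun t => d t ≤ n) fun t ht => by omega :
          Nat.card {t : {t // d t ≤ n} // d t.1 = i} = _), ← (hcount i).2]
        exact Nat.card_congr ⟨fun x => ⟨⟨x.1, x.2.1, x.2.2.trans_lt h⟩, x.2.2⟩,
          fun x => ⟨x.1.1, x.1.2.1, x.2⟩, fun _ => rfl, fun _ => rfl⟩
      · have i1 : IsEmpty {t : {t // d t ≤ n} // d t.1 = i} :=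
          ⟨fun t => h (t.2 ▸ Nat.lt_succ_of_le t.1.2)⟩
        have i2 : IsEmpty {c : {x : Ir k // IsCusp x ∧ x.deg < n + 1} // c.1.deg = i} :=
          ⟨fun t => h (t.2 ▸ t.1.2.2)⟩
        simp
  choose e he using fun c => (σ c).2.1.exists_divSeq hψ ((hcount _).1 _ (σ c).2.1 rfl)
  refine ⟨{t // d t ≤ n}, inferInstance, fun c => c.1.1, fun c => (σ c).1, e, hm n, hi n, hinj n,
    hX n, hall n, he, Subtype.val_injective.comp σ.injective, fun x h1 h2 => ?_, hσ⟩
  exact ⟨σ.symm ⟨x, h1, Nat.lt_succ_of_le h2⟩, by simp⟩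

/-- The labels of the irreducible characters of a fixed general linear group. -/
theorem exists_chars {ι : Type} [Fintype ι] [DecidableEq ι] {ρ : ι → Ir k} {e : ι → ℕ → Ir k}
    (he : ∀ c, DivSeq ψ (ρ c) (e c)) (hρ : Function.Injective ρ) {n : ℕ}
    (h : ∀ x, IsCusp x → x.deg ≤ n → x ∈ Set.range ρ) {d : ι → ℕ} (hd : ∀ c, (ρ c).deg = d c) :
    ∃ χ : {m : ι → Fin n → ℕ // lw d m = n} → irrSet (GL (Fin n) k),
      Function.Bijective χ ∧ ∀ m, irr he hρ m.1 = ⟨n, χ m⟩ := by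
  obtain rfl := funext hd
  have h1 : ∀ m : {m : ι → Fin n → ℕ // lw (fun c => (ρ c).deg) m = n},
      ∃ χ : irrSet (GL (Fin n) k), irr he hρ m.1 = ⟨n, χ⟩ := fun m => by
    have h2 := (irr_mem_labels he hρ m.2).1
    generalize irr he hρ m.1 = x at h2 ⊢
    obtain ⟨i, χ⟩ := x
    obtain rfl : i = n := h2
    exact ⟨χ, rfl⟩
  choose χ hχ using h1
  have hb := irr_bijective he hρ n fun y hy hn => h y hy hn.le
  refine ⟨χ, ⟨fun m m' hm => Subtype.ext (irr_injective he hρ ?_), fun x => ?_⟩, hχ⟩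
  · rw [hχ, hχ, hm]
  · obtain ⟨m, hm⟩ := hb.2 ⟨⟨n, x⟩, rfl, fun hc => h _ hc le_rfl⟩
    have h3 : irr he hρ m.1 = ⟨n, x⟩ := congrArg Subtype.val hm
    rw [hχ] at h3
    exact ⟨m, eq_of_heq (Sigma.mk.inj h3).2⟩

theorem card_not_isReg_le {ι : Type} [Fintype ι] {n : ℕ} {π : ι → k[X]}
    (hπ : ∀ c, (π c).Monic) (hi : ∀ c, Irreducible (π c))
    (hinj : Function.Injective π) (hX : ∀ c, π c ≠ X)
    (hall : ∀ f : k[X], f.Monic → Irreducible f → f ≠ X → f.natDegree ≤ n + 1 → f ∈ Set.range π)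
    (hq : 2 * (n + 2) ^ ((n + 1) * (n + 1)) + 1 ≤ Fintype.card k) :
    Nat.card {m : {m : ι → Fin (n + 1) → ℕ // lw (fun c => (π c).natDegree) m = n + 1} //
        ¬ IsReg m.1} ≤
      Nat.card {m : {m : ι → Fin (n + 1) → ℕ // lw (fun c => (π c).natDegree) m = n + 1} //
        IsReg m.1} := by
  classical
  have hd : ∀ c, 0 < (π c).natDegree := fun c => (hi c).natDegree_pos
  have hf : Finite {m : ι → Fin (n + 1) → ℕ // lw (fun c => (π c).natDegree) m = n + 1} :=
    finite_labels (w := fun j : Fin (n + 1) => n + 1 - (j : ℕ)) hd (fun j => by omega) _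
  have h1 := (card_pow_le hπ hi hinj hall).trans
    (Nat.add_le_add_right (card_multiplicities_le hd n) _)
  have h2 := card_irregular_le (n := n) hπ hi hinj hX
  have h3 := Nat.card_congr (Equiv.sumCompl fun m :
    {m : ι → Fin (n + 1) → ℕ // lw (fun c => (π c).natDegree) m = n + 1} => IsReg m.1)
  rw [Nat.card_sum] at h3
  have h4 := Nat.card_congr (Equiv.subtypeSubtypeEquivSubtypeInter
    (fun m : ι → Fin (n + 1) → ℕ => lw (fun c => (π c).natDegree) m = n + 1) fun m => ¬ IsReg m)
  rw [← h4] at h2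
  have h5 := Nat.mul_le_mul_right (Fintype.card k ^ n) hq
  rw [← pow_succ'] at h5
  rw [add_mul, one_mul, mul_assoc] at h5
  omega

theorem prod_degree_dvd (n : ℕ) (hq : 2 * (n + 2) ^ ((n + 1) * (n + 1)) + 1 ≤ Fintype.card k)
    [Fintype (ConjClasses (GL (Fin (n + 1)) k))] :
    ∏ χ : irrSet (GL (Fin (n + 1)) k), degree χ ∣
      ∏ c : ConjClasses (GL (Fin (n + 1)) k), c.carrier.ncard := by
  classical
  obtain ⟨ψ, hψ⟩ : ∃ ψ : AddChar k ℂ, ψ ≠ 1 := by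
    obtain ⟨ψ, hψ⟩ := AddChar.exists_apply_ne_zero.2 (one_ne_zero (α := k))
    exact ⟨ψ, fun h => hψ (by rw [h, AddChar.one_apply])⟩
  obtain ⟨ι, _, π, ρ, e, hπ, hi, hinj, hX, hall, he, hρ, hcusp, hdeg⟩ := exists_labels hψ (n + 1)
  have hd : ∀ c, 0 < (π c).natDegree := fun c => (hi c).natDegree_pos
  obtain ⟨K, hK, hK'⟩ := exists_classes hπ hi hinj hX hall
  obtain ⟨χ, hχ, hχ'⟩ := exists_chars he hρ hcusp hdeg
  have hdvd1 := fun m => degree_mul_dvd he hρ _ hψ (hχ' m)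
  have hdvd2 := fun m => degree_dvd he hρ _ hψ (hχ' m)
  simp only [hdeg] at hdvd1 hdvd2
  have hf : Finite {m : ι → Fin (n + 1) → ℕ // lw (fun c => (π c).natDegree) m = n + 1} :=
    finite_labels (w := fun j : Fin (n + 1) => n + 1 - (j : ℕ)) hd (fun j => by omega) _
  let _ := Fintype.ofFinite {m : ι → Fin (n + 1) → ℕ // lw (fun c => (π c).natDegree) m = n + 1}
  obtain ⟨p, hp⟩ := CharP.exists k
  obtain ⟨r, hpp, hqr⟩ := FiniteField.card k p
  have : Fact p.Prime := ⟨hpp⟩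
  have hpq : p ∣ Fintype.card k := hqr ▸ dvd_pow_self p r.ne_zero
  have hu : Nat.Coprime p (cop (Fintype.card k) (n + 1)) := coprime_cop hpq Fintype.card_pos _
  rw [← Equiv.prod_comp (Equiv.ofBijective χ hχ), ← Equiv.prod_comp (Equiv.ofBijective K hK)]
  simp only [Equiv.ofBijective_apply]
  refine prod_dvd_prod_of_card_le (R := fun m => IsReg m.1) (t := (n + 1).choose 2)
    (E := fun m => expQ (fun c => (π c).natDegree) m.1) hqr hu (fun m => ?_) hdvd2
    (fun m hm => expQ_eq_zero hm) (fun m => expQ_le hd m.2) (fun m hm => ?_)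
    (card_not_isReg_le hπ hi hinj hX hall hq)
  · obtain ⟨a, ha⟩ := card_units_Md_dvd p hπ hi hinj m.1
    have h1 := hK' m
    rw [card_GL_eq] at h1
    refine ⟨a + r * expQ (fun c => (π c).natDegree) m.1, ?_⟩
    have hG : 0 < ∏ c, ∏ j, cop (Fintype.card k ^ (π c).natDegree) (m.1 c j) :=
      Finset.prod_pos fun c _ => Finset.prod_pos fun j _ =>
        cop_pos (Nat.one_lt_pow (hd c).ne' one_lt_card) _
    refine Nat.dvd_of_mul_dvd_mul_right hG ((hdvd1 m).trans ?_)
    have h2 : cop (Fintype.card k) (n + 1) ∣ (K m).carrier.ncard *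
        (p ^ a * ∏ c, ∏ j, cop (Fintype.card k ^ (π c).natDegree) (m.1 c j)) :=
      (Dvd.intro_left _ h1.symm).trans (Nat.mul_dvd_mul_left _ ha)
    rw [hqr, ← pow_mul, ← hqr]
    refine (Nat.mul_dvd_mul_left _ h2).trans (dvd_of_eq ?_)
    rw [pow_add]
    ring
  · have h1 := hK' m
    rw [card_GL_eq] at h1
    have h2 := coprime_card_units_Md hpq hπ hi hinj hm
    rw [hqr, ← pow_mul]
    refine (h2.pow_left _).dvd_of_dvd_mul_right (n := Nat.card _) ?_
    rw [h1, pow_mul, ← hqr]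
    exact Dvd.intro _ rfl

/-- For large fields the product of the degrees divides the product of the class sizes. -/
theorem exists_groupH_eq (n : ℕ) (hq : 2 * (n + 2) ^ ((n + 1) * (n + 1)) + 1 ≤ Fintype.card k) :
    ∃ z : ℤ, groupH (GL (Fin (n + 1)) k) = z := by
  classical
  let _ := Fintype.ofFinite (ConjClasses (GL (Fin (n + 1)) k))
  obtain ⟨z, hz⟩ := prod_degree_dvd n hq
  refine ⟨z, ?_⟩
  have h0 : (∏ χ : irrSet (GL (Fin (n + 1)) k), (degree χ : ℚ)) ≠ 0 :=
    Finset.prod_ne_zero_iff.2 fun χ _ => Nat.cast_ne_zero.2 (degree_pos χ).ne'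
  rw [groupH_eq, finprod_eq_prod_of_fintype, div_eq_iff h0, mul_comm]
  exact_mod_cast hz

end

end HaradaGL

/-- For every `n ≥ 1` there is a bound `qn` such that `h(GL_n(k))` is an integer for
every finite field `k` with more than `qn` elements. -/
theorem harada_GL_large_q (n : ℕ) (hn : 0 < n) :
    ∃ qn : ℕ, ∀ (k : Type) [Field k] [Fintype k], qn < Fintype.card k →
      ∃ z : ℤ, groupH (GL (Fin n) k) = (z : ℚ) := by
  obtain ⟨n, rfl⟩ := Nat.exists_eq_add_one_of_ne_zero hn.ne'
  exact ⟨2 * (n + 2) ^ ((n + 1) * (n + 1)), fun k _ _ hq => HaradaGL.exists_groupH_eq n hq⟩
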